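/- Take the parameters ϱ_l to be the moments of the measure, with ϱ₀ ≠ 0, and let J = {2,…,B}. For all integers g ≥ 0 and B ≥ 2 with 2−2g−B < 0, the multi-boundary functions satisfy, for all admissible z₁ and nonzero pairwise non-opposite z₂,…,z_B: 0 = K̂_{z₁}G_g(z₁|z◁_J) + λ·G_{g−1}(z₁|z₁|z◁_J) + λ·Σ_{h=0}^{g}Σ_{I⊆J, 1≤|I|≤B−2} G_h(z₁|z◁_I)·G_{g−h}(z₁|z◁_{J∖I}) + Σ_{h=1}^{g} G_h(z₁)·G_{g−h}(z₁|z◁_J) + ((2λ)³/(2λ)^{δ_{B,2}})·Σ_{β∈J}(1/z_β)·(∂/∂z_β)[(G_g(z₁|z◁_{J∖{β}}) − G_g(z_β|z◁_{J∖{β}}))/(z₁²−z_β²)], where K̂ acts on the z₁-dependence, G_g(z◁_I) denotes the multi-boundary function with boundaries labelled by I, G_g(z₁|z◁_∅) := G_g(z₁), G₀(z₁|z◁_J) is excluded from the product terms only where g−h = 0 and J∖I = ∅, the term with G_{g−1} is absent for g = 0, and G_{g−1}(z₁|z₁|z◁_J) denotes the value at w = z₁ of the rational function w ↦ (2λ)³·Â†_{(z₁,z_J),w}G_{g−1}(z₁|z◁_J)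 (regular at w = z₁). -/

import Mathlib

open scoped BigOperators
open MeasureTheory

noncomputable section

namespace NCQFT

/-! ### Measure data: the planar 1‑point function `G0fun`, the moments and the operator `K̂`. -/

/-- The planar one-point function `𝒢₀(z) = s·z − n̄ + ½∫ᵃᵇ r(y)/((z+y)y) dy`. -/
def G0fun (a b s nbar : ℝ) (r : ℝ → ℝ) (z : ℂ) : ℂ :=
  (s : ℂ) * z - (nbar : ℂ) + (1 / 2) * ∫ y in a..b, (r y : ℂ) / ((z + (y : ℂ)) * (y : ℂ))

/-- Moments `ϱ_l = s·δ_{l,0} − ½∫ᵃᵇ r(y)/y^{3+2l} dy` of the measure. -/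
def moment (a b s : ℝ) (r : ℝ → ℝ) (l : ℕ) : ℝ :=
  (if l = 0 then s else 0) - (1 / 2) * ∫ y in a..b, r y / y ^ (3 + 2 * l)

/-- The integral operator `K̂`. -/
def Khat (a b s nbar : ℝ) (r : ℝ → ℝ) (f : ℂ → ℂ) (z : ℂ) : ℂ :=
  G0fun a b s nbar r z * f z + (nbar : ℂ) * f z
    + (1 / 2) * ∫ y in a..b, (r y : ℂ) * (f z - f (y : ℂ)) / (z ^ 2 - (y : ℂ) ^ 2)

/-- Admissible points: `z ∉ [a,b] ∪ (−[a,b]) ∪ {0}`. -/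
def Admissible (a b : ℝ) (z : ℂ) : Prop :=
  z ≠ 0 ∧ ∀ y : ℝ, y ∈ Set.Icc a b → z ≠ (y : ℂ) ∧ z ≠ -(y : ℂ)

/-! ### Partial Bell polynomials and the polynomials `S_m(ϱ)`. -/

/-- Partial Bell polynomial `B_{n,k}(x₁,…,x_{n−k+1})`. -/
def bellP (n k : ℕ) (x : ℕ → ℝ) : ℝ :=
  ∑ j : Fin n → Fin (n + 1),
    if (∑ i : Fin n, (j i : ℕ)) = k ∧ (∑ i : Fin n, ((i : ℕ) + 1) * (j i : ℕ)) = n then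
      (n.factorial : ℝ) / (∏ i : Fin n, ((j i : ℕ).factorial : ℝ)) *
        ∏ i : Fin n, (x ((i : ℕ) + 1) / (((i : ℕ) + 1).factorial : ℝ)) ^ (j i : ℕ)
    else 0

/-- `S_m(ϱ) = Σ_{i=0}^m (−1)^i i! ϱ₀^{−i} B_{m,i}(1!ϱ₁,…,(m−i+1)!ϱ_{m−i+1})`. -/
def Sm (ρ : ℕ → ℝ) (m : ℕ) : ℝ :=
  ∑ i ∈ Finset.range (m + 1),
    (-1) ^ i * (i.factorial : ℝ) * ((ρ 0)⁻¹) ^ i *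
      bellP m i (fun j => (j.factorial : ℝ) * ρ j)

/-! ### Partial derivatives in the moment variables. -/

/-- Partial derivative `∂/∂ϱ_l` of a real-valued function of the moments. -/
def pdR (c : (ℕ → ℝ) → ℝ) (l : ℕ) (ρ : ℕ → ℝ) : ℝ :=
  deriv (fun t => c (Function.update ρ l t)) (ρ l)

/-- Partial derivative `∂/∂ϱ_l` of a complex-valued function of the moments. -/
def pdC (c : (ℕ → ℝ) → ℂ) (l : ℕ) (ρ : ℕ → ℝ) : ℂ :=
  deriv (fun t : ℝ => c (Function.update ρ l t)) (ρ l)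

/-! ### Boundary creation operators. -/

/-- Boundary creation operator `Â†_{z_J,w}` with free creation variable `w`, acting on a
family `F` of the moments `ϱ` and boundary variables `(z_i)_{i∈J}`. -/
def AdagFree (J : Finset ℕ) (F : (ℕ → ℝ) → (ℕ → ℂ) → ℂ)
    (ρ : ℕ → ℝ) (z : ℕ → ℂ) (w : ℂ) : ℂ :=
  (∑' l : ℕ, (-((3 + 2 * (l : ℂ)) * (ρ (l + 1) : ℂ)) / ((ρ 0 : ℂ) * w ^ 3)
      + (3 + 2 * (l : ℂ)) / w ^ (5 + 2 * l)) * pdC (fun σ => F σ z) l ρ)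
  + ∑ i ∈ J, (1 / ((ρ 0 : ℂ) * w ^ 3 * z i)) *
      deriv (fun v => F ρ (Function.update z i v)) (z i)

/-- Boundary creation operator creating a boundary at coordinate `p`. -/
def AdagVar (J : Finset ℕ) (p : ℕ) (F : (ℕ → ℝ) → (ℕ → ℂ) → ℂ) :
    (ℕ → ℝ) → (ℕ → ℂ) → ℂ :=
  fun ρ z => AdagFree J F ρ z (z p)

/-- Boundary creation operator `Â†_w` acting on scalar functions of the moments only. -/
def AdagScalar (F : (ℕ → ℝ) → ℝ) (ρ : ℕ → ℝ) (w : ℂ) : ℂ :=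
  ∑' l : ℕ, (-((3 + 2 * (l : ℂ)) * (ρ (l + 1) : ℂ)) / ((ρ 0 : ℂ) * w ^ 3)
      + (3 + 2 * (l : ℂ)) / w ^ (5 + 2 * l)) * (pdR F l ρ : ℂ)

/-! ### The genus recursion for the 1-boundary functions `𝒢_g(z) = Σ_k c_{g,k}(ϱ)/z^{2k+3}`. -/

/-- Coefficients `e_m(ϱ)` of the even bracket
`w²·(Σ_{h=1}^{g-1} G_h(w)G_{g−h}(w) + (2λ)²·G_{g−1}(w|w))`, expressed through the table
`prev` of the coefficients of the lower-genus one-boundary functions. -/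
def eBr (lam : ℝ) (g : ℕ) (prev : ℕ → ℕ → (ℕ → ℝ) → ℝ) (m : ℕ) (ρ : ℕ → ℝ) : ℝ :=
  (∑ h ∈ Finset.Icc 1 (g - 1), ∑ i ∈ Finset.range (m + 1), ∑ j ∈ Finset.range (m + 1),
      if i + j + 2 = m then prev h i ρ * prev (g - h) j ρ else 0)
  + (2 * lam) ^ 4 *
    ((if 2 ≤ m then
        -(1 / ρ 0) * ∑' l : ℕ, (3 + 2 * (l : ℝ)) * ρ (l + 1) * pdR (prev (g - 1) (m - 2)) l ρ
      else 0)
    + (∑ k ∈ Finset.range (m + 1), ∑ l ∈ Finset.range (m + 1),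
        if k + l + 3 = m then (3 + 2 * (l : ℝ)) * pdR (prev (g - 1) k) l ρ else 0)
    + (if 3 ≤ m then -(((2 * (m - 3) + 3 : ℕ) : ℝ) * prev (g - 1) (m - 3) ρ) / ρ 0 else 0))

/-- Table of the coefficients of the one-boundary functions for all genera `h ≤ G`.
`Gtab lam G h k ρ` is the coefficient of `z^{-(2k+3)}` in `𝒢_h(z)`. -/
def Gtab (lam : ℝ) : ℕ → ℕ → ℕ → (ℕ → ℝ) → ℝ
  | 0 => fun _ _ _ => 0
  | 1 => fun h k ρ =>
      if h = 1 then
        (if k = 0 then 2 * lam ^ 4 * ρ 1 / (ρ 0) ^ 2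
         else if k = 1 then -(2 * lam ^ 4) / ρ 0 else 0)
      else 0
  | (G + 2) => fun h k ρ =>
      if h ≤ G + 1 then Gtab lam (G + 1) h k ρ
      else if h = G + 2 then
        -(1 / (2 * ρ 0)) *
          ∑' j : ℕ, eBr lam (G + 2) (Gtab lam (G + 1)) (k + j) ρ * Sm ρ j / (j.factorial : ℝ)
      else 0

/-- Coefficients of the genus-`g` one-boundary function. -/
def Gcoef (lam : ℝ) (g : ℕ) : ℕ → (ℕ → ℝ) → ℝ := Gtab lam g g

/-- One-boundary function `𝒢_g(z)` of genus `g ≥ 1`. -/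
def Gfun (lam : ℝ) (g : ℕ) (ρ : ℕ → ℝ) (z : ℂ) : ℂ :=
  ∑' k : ℕ, (Gcoef lam g k ρ : ℂ) / z ^ (2 * k + 3)

/-- The same-point two-boundary function `𝒢_g(z|z)`, with
`𝒢₀(z|z) := λ²/z⁴` and `𝒢_g(z|z) := (2λ)²(Â†_z + (1/(ϱ₀z⁴))∂_z)𝒢_g(z)` for `g ≥ 1`. -/
def Gpair (lam : ℝ) (g : ℕ) (ρ : ℕ → ℝ) (z : ℂ) : ℂ :=
  if g = 0 then (lam : ℂ) ^ 2 / z ^ 4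
  else (2 * (lam : ℂ)) ^ 2 *
    ((∑' l : ℕ, (-((3 + 2 * (l : ℂ)) * (ρ (l + 1) : ℂ)) / ((ρ 0 : ℂ) * z ^ 3)
        + (3 + 2 * (l : ℂ)) / z ^ (5 + 2 * l)) * pdC (fun σ => Gfun lam g σ z) l ρ)
     + (1 / ((ρ 0 : ℂ) * z ^ 4)) * deriv (Gfun lam g ρ) z)

/-! ### Multi-boundary functions. -/

/-- Iterated boundary creation for `g ≥ 1` (without prefactors); coordinates `0,…,B−1`. -/
def GBraw (lam : ℝ) (g : ℕ) : ℕ → (ℕ → ℝ) → (ℕ → ℂ) → ℂ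
  | 0 => fun _ _ => 0
  | 1 => fun ρ z => Gfun lam g ρ (z 0)
  | (B + 2) => AdagVar (Finset.range (B + 1)) (B + 1) (GBraw lam g (B + 1))

/-- Iterated boundary creation for `g = 0` (without prefactors), starting from `𝒢₀(z₁|z₂)`. -/
def GBraw0 (lam : ℝ) : ℕ → (ℕ → ℝ) → (ℕ → ℂ) → ℂ
  | 0 => fun _ _ => 0
  | 1 => fun _ _ => 0
  | 2 => fun _ z => 4 * (lam : ℂ) ^ 2 / (z 0 * z 1 * (z 0 + z 1) ^ 2)
  | (B + 3) => AdagVar (Finset.range (B + 2)) (B + 2) (GBraw0 lam (B + 2))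

/-- The multi-boundary functions `𝒢_g(z₁|…|z_B)`, with variables at coordinates `0,…,B−1`:
`𝒢_g(z₁|…|z_B) = (2λ)^{3B−4} Â†_{(z₁..z_{B−1}),z_B}(⋯ Â†_{(z₁),z₂}𝒢_g(z₁)⋯)` for `g ≥ 1`,
and `𝒢₀(z₁|…|z_B) = (2λ)^{3B−6} Â†(⋯ Â†𝒢₀(z₁|z₂)⋯)` for `g = 0`. -/
def GBfun (lam : ℝ) (g B : ℕ) (ρ : ℕ → ℝ) (z : ℕ → ℂ) : ℂ :=
  if g = 0 then (2 * (lam : ℂ)) ^ (3 * B - 6) * GBraw0 lam B ρ z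
  else if B = 1 then Gfun lam g ρ (z 0)
  else (2 * (lam : ℂ)) ^ (3 * B - 4) * GBraw lam g B ρ z

/-! ### Free energies and boundary annihilation. -/

/-- Boundary annihilation applied to `𝒢_g`:  `Â_ǎ 𝒢_g = −Σ_l ϱ_l/(3+2l) · c_{g,l+1}(ϱ)`
(the coefficient of `z^{−5−2l}` in `𝒢_g(z)` is `c_{g,l+1}`). -/
def AcheckG (lam : ℝ) (g : ℕ) (ρ : ℕ → ℝ) : ℝ :=
  -∑' l : ℕ, ρ l / (3 + 2 * (l : ℝ)) * Gcoef lam g (l + 1) ρ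

/-- Free energies: `F₁ = −(1/24)·log ϱ₀`, and
`F_g = (1/((2g−2)(2λ)⁴))·Â_ǎ(𝒢_g)` for `g ≥ 2`. -/
def Ffree (lam : ℝ) (g : ℕ) (ρ : ℕ → ℝ) : ℝ :=
  if g = 1 then -(1 / 24) * Real.log (ρ 0)
  else 1 / ((2 * (g : ℝ) - 2) * (2 * lam) ^ 4) * AcheckG lam g ρ

/-! ### Auxiliary notions. -/

/-- Variable assignment `(z₁, z_{i₁}, z_{i₂}, …)` with first slot `w` and the remaining slots
filled by the coordinates of `z` indexed by the set `I` in increasing order. -/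
def slotAt (z : ℕ → ℂ) (w : ℂ) (I : Finset ℕ) : ℕ → ℂ :=
  fun n => if n = 0 then w else z ((I.sort (· ≤ ·)).getD (n - 1) 0)

/-- A polynomial in variables `x₁,…,x_j` is `j`-weighted if each of its monomials
`∏ x_i^{m_i}` satisfies `Σ i·m_i = j`. -/
def IsWeighted (j : ℕ) (P : MvPolynomial (Fin j) ℚ) : Prop :=
  ∀ m ∈ P.support, (∑ i : Fin j, ((i : ℕ) + 1) * m i) = j

/-- A smooth family `F(ϱ₀,…,ϱ_M; (z_i)_{i∈J})`: it factors through a function of the first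
`M+1` moments and the coordinates in `J` which is smooth (and holomorphic in each `z_i`)
on the region `ϱ₀ ≠ 0`, `z_i ≠ 0`. -/
def SmoothFam (M : ℕ) (J : Finset ℕ) (F : (ℕ → ℝ) → (ℕ → ℂ) → ℂ) : Prop :=
  ∃ Ft : ((Fin (M + 1) → ℝ) × ({ i // i ∈ J } → ℂ)) → ℂ,
    ContDiffOn ℝ (⊤ : ℕ∞) Ft { x | x.1 0 ≠ 0 ∧ ∀ i, x.2 i ≠ 0 } ∧
    (∀ x ∈ ({ x : (Fin (M + 1) → ℝ) × ({ i // i ∈ J } → ℂ) |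
        x.1 0 ≠ 0 ∧ ∀ i, x.2 i ≠ 0 }), ∀ i,
      DifferentiableAt ℂ (fun w => Ft (x.1, Function.update x.2 i w)) (x.2 i)) ∧
    ∀ ρ z, F ρ z = Ft (fun l => ρ (l : ℕ), fun i => z (i : ℕ))

/-- A smooth scalar function of `ϱ₀ ≠ 0, ϱ₁, …, ϱ_M`. -/
def SmoothScalarFam (M : ℕ) (F : (ℕ → ℝ) → ℝ) : Prop :=
  ∃ Ft : (Fin (M + 1) → ℝ) → ℝ,
    ContDiffOn ℝ (⊤ : ℕ∞) Ft { v | v 0 ≠ 0 } ∧ ∀ ρ : ℕ → ℝ, F ρ = Ft (fun l => ρ (l : ℕ))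

/-! ### The Laplacian of Theorem `Δ_ϱ`. -/

/-- `R_m(ϱ) = −(2/3) Σ_{k=1}^m (kϱ_k/((3+2k)ϱ₀))·S_{m−k}(ϱ)/(m−k)!`. -/
def Rm (ρ : ℕ → ℝ) (m : ℕ) : ℝ :=
  -(2 / 3) * ∑ k ∈ Finset.Icc 1 m,
    ((k : ℝ) * ρ k / ((3 + 2 * (k : ℝ)) * ρ 0)) * (Sm ρ (m - k) / ((m - k).factorial : ℝ))

/-- The Laplacian `Δ_ϱ`, acting on functions of the moments. -/
def DeltaRho (F : (ℕ → ℝ) → ℝ) (ρ : ℕ → ℝ) : ℝ :=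
  -(-(6 * ρ 1 ^ 3) / (5 * ρ 0 ^ 3) + 111 * ρ 1 * ρ 2 / (70 * ρ 0 ^ 2)
      - ρ 3 / (2 * ρ 0)) * pdR (fun σ => pdR F 0 σ) 0 ρ
  - (2 * ρ 1 ^ 3 / ρ 0 ^ 4 - 1097 * ρ 1 * ρ 2 / (280 * ρ 0 ^ 3)
      + 41 * ρ 3 / (24 * ρ 0 ^ 2)) * pdR F 0 ρ
  - (∑' k : ℕ, (3 + 2 * ((k : ℝ) + 1)) *
      ((-(2 * ρ 1 ^ 2 / (5 * ρ 0 ^ 3)) + 2 * ρ 2 / (7 * ρ 0 ^ 2)) * ρ (k + 2)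
        - 3 * Rm ρ (k + 3) * ρ 1 / (2 * ρ 0) + 3 * Rm ρ (k + 4) / 2) *
      pdR (fun σ => pdR F 0 σ) (k + 1) ρ)
  - (∑' k : ℕ, ∑' l : ℕ, (3 + 2 * ((k : ℝ) + 1)) * (3 + 2 * ((l : ℝ) + 1)) *
      (-(ρ 1 * ρ (l + 2) * ρ (k + 2) / (30 * ρ 0 ^ 2))
        - ρ (k + 2) * Rm ρ (l + 3) / (4 * ρ 0)
        - ρ (l + 2) * Rm ρ (k + 3) / (4 * ρ 0)
        + Rm ρ (k + l + 5) / 4) *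
      pdR (fun σ => pdR F (l + 1) σ) (k + 1) ρ)
  - (∑' k : ℕ, (3 + 2 * ((k : ℝ) + 1)) *
      ((19 * ρ 1 ^ 2 / (60 * ρ 0 ^ 4) - 25 * ρ 2 / (84 * ρ 0 ^ 3)) * ρ (k + 2)
        + ρ 1 * Rm ρ (k + 3) / (16 * ρ 0 ^ 2)
        - Rm ρ (k + 4) / (16 * ρ 0)
        - (5 + 2 * ((k : ℝ) + 1)) * ρ 1 * ρ (k + 3) / (30 * ρ 0 ^ 3)
        - (5 + 2 * ((k : ℝ) + 1)) * Rm ρ (k + 4) / (2 * ρ 0)) *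
      pdR F (k + 1) ρ)

/-- The operator `D = −(2λ)⁴Δ_ϱ + (2λ)⁴·(−21ϱ₁³/(160ϱ₀⁵)+29ϱ₁ϱ₂/(128ϱ₀⁴)−35ϱ₃/(384ϱ₀³))·`. -/
def Dop (lam : ℝ) (F : (ℕ → ℝ) → ℝ) : (ℕ → ℝ) → ℝ :=
  fun ρ => -(2 * lam) ^ 4 * DeltaRho F ρ
    + (2 * lam) ^ 4 * (-(21 / 160) * ρ 1 ^ 3 / ρ 0 ^ 5 + (29 / 128) * ρ 1 * ρ 2 / ρ 0 ^ 4
        - (35 / 384) * ρ 3 / ρ 0 ^ 3) * F ρ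

end NCQFT

namespace NCQFT

set_option linter.unusedSimpArgs false

/-- Formal variables: `r l = ϱ_l`, `u = 1/ϱ₀`, `x i = 1/z_i`, `q i = 1/(z₀ z_i (z₀+z_i)²)`,
and the formal planar one-point function `o`. -/
inductive V where
  | r (l : ℕ) : V
  | u : V
  | x (i : ℕ) : V
  | q (i : ℕ) : V
  | o : V

abbrev PR := MvPolynomial V ℝ

def rr (l : ℕ) : PR := MvPolynomial.X (V.r l)
def uu : PR := MvPolynomial.X V.u
def xx (i : ℕ) : PR := MvPolynomial.X (V.x i)
def qq (i : ℕ) : PR := MvPolynomial.X (V.q i)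
def oo : PR := MvPolynomial.X V.o

/-- Values of the boundary creation derivation on the generators. -/
def aVal (i : ℕ) : V → PR
  | .r l => (3 + 2 * (l : PR)) * (-(rr (l + 1) * uu * xx i ^ 3) + xx i ^ (5 + 2 * l))
  | .u => -uu ^ 2 * (3 * (-(rr 1 * uu * xx i ^ 3) + xx i ^ 5))
  | .x j => -(uu * xx i ^ 3 * xx j ^ 3)
  | .q j => -(uu * xx i ^ 3 * xx 0 ^ 3 * xx j ^ 3)
  | .o => qq i

/-- The boundary creation operator as a derivation. -/
def AA (i : ℕ) : Derivation ℝ PR PR := MvPolynomial.mkDerivation ℝ (aVal i)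

lemma AA_r (i l : ℕ) : AA i (rr l) =
    (3 + 2 * (l : PR)) * (-(rr (l + 1) * uu * xx i ^ 3) + xx i ^ (5 + 2 * l)) :=
  MvPolynomial.mkDerivation_X ℝ _ _
lemma AA_u (i : ℕ) : AA i uu = -uu ^ 2 * (3 * (-(rr 1 * uu * xx i ^ 3) + xx i ^ 5)) :=
  MvPolynomial.mkDerivation_X ℝ _ _
lemma AA_x (i j : ℕ) : AA i (xx j) = -(uu * xx i ^ 3 * xx j ^ 3) :=
  MvPolynomial.mkDerivation_X ℝ _ _
lemma AA_q (i j : ℕ) : AA i (qq j) = -(uu * xx i ^ 3 * xx 0 ^ 3 * xx j ^ 3) :=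
  MvPolynomial.mkDerivation_X ℝ _ _
lemma AA_o (i : ℕ) : AA i oo = qq i :=
  MvPolynomial.mkDerivation_X ℝ _ _

lemma AA_mul (i : ℕ) (a b : PR) : AA i (a * b) = a * AA i b + b * AA i a := by
  rw [Derivation.leibniz]; simp [smul_eq_mul]

lemma AA_pow (i : ℕ) (a : PR) (n : ℕ) : AA i (a ^ n) = (n : PR) * a ^ (n - 1) * AA i a := by
  rw [Derivation.leibniz_pow]; simp [smul_eq_mul, mul_assoc]

lemma AA_xpow (i j n : ℕ) : AA i (xx j ^ n) = -((n : PR) * (uu * xx i ^ 3 * xx j ^ (n + 2))) := by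
  rw [AA_pow, AA_x]
  rcases n with _ | n
  · simp
  · simp; ring

lemma AA_nat (i n : ℕ) : AA i (n : PR) = 0 := Derivation.map_natCast _ _

lemma AA_comm (i j : ℕ) (p : PR) : AA i (AA j p) = AA j (AA i p) := by
  have h : ⁅AA i, AA j⁆ = (0 : Derivation ℝ PR PR) := by
    apply MvPolynomial.derivation_ext
    intro v
    have h3 : ∀ k, AA k (3 : PR) = 0 := fun k => AA_nat k 3
    have h2 : ∀ k, AA k (2 : PR) = 0 := fun k => AA_nat k 2
    rw [Derivation.commutator_apply]
    rcases v with l | _ | k | k | _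
    · change AA i (AA j (rr l)) - AA j (AA i (rr l)) = 0
      simp only [AA_r, AA_u, AA_x, AA_mul, AA_xpow, map_add, map_neg, AA_nat, h3, h2]
      push_cast
      ring
    · change AA i (AA j uu) - AA j (AA i uu) = 0
      simp only [AA_r, AA_u, AA_x, AA_mul, AA_xpow, AA_pow, map_add, map_neg, AA_nat, h3, h2]
      push_cast
      ring
    · change AA i (AA j (xx k)) - AA j (AA i (xx k)) = 0
      simp only [AA_r, AA_u, AA_x, AA_mul, AA_xpow, map_add, map_neg, AA_nat, h3, h2]
      push_cast
      ring
    · change AA i (AA j (qq k)) - AA j (AA i (qq k)) = 0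
      simp only [AA_r, AA_u, AA_x, AA_q, AA_mul, AA_xpow, map_add, map_neg, AA_nat, h3, h2]
      push_cast
      ring
    · change AA i (AA j oo) - AA j (AA i oo) = 0
      simp only [AA_o, AA_q]
      ring
  have := congrArg (fun D : Derivation ℝ PR PR => D p) h
  simpa [Derivation.commutator_apply, sub_eq_zero] using this

/-- `K̂ z₀^{-(2k+3)}`. -/
def kap : ℕ → PR
  | 0 => rr 0 * xx 0 ^ 2
  | k + 1 => xx 0 ^ 2 * kap k + rr (k + 1) * xx 0 ^ 2

/-- The commutator of `K̂` and boundary creation on `z₀^{-(2k+3)}`. -/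
def tau (i : ℕ) : ℕ → PR
  | 0 => xx i ^ 3 * xx 0 ^ 4 + 3 * xx i ^ 5 * xx 0 ^ 2
  | k + 1 => xx 0 ^ 2 * tau i k + (2 * (k : PR) + 5) * xx i ^ (2 * k + 7) * xx 0 ^ 2

lemma AA_kap (i k : ℕ) : AA i (kap k) = tau i k - (2 * (k : PR) + 3) * (uu * xx i ^ 3) * kap (k + 1)
    + (rr 0 * uu - 1) * (xx i ^ 3 * xx 0 ^ (2 * k + 4)) := by
  induction k with
  | zero =>
    simp only [kap, tau, AA_mul, AA_xpow, AA_r]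
    push_cast
    ring
  | succ k ih =>
    rw [kap, map_add, AA_mul, AA_mul, ih, AA_xpow, AA_r]
    simp only [kap, tau]
    push_cast
    ring

lemma AA_tau (i j k : ℕ) : AA i (tau j k) = - (2 * (k : PR) + 3) * (uu * xx i ^ 3) * tau j (k + 1)
    - uu * xx i ^ 3 * xx j ^ 3 * xx 0 ^ (2 * k + 6) := by
  induction k with
  | zero =>
    have h3 : ∀ k, AA k (3 : PR) = 0 := fun k => AA_nat k 3
    simp only [tau, AA_mul, AA_xpow, map_add, h3]
    push_cast
    ring
  | succ k ih =>
    have h : AA i (2 * (k : PR) + 5) = 0 := by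
      have := AA_nat i (2 * k + 5)
      push_cast at this
      exact this
    rw [tau, map_add, AA_mul, AA_mul, AA_mul, ih, AA_xpow, AA_xpow, h]
    simp only [tau]
    push_cast
    ring

/-- Splitting off the variable `x 0`. -/
def eVal : V → Polynomial PR
  | .x 0 => Polynomial.X
  | v => Polynomial.C (MvPolynomial.X v)

def eX : PR →ₐ[ℝ] Polynomial PR := MvPolynomial.aeval eVal

/-- Linear operator acting on powers of `x 0`. -/
def opX (mon : ℕ → PR) : PR →ₗ[ℝ] PR :=
  (Polynomial.lsum (fun n => LinearMap.mulRight ℝ (mon n))).comp eX.toLinearMap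

/-- Variables allowed in coefficients. -/
def freeV (n : ℕ) : Set V
  | .r _ => True
  | .u => True
  | .x i => 0 < i ∧ i < n
  | _ => False

/-- Coefficient algebra. -/
def S0 (n : ℕ) : Subalgebra ℝ PR := MvPolynomial.supported ℝ (freeV n)

lemma r_mem (n l : ℕ) : rr l ∈ S0 n := MvPolynomial.X_mem_supported.2 trivial
lemma u_mem (n : ℕ) : uu ∈ S0 n := MvPolynomial.X_mem_supported.2 trivial
lemma x_mem {n i : ℕ} (h : 0 < i ∧ i < n) : xx i ∈ S0 n := MvPolynomial.X_mem_supported.2 h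

lemma S0_induction {n : ℕ} {P : PR → Prop} (hC : ∀ a : ℝ, P (algebraMap ℝ PR a))
    (hr : ∀ l, P (rr l)) (hu : P uu) (hx : ∀ i, 0 < i → i < n → P (xx i))
    (ha : ∀ f g, P f → P g → P (f + g)) (hm : ∀ f g, P f → P g → P (f * g)) {f : PR}
    (hf : f ∈ S0 n) : P f := by
  unfold S0 at hf
  rw [MvPolynomial.supported_eq_adjoin_X] at hf
  induction hf using Algebra.adjoin_induction with
  | mem x hx' =>
    obtain ⟨v, hv, rfl⟩ := hx'
    rcases v with l | _ | k | k | _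
    · exact hr l
    · exact hu
    · exact hx k hv.1 hv.2
    · exact hv.elim
    · exact hv.elim
  | algebraMap r => exact hC r
  | add x y _ _ h1 h2 => exact ha _ _ h1 h2
  | mul x y _ _ h1 h2 => exact hm _ _ h1 h2

lemma eX_S0 {n : ℕ} {c : PR} (hc : c ∈ S0 n) : eX c = Polynomial.C c := by
  refine S0_induction (P := fun c => eX c = Polynomial.C c) ?_ ?_ ?_ ?_ ?_ ?_ hc
  · intro a; simp
  · intro l; simp [eX, rr, eVal]
  · simp [eX, uu, eVal]
  · intro i hi _
    obtain ⟨j, rfl⟩ : ∃ j, i = j + 1 := ⟨i - 1, by omega⟩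
    simp [eX, xx, eVal]
  · intro f g h1 h2; simp [h1, h2]
  · intro f g h1 h2; simp [h1, h2]

lemma opX_mul (mon : ℕ → PR) {n : ℕ} {c : PR} (hc : c ∈ S0 n) (k : ℕ) :
    opX mon (c * xx 0 ^ k) = c * mon k := by
  have h0 : eX (xx 0) = Polynomial.X := by simp [eX, xx, eVal]
  simp only [opX, LinearMap.comp_apply, AlgHom.toLinearMap_apply, map_mul, map_pow, eX_S0 hc, h0]
  rw [Polynomial.lsum_apply, Polynomial.C_mul_X_pow_eq_monomial,
    Polynomial.sum_monomial_index] <;> simp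

def KK : PR →ₗ[ℝ] PR := opX (fun n => kap ((n - 3) / 2))
def TT (i : ℕ) : PR →ₗ[ℝ] PR := opX (fun n => tau i ((n - 3) / 2))

lemma KK_mul {n : ℕ} {c : PR} (hc : c ∈ S0 n) (k : ℕ) :
    KK (c * xx 0 ^ (2 * k + 3)) = c * kap k := by
  rw [KK, opX_mul _ hc]; simp
lemma TT_mul (i : ℕ) {n : ℕ} {c : PR} (hc : c ∈ S0 n) (k : ℕ) :
    TT i (c * xx 0 ^ (2 * k + 3)) = c * tau i k := by
  rw [TT, opX_mul _ hc]; simp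

/-- Odd functions of `z₀`, of order at least three in `1/z₀`. -/
def Odd0 (n : ℕ) : Submodule ℝ PR :=
  Submodule.span ℝ {f | ∃ c ∈ S0 n, ∃ k : ℕ, f = c * xx 0 ^ (2 * k + 3)}

lemma Odd0_induction {n : ℕ} {P : PR → Prop} (h0 : P 0)
    (hm : ∀ c ∈ S0 n, ∀ k : ℕ, P (c * xx 0 ^ (2 * k + 3)))
    (ha : ∀ f g, P f → P g → P (f + g)) {f : PR} (hf : f ∈ Odd0 n) : P f := by
  unfold Odd0 at hf
  have : ∀ a : ℝ, P (a • f) := by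
    induction hf using Submodule.span_induction with
    | mem x h =>
      intro a
      obtain ⟨c, hc, k, rfl⟩ := h
      rw [← smul_mul_assoc]
      exact hm _ ((S0 n).smul_mem hc a) k
    | zero => intro a; simpa using h0
    | add x y _ _ h1 h2 => intro a; rw [smul_add]; exact ha _ _ (h1 a) (h2 a)
    | smul b x _ h => intro a; rw [smul_smul]; exact h _
  simpa using this 1

lemma mem_Odd0 {n : ℕ} {c : PR} (hc : c ∈ S0 n) (k : ℕ) : c * xx 0 ^ (2 * k + 3) ∈ Odd0 n :=
  Submodule.subset_span ⟨c, hc, k, rfl⟩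

lemma AA_S0 {n i : ℕ} (hi : 0 < i ∧ i < n) {c : PR} (hc : c ∈ S0 n) : AA i c ∈ S0 n := by
  have hN : ∀ m : ℕ, (m : PR) ∈ S0 n := fun m => natCast_mem _ m
  refine (S0_induction (P := fun c => c ∈ S0 n ∧ AA i c ∈ S0 n) ?_ ?_ ?_ ?_ ?_ ?_ hc).2
  · intro a; exact ⟨Subalgebra.algebraMap_mem _ _, by simp [Derivation.map_algebraMap]⟩
  · intro l
    refine ⟨r_mem n l, ?_⟩
    rw [AA_r]
    have h1 : (3 + 2 * (l : PR)) ∈ S0 n := by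
      have := hN (3 + 2 * l)
      push_cast at this
      exact this
    exact mul_mem h1 (add_mem (neg_mem (mul_mem (mul_mem (r_mem _ _) (u_mem _))
      (pow_mem (x_mem hi) _))) (pow_mem (x_mem hi) _))
  · refine ⟨u_mem n, ?_⟩
    rw [AA_u]
    exact mul_mem (neg_mem (pow_mem (u_mem _) _)) (mul_mem (hN 3) (add_mem (neg_mem
      (mul_mem (mul_mem (r_mem _ _) (u_mem _))
      (pow_mem (x_mem hi) _))) (pow_mem (x_mem hi) _)))
  · intro j h1 h2
    refine ⟨x_mem ⟨h1, h2⟩, ?_⟩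
    rw [AA_x]
    exact neg_mem (mul_mem (mul_mem (u_mem _) (pow_mem (x_mem hi) _)) (pow_mem (x_mem ⟨h1, h2⟩) _))
  · rintro f g ⟨h1, h2⟩ ⟨h3, h4⟩
    exact ⟨add_mem h1 h3, by rw [map_add]; exact add_mem h2 h4⟩
  · rintro f g ⟨h1, h2⟩ ⟨h3, h4⟩
    exact ⟨mul_mem h1 h3, by rw [AA_mul]; exact add_mem (mul_mem h1 h4) (mul_mem h3 h2)⟩

lemma AA_mono (i k : ℕ) (c : PR) : AA i (c * xx 0 ^ (2 * k + 3)) =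
    AA i c * xx 0 ^ (2 * k + 3)
      + (-((2 * (k : PR) + 3) * (uu * xx i ^ 3)) * c) * xx 0 ^ (2 * (k + 1) + 3) := by
  rw [AA_mul, AA_xpow]
  push_cast
  ring

lemma aux_mem {n i : ℕ} (hi : 0 < i ∧ i < n) {c : PR} (hc : c ∈ S0 n) (k : ℕ) :
    (-((2 * (k : PR) + 3) * (uu * xx i ^ 3)) * c) ∈ S0 n := by
  have h1 : (2 * (k : PR) + 3) ∈ S0 n := by
    have := natCast_mem (S0 n) (2 * k + 3)
    push_cast at this
    exact this
  exact mul_mem (neg_mem (mul_mem h1 (mul_mem (u_mem _) (pow_mem (x_mem hi) _)))) hc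

lemma AA_Odd0 {n i : ℕ} (hi : 0 < i ∧ i < n) {f : PR} (hf : f ∈ Odd0 n) : AA i f ∈ Odd0 n := by
  refine Odd0_induction (P := fun f => AA i f ∈ Odd0 n) (by simp) ?_ ?_ hf
  · intro c hc k
    rw [AA_mono]
    exact add_mem (mem_Odd0 (AA_S0 hi hc) k) (mem_Odd0 (aux_mem hi hc k) (k + 1))
  · intro f g h1 h2; rw [map_add]; exact add_mem h1 h2

/-- Commutator of `K̂` with boundary creation. -/
lemma AA_KK {n i : ℕ} (hi : 0 < i ∧ i < n) {f : PR} (hf : f ∈ Odd0 n) :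
    AA i (KK f) = KK (AA i f) + TT i f + (rr 0 * uu - 1) * (xx i ^ 3 * xx 0 * f) := by
  refine Odd0_induction (P := fun f => AA i (KK f) = KK (AA i f) + TT i f
    + (rr 0 * uu - 1) * (xx i ^ 3 * xx 0 * f)) (by simp) ?_ ?_ hf
  · intro c hc k
    rw [AA_mono, map_add, KK_mul hc, KK_mul (AA_S0 hi hc), KK_mul (aux_mem hi hc k), TT_mul i hc,
      AA_mul, AA_kap]
    ring
  · intro f g h1 h2; simp only [map_add, h1, h2]; ring

lemma AA_TT {n i : ℕ} (hi : 0 < i ∧ i < n) (j : ℕ) {f : PR} (hf : f ∈ Odd0 n) :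
    AA i (TT j f) = TT j (AA i f) - uu * xx i ^ 3 * xx j ^ 3 * xx 0 ^ 3 * f := by
  refine Odd0_induction (P := fun f => AA i (TT j f) = TT j (AA i f)
    - uu * xx i ^ 3 * xx j ^ 3 * xx 0 ^ 3 * f) (by simp) ?_ ?_ hf
  · intro c hc k
    rw [AA_mono, map_add, TT_mul j hc, TT_mul j (AA_S0 hi hc), TT_mul j (aux_mem hi hc k),
      AA_mul, AA_tau]
    ring
  · intro f g h1 h2; simp only [map_add, h1, h2]; ring

/-- The divided difference term. -/
def UU (j : ℕ) (f : PR) : PR := TT j f - qq j * f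

lemma AA_UU {n i : ℕ} (hi : 0 < i ∧ i < n) (j : ℕ) {f : PR} (hf : f ∈ Odd0 n) :
    AA i (UU j f) = UU j (AA i f) := by
  rw [UU, UU, map_sub, AA_TT hi j hf, AA_mul, AA_q]
  ring

/-- Evaluation of the formal variables. -/
def evv (ρ : ℕ → ℝ) (z : ℕ → ℂ) : V → ℂ
  | .r l => (ρ l : ℂ)
  | .u => (ρ 0 : ℂ)⁻¹
  | .x i => (z i)⁻¹
  | .q i => (z 0 * z i * (z 0 + z i) ^ 2)⁻¹
  | .o => 0

def ev (ρ : ℕ → ℝ) (z : ℕ → ℂ) : PR →ₐ[ℝ] ℂ := MvPolynomial.aeval (evv ρ z)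

@[simp] lemma ev_r (ρ : ℕ → ℝ) (z : ℕ → ℂ) (l : ℕ) : ev ρ z (rr l) = (ρ l : ℂ) := by
  simp [ev, rr, evv]
@[simp] lemma ev_u (ρ : ℕ → ℝ) (z : ℕ → ℂ) : ev ρ z uu = (ρ 0 : ℂ)⁻¹ := by
  simp [ev, uu, evv]
@[simp] lemma ev_x (ρ : ℕ → ℝ) (z : ℕ → ℂ) (i : ℕ) : ev ρ z (xx i) = (z i)⁻¹ := by
  simp [ev, xx, evv]
@[simp] lemma ev_q (ρ : ℕ → ℝ) (z : ℕ → ℂ) (i : ℕ) :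
    ev ρ z (qq i) = (z 0 * z i * (z 0 + z i) ^ 2)⁻¹ := by
  simp [ev, qq, evv]

/-- Variables allowed in `R0 n`. -/
def allV (n : ℕ) : Set V
  | .r _ => True
  | .u => True
  | .x i => i < n
  | .q i => i < n
  | _ => False

def R0 (n : ℕ) : Subalgebra ℝ PR := MvPolynomial.supported ℝ (allV n)

lemma r_memR (n l : ℕ) : rr l ∈ R0 n := MvPolynomial.X_mem_supported.2 trivial
lemma u_memR (n : ℕ) : uu ∈ R0 n := MvPolynomial.X_mem_supported.2 trivial
lemma x_memR {n i : ℕ} (h : i < n) : xx i ∈ R0 n := MvPolynomial.X_mem_supported.2 h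
lemma q_memR {n i : ℕ} (h : i < n) : qq i ∈ R0 n := MvPolynomial.X_mem_supported.2 h

lemma R0_mono {n m : ℕ} (h : n ≤ m) : R0 n ≤ R0 m := by
  apply MvPolynomial.supported_mono
  rintro (l | _ | k | k | _) hv
  · trivial
  · trivial
  · exact lt_of_lt_of_le hv h
  · exact lt_of_lt_of_le hv h
  · exact hv

lemma S0_le_R0 (n : ℕ) : S0 n ≤ R0 n := by
  apply MvPolynomial.supported_mono
  rintro (l | _ | k | k | _) hv
  · trivial
  · trivial
  · exact hv.2
  · exact hv.elim
  · exact hv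

lemma R0_induction {n : ℕ} {P : PR → Prop} (hC : ∀ a : ℝ, P (algebraMap ℝ PR a))
    (hr : ∀ l, P (rr l)) (hu : P uu) (hx : ∀ i, i < n → P (xx i)) (hq : ∀ i, i < n → P (qq i))
    (ha : ∀ f g, P f → P g → P (f + g)) (hm : ∀ f g, P f → P g → P (f * g)) {f : PR}
    (hf : f ∈ R0 n) : P f := by
  unfold R0 at hf
  rw [MvPolynomial.supported_eq_adjoin_X] at hf
  induction hf using Algebra.adjoin_induction with
  | mem x hx' =>
    obtain ⟨v, hv, rfl⟩ := hx'
    rcases v with l | _ | k | k | _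
    · exact hr l
    · exact hu
    · exact hx k hv
    · exact hq k hv
    · exact hv.elim
  | algebraMap r => exact hC r
  | add x y _ _ h1 h2 => exact ha _ _ h1 h2
  | mul x y _ _ h1 h2 => exact hm _ _ h1 h2

lemma AA_R0 {n i : ℕ} (hi : i < n) {c : PR} (hc : c ∈ R0 n) : AA i c ∈ R0 n := by
  have hN : ∀ m : ℕ, (m : PR) ∈ R0 n := fun m => natCast_mem _ m
  have h00 : xx 0 ∈ R0 n := x_memR (by omega)
  refine (R0_induction (P := fun c => c ∈ R0 n ∧ AA i c ∈ R0 n) ?_ ?_ ?_ ?_ ?_ ?_ ?_ hc).2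
  · intro a; exact ⟨Subalgebra.algebraMap_mem _ _, by simp [Derivation.map_algebraMap]⟩
  · intro l
    refine ⟨r_memR n l, ?_⟩
    rw [AA_r]
    have h1 : (3 + 2 * (l : PR)) ∈ R0 n := by
      have := hN (3 + 2 * l)
      push_cast at this
      exact this
    exact mul_mem h1 (add_mem (neg_mem (mul_mem (mul_mem (r_memR _ _) (u_memR _))
      (pow_mem (x_memR hi) _))) (pow_mem (x_memR hi) _))
  · refine ⟨u_memR n, ?_⟩
    rw [AA_u]
    exact mul_mem (neg_mem (pow_mem (u_memR _) _)) (mul_mem (hN 3) (add_mem (neg_mem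
      (mul_mem (mul_mem (r_memR _ _) (u_memR _))
      (pow_mem (x_memR hi) _))) (pow_mem (x_memR hi) _)))
  · intro j h2
    refine ⟨x_memR h2, ?_⟩
    rw [AA_x]
    exact neg_mem (mul_mem (mul_mem (u_memR _) (pow_mem (x_memR hi) _)) (pow_mem (x_memR h2) _))
  · intro j h2
    refine ⟨q_memR h2, ?_⟩
    rw [AA_q]
    exact neg_mem (mul_mem (mul_mem (mul_mem (u_memR _) (pow_mem (x_memR hi) _))
      (pow_mem h00 _)) (pow_mem (x_memR h2) _))
  · rintro f g ⟨h1, h2⟩ ⟨h3, h4⟩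
    exact ⟨add_mem h1 h3, by rw [map_add]; exact add_mem h2 h4⟩
  · rintro f g ⟨h1, h2⟩ ⟨h3, h4⟩
    exact ⟨mul_mem h1 h3, by rw [AA_mul]; exact add_mem (mul_mem h1 h4) (mul_mem h3 h2)⟩

/-- Admissible configurations of the first `n` variables. -/
def GoodZ (n : ℕ) (z : ℕ → ℂ) : Prop := ∀ i, i < n → z i ≠ 0 ∧ z 0 + z i ≠ 0

/-- Coefficient of `∂/∂ϱ_l`. -/
def cR (ρ : ℕ → ℝ) (w : ℂ) (l : ℕ) : ℂ :=
  -((3 + 2 * (l : ℂ)) * (ρ (l + 1) : ℂ)) / ((ρ 0 : ℂ) * w ^ 3) + (3 + 2 * (l : ℂ)) / w ^ (5 + 2 * l)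

/-- Chain rule data. -/
def ChainP (n : ℕ) (ρ : ℕ → ℝ) (z : ℕ → ℂ) (f : PR) : Prop :=
  ∃ dl de : ℕ → ℂ,
    (∀ l, HasDerivAt (fun t : ℝ => ev (Function.update ρ l t) z f) (dl l) (ρ l)) ∧
    (∀ i, i < n → HasDerivAt (fun v : ℂ => ev ρ (Function.update z i v) f) (de i) (z i)) ∧
    ∃ L0, (∀ l, L0 ≤ l → dl l = 0) ∧ ∀ j, z j ≠ 0 → ∀ L, L0 ≤ L →
      ∑ l ∈ Finset.range L, cR ρ (z j) l * dl l
        + ∑ i ∈ Finset.range n, (1 / ((ρ 0 : ℂ) * z j ^ 3 * z i)) * de i = ev ρ z (AA j f)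

lemma chain_q0 {n : ℕ} {ρ : ℕ → ℝ} {z : ℕ → ℂ} (hρ : ρ 0 ≠ 0) (hn : 0 < n) (hz : GoodZ n z) :
    ChainP n ρ z (qq 0) := by
  have hc : (ρ 0 : ℂ) ≠ 0 := by exact_mod_cast hρ
  have h0 := hz 0 hn
  refine ⟨fun _ => 0, fun i => if i = 0 then -(z 0 ^ 5)⁻¹ else 0, ?_, ?_, 0, by simp, ?_⟩
  · intro l; simp only [ev_q]; exact hasDerivAt_const _ _
  · intro i hi
    by_cases h : i = 0
    · subst h
      simp only [ev_q, Function.update_self, if_true]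
      have hd : HasDerivAt (fun v : ℂ => v * v * (v + v) ^ 2) (16 * z 0 ^ 3) (z 0) := by
        have h4 := (hasDerivAt_pow 4 (z 0)).const_mul (4 : ℂ)
        have e : (fun v : ℂ => v * v * (v + v) ^ 2) = fun v => 4 * v ^ 4 := by
          funext v; ring
        rw [e]
        refine h4.congr_deriv ?_
        push_cast; ring
      have hne : z 0 * z 0 * (z 0 + z 0) ^ 2 ≠ 0 := by
        have := h0.1; have := h0.2; positivity
      refine (hd.inv hne).congr_deriv ?_
      have := h0.1
      have h2 : (z 0 + z 0) = 2 * z 0 := by ring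
      rw [h2]
      field_simp
      ring
    · have h' : (0 : ℕ) ≠ i := fun e => h e.symm
      simp only [ev_q, Function.update_of_ne h', if_neg h]
      exact hasDerivAt_const _ _
  · intro j hj L _
    rw [AA_q]
    have h1 := h0.1
    simp [Finset.sum_ite_eq', hn]
    field_simp

lemma chain_q {n : ℕ} {ρ : ℕ → ℝ} {z : ℕ → ℂ} (hρ : ρ 0 ≠ 0) (hz : GoodZ n z) (k : ℕ)
    (hk0 : k ≠ 0) (hk : k < n) :
    ChainP n ρ z (qq k) := by
  have hc : (ρ 0 : ℂ) ≠ 0 := by exact_mod_cast hρ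
  have h0 := (hz 0 (by omega)).1
  obtain ⟨h1, h2⟩ := hz k hk
  have key : ∀ a b : ℂ, a ≠ 0 → b ≠ 0 → b + a ≠ 0 → HasDerivAt (fun v : ℂ => (v * b * (b + v) ^ 2)⁻¹)
      (-(b + 3 * a) / (a ^ 2 * b * (b + a) ^ 3)) a := by
    intro a b ha hb hab
    have hd : HasDerivAt (fun v : ℂ => v * b * (b + v) ^ 2)
        (b * (b + a) ^ 2 + a * b * (2 * (b + a))) a := by
      have h3 := ((hasDerivAt_id' a).mul_const b).mul
        (((hasDerivAt_id' a).const_add b).mul ((hasDerivAt_id' a).const_add b))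
      have e : (fun v : ℂ => v * b * (b + v) ^ 2) = fun v => v * b * ((b + v) * (b + v)) := by
        funext v; ring
      rw [e]
      refine h3.congr_deriv ?_
      simp; ring
    have hne : a * b * (b + a) ^ 2 ≠ 0 := by positivity
    refine (hd.inv hne).congr_deriv ?_
    field_simp
    ring
  refine ⟨fun _ => 0, fun i => (if i = 0 then -(z k + 3 * z 0) / (z 0 ^ 2 * z k * (z k + z 0) ^ 3) else 0)
    + (if i = k then -(z 0 + 3 * z k) / (z k ^ 2 * z 0 * (z 0 + z k) ^ 3) else 0), ?_, ?_, 0, by simp, ?_⟩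
  · intro l; simp only [ev_q]; exact hasDerivAt_const _ _
  · intro i hi
    by_cases h : i = 0
    · subst h
      simp only [ev_q, Function.update_self, if_true, Function.update_of_ne hk0, if_neg hk0.symm,
        add_zero]
      have := key (z 0) (z k) h0 h1 (by rwa [add_comm])
      simpa only [add_comm (z k)] using this
    · by_cases h' : i = k
      · subst h'
        simp only [ev_q, Function.update_self, if_true, Function.update_of_ne hk0.symm, if_neg hk0,
          zero_add]
        have := key (z i) (z 0) h1 h0 h2
        simpa only [mul_comm (z 0)] using this
      · simp only [ev_q, Function.update_of_ne (Ne.symm h), Function.update_of_ne (Ne.symm h'),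
          if_neg h, if_neg h', add_zero]
        exact hasDerivAt_const _ _
  · intro j hj L _
    rw [AA_q]
    have h3 : z k + z 0 ≠ 0 := by rwa [add_comm]
    simp [Finset.sum_ite_eq', mul_add, Finset.sum_add_distrib, hk, (by omega : 0 < n)]
    have h4 : z k + z 0 = z 0 + z k := add_comm _ _
    rw [h4]
    field_simp
    ring

lemma chain {n : ℕ} {ρ : ℕ → ℝ} {z : ℕ → ℂ} (hρ : ρ 0 ≠ 0) (hz : GoodZ n z) {f : PR}
    (hf : f ∈ R0 n) : ChainP n ρ z f := by
  have hc : (ρ 0 : ℂ) ≠ 0 := by exact_mod_cast hρ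
  refine R0_induction (P := fun f => ChainP n ρ z f) ?_ ?_ ?_ ?_ ?_ ?_ ?_ hf
  · intro a
    refine ⟨fun _ => 0, fun _ => 0, ?_, ?_, 0, by simp, ?_⟩
    · intro l; simp only [AlgHom.commutes]; exact hasDerivAt_const _ _
    · intro l _; simp only [AlgHom.commutes]; exact hasDerivAt_const _ _
    · intro j hj L _
      simp [Derivation.map_algebraMap]
  · intro k
    refine ⟨fun l => if l = k then 1 else 0, fun _ => 0, ?_, ?_, k + 1, ?_, ?_⟩
    · intro l
      simp only [ev_r]
      by_cases h : l = k
      · subst h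
        simp only [Function.update_self, if_true]
        exact Complex.ofRealCLM.hasDerivAt
      · simp only [Function.update_of_ne (Ne.symm h), if_neg h]
        exact hasDerivAt_const _ _
    · intro l _; simp only [ev_r]; exact hasDerivAt_const _ _
    · intro l hl; exact if_neg (by omega)
    · intro j hj L hL
      have hk : k < L := by omega
      rw [AA_r]
      have e2 : ev ρ z 2 = 2 := map_ofNat _ 2
      have e3 : ev ρ z 3 = 3 := map_ofNat _ 3
      simp [cR, hk, e2, e3]
      field_simp
      try ring
  · refine ⟨fun l => if l = 0 then -((ρ 0 : ℂ) ^ 2)⁻¹ else 0, fun _ => 0, ?_, ?_, 1, ?_, ?_⟩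
    · intro l
      simp only [ev_u]
      by_cases h : l = 0
      · subst h
        simp only [Function.update_self, if_true]
        have h1 : HasDerivAt (fun t : ℝ => (t : ℂ)) 1 (ρ 0) := Complex.ofRealCLM.hasDerivAt
        refine (h1.inv hc).congr_deriv ?_
        field_simp
      · simp only [Function.update_of_ne (Ne.symm h), if_neg h]
        exact hasDerivAt_const _ _
    · intro l _; simp only [ev_u]; exact hasDerivAt_const _ _
    · intro l hl; exact if_neg (by omega)
    · intro j hj L hL
      have hk : 0 < L := by omega
      rw [AA_u]
      have e2 : ev ρ z 2 = 2 := map_ofNat _ 2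
      have e3 : ev ρ z 3 = 3 := map_ofNat _ 3
      simp [cR, hk, e2, e3]
      field_simp
      try ring
  · intro k hk
    have h1 := (hz k hk).1
    refine ⟨fun l => 0, fun i => if i = k then -((z k) ^ 2)⁻¹ else 0, ?_, ?_, 0, by simp, ?_⟩
    · intro l; simp only [ev_x]; exact hasDerivAt_const _ _
    · intro i hi
      simp only [ev_x]
      by_cases h : i = k
      · subst h
        simp only [Function.update_self, if_true]
        exact hasDerivAt_inv h1
      · simp only [Function.update_of_ne (Ne.symm h), if_neg h]
        exact hasDerivAt_const _ _
    · intro j hj L hL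
      rw [AA_x]
      simp [hk]
      field_simp
  · intro k hk
    by_cases h : k = 0
    · subst h; exact chain_q0 hρ hk hz
    · exact chain_q hρ hz k h hk
  · rintro f g ⟨dl, de, h1, h2, L0, h3, h4⟩ ⟨dl', de', h1', h2', L0', h3', h4'⟩
    refine ⟨fun l => dl l + dl' l, fun i => de i + de' i, ?_, ?_, max L0 L0', ?_, ?_⟩
    · intro l; simp only [map_add]; exact (h1 l).add (h1' l)
    · intro l hl; simp only [map_add]; exact (h2 l hl).add (h2' l hl)
    · intro l hl
      simp [h3 l (le_trans (le_max_left _ _) hl), h3' l (le_trans (le_max_right _ _) hl)]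
    · intro j hj L hL
      rw [map_add, map_add, ← h4 j hj L (le_trans (le_max_left _ _) hL),
        ← h4' j hj L (le_trans (le_max_right _ _) hL)]
      simp only [mul_add, Finset.sum_add_distrib]
      ring
  · rintro f g ⟨dl, de, h1, h2, L0, h3, h4⟩ ⟨dl', de', h1', h2', L0', h3', h4'⟩
    refine ⟨fun l => dl l * ev ρ z g + ev ρ z f * dl' l,
      fun i => de i * ev ρ z g + ev ρ z f * de' i, ?_, ?_, max L0 L0', ?_, ?_⟩
    · intro l; simp only [map_mul]
      have := (h1 l).mul (h1' l)
      simp only [Function.update_eq_self] at this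
      exact this
    · intro l hl; simp only [map_mul]
      have := (h2 l hl).mul (h2' l hl)
      simp only [Function.update_eq_self] at this
      exact this
    · intro l hl
      simp [h3 l (le_trans (le_max_left _ _) hl), h3' l (le_trans (le_max_right _ _) hl)]
    · intro j hj L hL
      rw [AA_mul, map_add, map_mul, map_mul, ← h4 j hj L (le_trans (le_max_left _ _) hL),
        ← h4' j hj L (le_trans (le_max_right _ _) hL)]
      have e1 : ∀ (s : Finset ℕ) (a b c : ℕ → ℂ) (p q : ℂ), ∑ l ∈ s, c l * (a l * p + q * b l)
          = p * ∑ l ∈ s, c l * a l + q * ∑ l ∈ s, c l * b l := by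
        intro s a b c p q
        rw [Finset.mul_sum, Finset.mul_sum, ← Finset.sum_add_distrib]
        exact Finset.sum_congr rfl fun _ _ => by ring
      rw [e1, e1]
      ring

lemma goodZ_eventually {n : ℕ} {z : ℕ → ℂ} (hz : GoodZ n z) (i : ℕ) :
    ∀ᶠ v in nhds (z i), GoodZ n (Function.update z i v) := by
  have hc : ∀ k, Continuous (fun v : ℂ => Function.update z i v k) := by
    intro k
    by_cases h : k = i
    · subst h; simpa using continuous_id'
    · simp only [Function.update_of_ne h]; exact continuous_const
  have : ∀ k ∈ Set.Iio n, ∀ᶠ v in nhds (z i), Function.update z i v k ≠ 0 ∧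
      Function.update z i v 0 + Function.update z i v k ≠ 0 := by
    intro k hk
    have h1 := hz k hk
    refine Filter.Eventually.and ?_ ?_
    · refine (hc k).continuousAt.eventually_ne ?_
      simpa using h1.1
    · refine ((hc 0).add (hc k)).continuousAt.eventually_ne ?_
      simpa using h1.2
  exact (Filter.eventually_all_finite (Set.finite_Iio n)).2 this

lemma rho_eventually {ρ : ℕ → ℝ} (hρ : ρ 0 ≠ 0) (l : ℕ) :
    ∀ᶠ t in nhds (ρ l), Function.update ρ l t 0 ≠ 0 := by
  by_cases h : l = 0
  · subst h
    simpa using eventually_ne_nhds hρ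
  · simp only [Function.update_of_ne (Ne.symm h)]
    exact Filter.Eventually.of_forall fun _ => hρ

lemma AdagFree_ev {n : ℕ} {F : (ℕ → ℝ) → (ℕ → ℂ) → ℂ} {ρ : ℕ → ℝ} {z : ℕ → ℂ} {w c : ℂ} {f : PR}
    (hρ : ρ 0 ≠ 0) (hz : GoodZ n z) (hf : f ∈ R0 n)
    (hF : ∀ ρ z, ρ 0 ≠ 0 → GoodZ n z → F ρ z = c * ev ρ z f) (j : ℕ) (hj : z j = w) (hw : w ≠ 0) :
    AdagFree (Finset.range n) F ρ z w = c * ev ρ z (AA j f) := by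
  subst hj
  obtain ⟨dl, de, h1, h2, L0, h3, h4⟩ := chain hρ hz hf
  have p1 : ∀ l, pdC (fun σ => F σ z) l ρ = c * dl l := by
    intro l
    unfold pdC
    refine HasDerivAt.deriv ?_
    refine ((h1 l).const_mul c).congr_of_eventuallyEq ?_
    filter_upwards [rho_eventually hρ l] with t ht
    exact hF _ _ ht hz
  have p2 : ∀ i, i < n → deriv (fun v => F ρ (Function.update z i v)) (z i) = c * de i := by
    intro i hi
    refine HasDerivAt.deriv ?_
    refine ((h2 i hi).const_mul c).congr_of_eventuallyEq ?_
    filter_upwards [goodZ_eventually hz i] with t ht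
    exact hF _ _ hρ ht
  unfold AdagFree
  rw [← h4 j hw L0 le_rfl, tsum_eq_sum (s := Finset.range L0), mul_add, Finset.mul_sum,
    Finset.mul_sum]
  · congr 1
    · refine Finset.sum_congr rfl fun l _ => ?_
      rw [p1, cR]; ring
    · refine Finset.sum_congr rfl fun i hi => ?_
      rw [p2 i (Finset.mem_range.1 hi)]; ring
  · intro l hl
    rw [p1, h3 l (by simpa using hl)]; ring

/-- Null elements: those evaluating to zero on all good configurations. -/
def Nl (n : ℕ) (p : PR) : Prop := ∀ ρ z, ρ 0 ≠ 0 → GoodZ n z → ev ρ z p = 0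

lemma Nl_AA {n i : ℕ} (hi : i < n) {p : PR} (hp : p ∈ R0 n) (h : Nl n p) : Nl n (AA i p) := by
  intro ρ z hρ hz
  have := AdagFree_ev (F := fun _ _ => 0) (c := 1) hρ hz hp (fun ρ z h1 h2 => by simp [h ρ z h1 h2])
    i rfl (hz i hi).1
  rw [one_mul] at this
  rw [← this]
  simp [AdagFree, pdC]

lemma Nl_add {n : ℕ} {p q : PR} (h1 : Nl n p) (h2 : Nl n q) : Nl n (p + q) := by
  intro ρ z a b; rw [map_add, h1 ρ z a b, h2 ρ z a b, add_zero]

lemma Nl_sub {n : ℕ} {p q : PR} (h1 : Nl n p) (h2 : Nl n q) : Nl n (p - q) := by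
  intro ρ z a b; rw [map_sub, h1 ρ z a b, h2 ρ z a b, sub_zero]

lemma Nl_u {n : ℕ} (p : PR) : Nl n ((rr 0 * uu - 1) * p) := by
  intro ρ z a b
  have : (ρ 0 : ℂ) ≠ 0 := by exact_mod_cast a
  simp [this]

/-! ### Iterated boundary creation -/

instance AAlc : LeftCommutative (fun (i : ℕ) (p : PR) => AA i p) := ⟨fun i j p => AA_comm i j p⟩

/-- Iterated boundary creation over the labels in `I`. -/
def Wm (b : PR) (I : Multiset ℕ) : PR := Multiset.foldr (fun (i : ℕ) (p : PR) => AA i p) b I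

def W (bs : ℕ → PR) (g : ℕ) (I : Finset ℕ) : PR := Wm (bs g) I.val

def Wo (bs : ℕ → PR) (g : ℕ) (I : Finset ℕ) : PR := if g = 0 ∧ I = ∅ then 0 else W bs g I

lemma W_empty (bs : ℕ → PR) (g : ℕ) : W bs g ∅ = bs g := by simp [W, Wm]

lemma W_insert (bs : ℕ → PR) (g : ℕ) {i : ℕ} {I : Finset ℕ} (h : i ∉ I) :
    W bs g (insert i I) = AA i (W bs g I) := by
  simp only [W, Wm, Finset.insert_val_of_notMem h, Multiset.foldr_cons]

lemma S0_mono {n m : ℕ} (h : n ≤ m) : S0 n ≤ S0 m := by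
  apply MvPolynomial.supported_mono
  rintro (l | _ | k | k | _) hv
  · trivial
  · trivial
  · exact ⟨hv.1, lt_of_lt_of_le hv.2 h⟩
  · exact hv
  · exact hv

lemma Odd0_mono {n m : ℕ} (h : n ≤ m) : Odd0 n ≤ Odd0 m := by
  apply Submodule.span_mono
  rintro f ⟨c, hc, k, rfl⟩
  exact ⟨c, S0_mono h hc, k, rfl⟩

lemma Odd0_le_R0 {n : ℕ} (hn : 0 < n) {f : PR} (hf : f ∈ Odd0 n) : f ∈ R0 n := by
  refine Odd0_induction (P := fun f => f ∈ R0 n) (zero_mem _) ?_ ?_ hf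
  · intro c hc k
    exact mul_mem (S0_le_R0 n hc) (pow_mem (x_memR hn) _)
  · intro f g; exact add_mem

/-- The family of base functions. -/
structure Base (bs : ℕ → PR) : Prop where
  zero : bs 0 = oo
  pos : ∀ g, g ≠ 0 → bs g ∈ Odd0 1

lemma W_single {bs : ℕ → PR} (hb : Base bs) (i : ℕ) : W bs 0 {i} = qq i := by
  have := W_insert bs 0 (i := i) (I := ∅) (by simp)
  rw [insert_empty_eq] at this
  rw [this, W_empty, hb.zero, AA_o]

lemma W_pair {bs : ℕ → PR} (hb : Base bs) {i j : ℕ} (h : i ≠ j) :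
    W bs 0 {i, j} = -(uu * xx i ^ 3 * xx 0 ^ 3 * xx j ^ 3) := by
  rw [W_insert bs 0 (by simpa using h), W_single hb, AA_q]

lemma W_Odd0 {bs : ℕ → PR} (hb : Base bs) {n g : ℕ} {J : Finset ℕ} (hn : 0 < n)
    (hJ : ∀ i ∈ J, 0 < i ∧ i < n) (h : g ≠ 0 ∨ 2 ≤ J.card) : W bs g J ∈ Odd0 n := by
  induction J using Finset.induction_on with
  | empty =>
    rw [W_empty]
    rcases h with h | h
    · exact Odd0_mono hn (hb.pos g h)
    · simp at h
  | insert i J hi ih =>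
    by_cases h' : g ≠ 0 ∨ 2 ≤ J.card
    · rw [W_insert _ _ hi]
      exact AA_Odd0 (hJ i (by simp)) (ih (fun k hk => hJ k (by simp [hk])) h')
    · push Not at h'
      obtain ⟨rfl, hc⟩ := h'
      simp [Finset.card_insert_of_notMem hi] at h
      have : J.card = 1 := by
        have h2 : 1 ≤ J.card := by simpa using h
        omega
      obtain ⟨j, rfl⟩ := Finset.card_eq_one.1 this
      rw [W_pair hb (by simpa using hi)]
      have := mem_Odd0 (n := n) (c := -(uu * xx i ^ 3 * xx j ^ 3)) (neg_mem (mul_mem (mul_mem (u_mem _)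
        (pow_mem (x_mem (hJ i (by simp))) _)) (pow_mem (x_mem (hJ j (by simp))) _))) 0
      convert this using 1
      ring

lemma Wo_R0 {bs : ℕ → PR} (hb : Base bs) {n g : ℕ} {J : Finset ℕ} (hn : 0 < n)
    (hJ : ∀ i ∈ J, 0 < i ∧ i < n) : Wo bs g J ∈ R0 n := by
  unfold Wo
  split_ifs with h
  · exact zero_mem _
  · by_cases h' : g ≠ 0 ∨ 2 ≤ J.card
    · exact Odd0_le_R0 hn (W_Odd0 hb hn hJ h')
    · push Not at h'
      obtain ⟨rfl, hc⟩ := h'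
      have h1 : J.card ≠ 0 := by simpa using h
      obtain ⟨j, rfl⟩ := Finset.card_eq_one.1 (show J.card = 1 by omega)
      rw [W_single hb]
      exact q_memR (hJ j (by simp)).2

lemma kap_R0 {n : ℕ} (hn : 0 < n) (k : ℕ) : kap k ∈ R0 n := by
  induction k with
  | zero => exact mul_mem (r_memR _ _) (pow_mem (x_memR hn) _)
  | succ k ih => exact add_mem (mul_mem (pow_mem (x_memR hn) _) ih) (mul_mem (r_memR _ _) (pow_mem (x_memR hn) _))

lemma tau_R0 {n i : ℕ} (hi : i < n) (k : ℕ) : tau i k ∈ R0 n := by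
  have hn : 0 < n := by omega
  have h3 : (3 : PR) ∈ R0 n := natCast_mem (R0 n) 3
  induction k with
  | zero => exact add_mem (mul_mem (pow_mem (x_memR hi) _) (pow_mem (x_memR hn) _)) (mul_mem
      (mul_mem h3 (pow_mem (x_memR hi) _)) (pow_mem (x_memR hn) _))
  | succ k ih =>
    have h5 : (2 * (k : PR) + 5) ∈ R0 n := by
      have := natCast_mem (R0 n) (2 * k + 5)
      push_cast at this
      exact this
    exact add_mem (mul_mem (pow_mem (x_memR hn) _) ih) (mul_mem
      (mul_mem h5 (pow_mem (x_memR hi) _)) (pow_mem (x_memR hn) _))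

lemma KK_R0 {n : ℕ} (hn : 0 < n) {f : PR} (hf : f ∈ Odd0 n) : KK f ∈ R0 n := by
  refine Odd0_induction (P := fun f => KK f ∈ R0 n) (by simp) ?_ ?_ hf
  · intro c hc k
    rw [KK_mul hc]; exact mul_mem (S0_le_R0 n hc) (kap_R0 hn k)
  · intro f g h1 h2; rw [map_add]; exact add_mem h1 h2

lemma UU_R0 {n i : ℕ} (hi : i < n) {f : PR} (hf : f ∈ Odd0 n) : UU i f ∈ R0 n := by
  refine sub_mem ?_ (mul_mem (q_memR hi) (Odd0_le_R0 (by omega) hf))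
  refine Odd0_induction (P := fun f => TT i f ∈ R0 n) (by simp) ?_ ?_ hf
  · intro c hc k
    rw [TT_mul i hc]; exact mul_mem (S0_le_R0 n hc) (tau_R0 hi k)
  · intro f g h1 h2; rw [map_add]; exact add_mem h1 h2

/-- The left-hand side of the universal loop equation. -/
def EE (bs : ℕ → PR) (κ : ℝ) (g : ℕ) (J : Finset ℕ) : PR :=
  KK (W bs g J) + κ • (if g = 0 then 0 else AA 0 (W bs (g - 1) J))
  + (1 / 2 : ℝ) • (∑ h ∈ Finset.range (g + 1), ∑ I ∈ J.powerset, Wo bs h I * Wo bs (g - h) (J \ I))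
  + ∑ β ∈ J, UU β (W bs g (J.erase β))

lemma EE_R0 {bs : ℕ → PR} (hb : Base bs) (κ : ℝ) {n g : ℕ} {J : Finset ℕ} (hn : 0 < n)
    (hJ : ∀ i ∈ J, 0 < i ∧ i < n) (h : g ≠ 0 ∨ 3 ≤ J.card) : EE bs κ g J ∈ R0 n := by
  unfold EE
  refine add_mem (add_mem (add_mem ?_ ?_) ?_) ?_
  · exact KK_R0 hn (W_Odd0 hb hn hJ (by omega))
  · refine Subalgebra.smul_mem _ ?_ _
    split_ifs with h0
    · exact zero_mem _
    · by_cases h2 : g - 1 = 0 ∧ J = ∅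
      · rw [h2.1, h2.2, W_empty, hb.zero, AA_o]
        exact q_memR hn
      · have : Wo bs (g - 1) J = W bs (g - 1) J := by simp [Wo, h2]
        rw [← this]
        exact AA_R0 hn (Wo_R0 hb hn hJ)
  · refine Subalgebra.smul_mem _ ?_ _
    refine sum_mem fun h _ => sum_mem fun I hI => ?_
    have hI' := Finset.mem_powerset.1 hI
    refine mul_mem (Wo_R0 hb hn fun i hi => hJ i (hI' hi)) (Wo_R0 hb hn fun i hi => hJ i ?_)
    exact (Finset.mem_sdiff.1 hi).1
  · refine sum_mem fun β hβ => UU_R0 (hJ β hβ).2 (W_Odd0 hb hn (fun i hi => hJ i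
      (Finset.mem_of_mem_erase hi)) ?_)
    rw [Finset.card_erase_of_mem hβ]
    omega

lemma Wo_insert {bs : ℕ → PR} (hb : Base bs) (g : ℕ) {i : ℕ} {I : Finset ℕ} (h : i ∉ I) :
    Wo bs g (insert i I) = AA i (Wo bs g I) + (if g = 0 ∧ I = ∅ then qq i else 0) := by
  have h1 : Wo bs g (insert i I) = W bs g (insert i I) := by simp [Wo]
  rw [h1, W_insert _ _ h]
  unfold Wo
  split_ifs with h2
  · obtain ⟨rfl, rfl⟩ := h2
    rw [W_empty, hb.zero, AA_o]; simp
  · simp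

lemma EE_prod_step {bs : ℕ → PR} (hb : Base bs) {g i : ℕ} {J : Finset ℕ} (hi : i ∉ J)
    (h : g ≠ 0 ∨ J ≠ ∅) :
    ∑ h ∈ Finset.range (g + 1), ∑ I ∈ (insert i J).powerset, Wo bs h I * Wo bs (g - h) (insert i J \ I)
    = AA i (∑ h ∈ Finset.range (g + 1), ∑ I ∈ J.powerset, Wo bs h I * Wo bs (g - h) (J \ I))
      + 2 * (qq i * W bs g J) := by
  have hW : Wo bs g J = W bs g J := by
    unfold Wo; rw [if_neg]; tauto
  have key : ∀ h ∈ Finset.range (g + 1), ∑ I ∈ (insert i J).powerset, Wo bs h I * Wo bs (g - h) (insert i J \ I)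
      = AA i (∑ I ∈ J.powerset, Wo bs h I * Wo bs (g - h) (J \ I))
       + ((if h = g then qq i * Wo bs h J else 0) + (if h = 0 then qq i * Wo bs (g - h) J else 0)) := by
    intro h hh
    have hh' : h ≤ g := by simpa [Nat.lt_succ_iff] using hh
    rw [Finset.sum_powerset_insert hi, ← Finset.sum_add_distrib, map_sum]
    have e1 : (if h = g then qq i * Wo bs h J else 0) = ∑ I ∈ J.powerset, (if I = J then
        (if h = g then qq i * Wo bs h I else 0) else 0) := by
      rw [Finset.sum_ite_eq']; simp
    have e2 : (if h = 0 then qq i * Wo bs (g - h) J else 0) = ∑ I ∈ J.powerset, (if I = ∅ then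
        (if h = 0 then qq i * Wo bs (g - h) (J \ I) else 0) else 0) := by
      rw [Finset.sum_ite_eq']; simp
    rw [e1, e2, ← Finset.sum_add_distrib, ← Finset.sum_add_distrib]
    refine Finset.sum_congr rfl fun I hI => ?_
    have hI' := Finset.mem_powerset.1 hI
    have hiI : i ∉ I := fun h => hi (hI' h)
    rw [Finset.insert_sdiff_of_notMem _ hiI, Finset.insert_sdiff_insert,
      Finset.sdiff_insert_of_notMem hi, Wo_insert hb _ hiI, Wo_insert hb _ (by simp [hi]), AA_mul]
    have a1 : (g - h = 0 ∧ J \ I = ∅) ↔ (I = J ∧ h = g) := by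
      rw [Finset.sdiff_eq_empty_iff_subset]
      constructor
      · rintro ⟨h1, h2⟩; exact ⟨Finset.Subset.antisymm hI' h2, by omega⟩
      · rintro ⟨rfl, rfl⟩; simp
    simp only [a1]
    by_cases b1 : I = J ∧ h = g <;> by_cases b2 : h = 0 ∧ I = ∅
    · simp only [if_pos b1.1, if_pos b1.2, if_pos b2.1, if_pos b2.2, if_pos b1, if_pos b2]; ring
    · have b2' : ¬ (I = ∅ ∧ h = 0) := by tauto
      simp only [if_pos b1.1, if_pos b1.2, if_pos b1, if_neg b2, ← ite_and, if_neg b2']; ring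
    · simp only [if_pos b2.1, if_pos b2.2, if_pos b2, if_neg b1, ← ite_and]; ring
    · have b2' : ¬ (I = ∅ ∧ h = 0) := by tauto
      simp only [if_neg b1, if_neg b2, ← ite_and, if_neg b2']; ring
  rw [Finset.sum_congr rfl key, Finset.sum_add_distrib, Finset.sum_add_distrib, Finset.sum_ite_eq',
    Finset.sum_ite_eq', map_sum]
  simp [hW]
  ring

lemma EE_step {bs : ℕ → PR} (hb : Base bs) (κ : ℝ) {n g i : ℕ} {J : Finset ℕ} (hi : i ∉ J)
    (hi' : 0 < i ∧ i < n)
    (hJ : ∀ i ∈ J, 0 < i ∧ i < n) (h : g ≠ 0 ∨ 3 ≤ J.card) :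
    AA i (EE bs κ g J) = EE bs κ g (insert i J)
      + (rr 0 * uu - 1) * (xx i ^ 3 * xx 0 * W bs g J) := by
  have hn : 0 < n := by omega
  have hne : g ≠ 0 ∨ J ≠ ∅ := by
    rcases h with h | h
    · exact Or.inl h
    · right; rintro rfl; simp at h
  have hO := W_Odd0 hb hn hJ (g := g) (by omega)
  unfold EE
  rw [EE_prod_step hb hi hne, Finset.sum_insert hi, Finset.erase_insert hi]
  simp only [map_add, Derivation.map_smul]
  rw [map_sum (AA i) _ J]
  rw [AA_KK hi' hO, W_insert _ _ hi, W_insert _ _ hi]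
  have e1 : AA i (if g = 0 then 0 else AA 0 (W bs (g - 1) J)) =
      if g = 0 then 0 else AA 0 (AA i (W bs (g - 1) J)) := by
    split_ifs
    · simp
    · rw [AA_comm]
  have e2 : ∀ β ∈ J, AA i (UU β (W bs g (J.erase β))) = UU β (W bs g ((insert i J).erase β)) := by
    intro β hβ
    have hne : i ≠ β := by rintro rfl; exact hi hβ
    rw [Finset.erase_insert_of_ne hne, W_insert _ _ (by simp [hi]), AA_UU hi']
    refine W_Odd0 hb hn (fun i hi => hJ i (Finset.mem_of_mem_erase hi)) ?_
    rw [Finset.card_erase_of_mem hβ]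
    omega
  rw [e1, Finset.sum_congr rfl e2]
  have e3 : TT i (W bs g J) = UU i (W bs g J) + qq i * W bs g J := by rw [UU]; ring
  have e4 : (1 / 2 : ℝ) • (2 * (qq i * W bs g J)) = qq i * W bs g J := by
    rw [Algebra.smul_def]
    have : (2 : PR) = algebraMap ℝ PR 2 := (map_ofNat (algebraMap ℝ PR) 2).symm
    rw [this, ← mul_assoc, ← map_mul]
    norm_num
  rw [e3, smul_add, e4]
  ring

lemma EE_pos {bs : ℕ → PR} (hb : Base bs) (κ : ℝ) {n g : ℕ} (hg : g ≠ 0) (hn : 0 < n)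
    (h0 : Nl n (EE bs κ g ∅)) {J : Finset ℕ} (hJ : ∀ i ∈ J, 0 < i ∧ i < n) : Nl n (EE bs κ g J) := by
  induction J using Finset.induction_on with
  | empty => exact h0
  | insert i J hi ih =>
    have hJ' : ∀ i ∈ J, 0 < i ∧ i < n := fun k hk => hJ k (by simp [hk])
    have hi' := hJ i (by simp)
    have h1 := Nl_AA hi'.2 (EE_R0 hb κ hn hJ' (Or.inl hg)) (ih hJ')
    rw [EE_step hb κ hi hi' hJ' (Or.inl hg)] at h1
    have := Nl_sub h1 (Nl_u (n := n) (xx i ^ 3 * xx 0 * W bs g J))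
    simpa using this

lemma EE_base {bs : ℕ → PR} (hb : Base bs) (κ : ℝ) {n i j k : ℕ} (hi : 0 < i ∧ i < n)
    (hj : 0 < j ∧ j < n) (hk : 0 < k ∧ k < n) (hij : i ≠ j) (hik : i ≠ k) (hjk : j ≠ k) :
    Nl n (EE bs κ 0 {i, j, k}) := by
  have h1 : W bs 0 {i, j, k} = AA i (-(uu * xx j ^ 3 * xx 0 ^ 3 * xx k ^ 3)) := by
    rw [W_insert _ _ (by simp [hij, hik]), W_pair hb hjk]
  have h2 : AA i (-(uu * xx j ^ 3 * xx 0 ^ 3 * xx k ^ 3)) =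
     (AA i (-(uu * xx j ^ 3 * xx k ^ 3))) * xx 0 ^ (2 * 0 + 3)
       + (3 * uu ^ 2 * xx i ^ 3 * xx j ^ 3 * xx k ^ 3) * xx 0 ^ (2 * 1 + 3) := by
    simp only [map_neg, AA_mul, AA_xpow]
    push_cast
    ring
  have m3 : (3 : PR) ∈ S0 n := natCast_mem (S0 n) 3
  have mem : ∀ a b, 0 < a ∧ a < n → 0 < b ∧ b < n → -(uu * xx a ^ 3 * xx b ^ 3) ∈ S0 n :=
    fun a b ha hb => neg_mem (mul_mem (mul_mem (u_mem _) (pow_mem (x_mem ha) _)) (pow_mem (x_mem hb) _))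
  have hT : ∀ a b c, 0 < a ∧ a < n → 0 < b ∧ b < n → TT c (-(uu * xx a ^ 3 * xx 0 ^ 3 * xx b ^ 3))
      = -(uu * xx a ^ 3 * xx b ^ 3) * tau c 0 := by
    intro a b c ha hb
    rw [← TT_mul c (mem a b ha hb) 0]
    congr 1; ring
  have hK : KK (W bs 0 {i, j, k}) = AA i (-(uu * xx j ^ 3 * xx k ^ 3)) * kap 0
      + (3 * uu ^ 2 * xx i ^ 3 * xx j ^ 3 * xx k ^ 3) * kap 1 := by
    rw [h1, h2, map_add, KK_mul (AA_S0 hi (mem j k hj hk)) 0, KK_mul (n := n) ?_ 1]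
    exact mul_mem (mul_mem (mul_mem (mul_mem m3 (pow_mem (u_mem _) _)) (pow_mem (x_mem hi) _))
      (pow_mem (x_mem hj) _)) (pow_mem (x_mem hk) _)
  have eI : ({i, j, k} : Finset ℕ).erase i = {j, k} := by
    ext a; simp; grind
  have eJ : ({i, j, k} : Finset ℕ).erase j = {i, k} := by
    ext a; simp; grind
  have eK : ({i, j, k} : Finset ℕ).erase k = {i, j} := by
    ext a; simp; grind
  have hP : ∑ I ∈ ({i, j, k} : Finset ℕ).powerset, Wo bs 0 I * Wo bs 0 ({i, j, k} \ I)
      = 2 * (qq i * W bs 0 {j, k} + qq j * W bs 0 {i, k} + qq k * W bs 0 {i, j}) := by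
    have s1 : ({j, k} : Finset ℕ) ≠ ∅ := by simp
    have := EE_prod_step hb (g := 0) (i := i) (J := {j, k}) (by simp [hij, hik]) (Or.inr s1)
    simp only [Finset.range_one, Finset.sum_singleton, zero_add, Nat.sub_self] at this
    rw [this]
    have := EE_prod_step hb (g := 0) (i := j) (J := {k}) (by simp [hjk]) (Or.inr (by simp))
    simp only [Finset.range_one, Finset.sum_singleton, zero_add, Nat.sub_self] at this
    rw [this]
    have h0 : ∑ I ∈ ({k} : Finset ℕ).powerset, Wo bs 0 I * Wo bs 0 ({k} \ I) = 0 := by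
      refine Finset.sum_eq_zero fun I hI => ?_
      rcases (Finset.mem_powerset.1 hI).eq_or_ssubset with rfl | h
      · simp [Wo]
      · simp at h; subst h; simp [Wo]
    have e2 : AA i (2 : PR) = 0 := AA_nat i 2
    rw [h0, W_single hb, W_pair hb hjk, W_pair hb hik, W_pair hb hij]
    simp only [map_zero, zero_add, AA_mul, AA_q, e2]
    ring
  intro ρ z hρ hz
  have hc : (ρ 0 : ℂ) ≠ 0 := by exact_mod_cast hρ
  have hhalf : ∀ p : PR, (1 / 2 : ℝ) • (2 * p) = p := by
    intro p
    rw [Algebra.smul_def]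
    have : (2 : PR) = algebraMap ℝ PR 2 := (map_ofNat (algebraMap ℝ PR) 2).symm
    rw [this, ← mul_assoc, ← map_mul]
    norm_num
  unfold EE
  rw [hK, Finset.sum_insert (by simp [hij, hik]), Finset.sum_pair hjk, eI, eJ, eK]
  simp only [if_true, smul_zero, zero_add, Finset.range_one, Finset.sum_singleton, Nat.sub_self]
  rw [hP, hhalf, UU, UU, UU, W_pair hb hjk, W_pair hb hik, W_pair hb hij, hT _ _ _ hj hk,
    hT _ _ _ hi hk, hT _ _ _ hi hj]
  have e3 : ev ρ z 3 = 3 := map_ofNat _ 3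
  simp only [map_add, map_neg, map_sub, AA_mul, AA_u, AA_xpow, kap, tau, map_mul, map_pow, ev_r, ev_u, ev_x,
    ev_q, e3, map_natCast, map_zero]
  have := (hz 0 (by omega)).1
  have := (hz i hi.2).1
  have := (hz j hj.2).1
  have := (hz k hk.2).1
  generalize (z 0 * z i * (z 0 + z i) ^ 2)⁻¹ = q1
  generalize (z 0 * z j * (z 0 + z j) ^ 2)⁻¹ = q2
  generalize (z 0 * z k * (z 0 + z k) ^ 2)⁻¹ = q3
  push_cast
  field_simp
  ring

lemma EE_zero {bs : ℕ → PR} (hb : Base bs) (κ : ℝ) {n : ℕ} (hn : 0 < n)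
    {J : Finset ℕ} (hJ : ∀ i ∈ J, 0 < i ∧ i < n) (hc : 3 ≤ J.card) : Nl n (EE bs κ 0 J) := by
  induction J using Finset.induction_on with
  | empty => simp at hc
  | insert i J hi ih =>
    have hJ' : ∀ i ∈ J, 0 < i ∧ i < n := fun k hk => hJ k (by simp [hk])
    have hi' := hJ i (by simp)
    by_cases h3 : 3 ≤ J.card
    · have h1 := Nl_AA hi'.2 (EE_R0 hb κ hn hJ' (Or.inr h3)) (ih hJ' h3)
      rw [EE_step hb κ hi hi' hJ' (Or.inr h3)] at h1
      have := Nl_sub h1 (Nl_u (n := n) (xx i ^ 3 * xx 0 * W bs 0 J))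
      simpa using this
    · rw [Finset.card_insert_of_notMem hi] at hc
      obtain ⟨j, k, hjk, rfl⟩ := Finset.card_eq_two.1 (show J.card = 2 by omega)
      simp at hi
      exact EE_base hb κ hi' (hJ j (by simp)) (hJ k (by simp)) hi.1 hi.2 hjk

lemma coeff_pow_bell (ρ : ℕ → ℝ) (m i : ℕ) :
    PowerSeries.coeff m ((PowerSeries.mk fun k => if k = 0 then 0 else ρ k) ^ i)
      = (i.factorial : ℝ) / (m.factorial : ℝ) * bellP m i (fun j => (j.factorial : ℝ) * ρ j) := by
  set f : PowerSeries ℝ := PowerSeries.mk fun k => if k = 0 then 0 else ρ k with hf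
  set P : PowerSeries ℝ := ∑ t : Fin m, PowerSeries.monomial ((t : ℕ) + 1) (ρ ((t : ℕ) + 1)) with hP
  have hd : (PowerSeries.X : PowerSeries ℝ) ^ (m + 1) ∣ f - P := by
    rw [PowerSeries.X_pow_dvd_iff]
    intro k hk
    rw [map_sub, hP, map_sum, hf, PowerSeries.coeff_mk]
    simp only [PowerSeries.coeff_monomial]
    rcases k with _ | k
    · simp
    · rw [Finset.sum_eq_single (⟨k, by omega⟩ : Fin m)]
      · simp
      · intro b _ hb
        rw [if_neg]
        intro h; apply hb; ext; simp; omega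
      · simp
  have hd2 : (PowerSeries.X : PowerSeries ℝ) ^ (m + 1) ∣ f ^ i - P ^ i :=
    hd.trans (sub_dvd_pow_sub_pow f P i)
  have e1 : PowerSeries.coeff m (f ^ i) = PowerSeries.coeff m (P ^ i) := by
    have := (PowerSeries.X_pow_dvd_iff.1 hd2) m (by omega)
    rw [map_sub] at this
    linarith
  rw [e1, hP, Finset.sum_pow_eq_sum_piAntidiag, map_sum]
  have e2 : ∀ k : Fin m → ℕ, k ∈ Finset.piAntidiag Finset.univ i →
      PowerSeries.coeff m ((Nat.multinomial Finset.univ k : PowerSeries ℝ) *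
        ∏ t : Fin m, (PowerSeries.monomial ((t : ℕ) + 1) (ρ ((t : ℕ) + 1))) ^ k t)
      = if ∑ t : Fin m, ((t : ℕ) + 1) * k t = m then
         (i.factorial : ℝ) / (∏ t, ((k t).factorial : ℝ)) * ∏ t : Fin m, ρ ((t : ℕ) + 1) ^ k t else 0 := by
    intro k hk
    have hk' : ∑ t, k t = i := by simpa using hk
    have h1 : ∏ t : Fin m, (PowerSeries.monomial (R := ℝ) ((t : ℕ) + 1) (ρ ((t : ℕ) + 1))) ^ k t
        = PowerSeries.C (∏ t : Fin m, ρ ((t : ℕ) + 1) ^ k t) *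
          PowerSeries.X ^ (∑ t : Fin m, ((t : ℕ) + 1) * k t) := by
      rw [map_prod, ← Finset.prod_pow_eq_pow_sum, ← Finset.prod_mul_distrib]
      refine Finset.prod_congr rfl fun t _ => ?_
      have hm : PowerSeries.monomial (R := ℝ) ((t : ℕ) + 1) (ρ ((t : ℕ) + 1)) =
          PowerSeries.C (ρ ((t : ℕ) + 1)) * PowerSeries.X ^ ((t : ℕ) + 1) := by
        ext k
        rw [PowerSeries.coeff_monomial, PowerSeries.coeff_C_mul, PowerSeries.coeff_X_pow]
        split_ifs <;> simp
      rw [hm, mul_pow, map_pow, pow_mul]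
    have h2 : (Nat.multinomial Finset.univ k : ℝ) = (i.factorial : ℝ) / (∏ t, ((k t).factorial : ℝ)) := by
      have := Nat.multinomial_spec Finset.univ k
      rw [hk'] at this
      rw [eq_div_iff (by positivity), mul_comm]
      exact_mod_cast this
    have h3 : (Nat.multinomial Finset.univ k : PowerSeries ℝ) =
      PowerSeries.C (Nat.multinomial Finset.univ k : ℝ) := by simp
    rw [h1, h3, ← mul_assoc, ← map_mul, PowerSeries.coeff_C_mul, PowerSeries.coeff_X_pow, h2]
    simp only [eq_comm (a := m)]
    split_ifs <;> simp
  rw [Finset.sum_congr rfl e2, bellP, Finset.mul_sum]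
  simp only [mul_ite, mul_zero]
  rw [← Finset.sum_filter, ← Finset.sum_filter]
  have hle : ∀ k : Fin m → ℕ, ∑ t : Fin m, ((t : ℕ) + 1) * k t = m → ∀ t, k t ≤ m := by
    intro k hk t
    have : ((t : ℕ) + 1) * k t ≤ ∑ t : Fin m, ((t : ℕ) + 1) * k t :=
      Finset.single_le_sum (f := fun t : Fin m => ((t : ℕ) + 1) * k t) (fun _ _ => Nat.zero_le _) (Finset.mem_univ t)
    rw [hk] at this
    nlinarith
  refine Finset.sum_bij' (fun k _ => fun t => (Fin.ofNat (m + 1) (k t))) (fun j _ => fun t => (j t : ℕ)) ?_ ?_ ?_ ?_ ?_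
  · intro k hk
    simp only [Finset.mem_filter, Finset.mem_piAntidiag, Finset.mem_univ, true_and] at hk ⊢
    have := hle k hk.2
    have e : ∀ t, ((Fin.ofNat (m + 1) (k t) : Fin (m + 1)) : ℕ) = k t := fun t => by
      simp only [Fin.val_ofNat]; exact Nat.mod_eq_of_lt (by have := this t; omega)
    simp only [e]
    exact ⟨hk.1.1, hk.2⟩
  · intro j hj
    simp only [Finset.mem_filter, Finset.mem_piAntidiag, Finset.mem_univ, true_and] at hj ⊢
    exact ⟨⟨hj.1, fun _ _ => trivial⟩, hj.2⟩
  · intro k hk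
    simp only [Finset.mem_filter, Finset.mem_piAntidiag, Finset.mem_univ, true_and] at hk
    funext t
    simp only [Fin.val_ofNat]; exact Nat.mod_eq_of_lt (by have := hle k hk.2 t; omega)
  · intro j hj
    funext t
    ext
    simp only [Fin.val_ofNat]; exact Nat.mod_eq_of_lt (j t).2
  · intro k hk
    simp only [Finset.mem_filter, Finset.mem_piAntidiag, Finset.mem_univ, true_and] at hk
    have := hle k hk.2
    have e : ∀ t, ((Fin.ofNat (m + 1) (k t) : Fin (m + 1)) : ℕ) = k t := fun t => by
      simp only [Fin.val_ofNat]; exact Nat.mod_eq_of_lt (by have := this t; omega)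
    simp only [e]
    have e2 : ∀ t : Fin m, (((t : ℕ) + 1).factorial : ℝ) * ρ ((t : ℕ) + 1) / (((t : ℕ) + 1).factorial : ℝ)
       = ρ ((t : ℕ) + 1) := fun t => by field_simp
    simp only [e2]
    field_simp

lemma Sm_conv {ρ : ℕ → ℝ} (h0 : ρ 0 ≠ 0) (n : ℕ) :
    ∑ p ∈ Finset.HasAntidiagonal.antidiagonal n, ρ p.1 * (Sm ρ p.2 / (p.2.factorial : ℝ)) = if n = 0 then ρ 0 else 0 := by
  set f : PowerSeries ℝ := PowerSeries.mk fun k => if k = 0 then 0 else ρ k with hf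
  set y : PowerSeries ℝ := PowerSeries.C (-(ρ 0)⁻¹) * f with hy
  have hX : (PowerSeries.X : PowerSeries ℝ) ∣ f := by
    rw [PowerSeries.X_dvd_iff]; simp [hf]
  have hz : ∀ m i, m < i → PowerSeries.coeff m (f ^ i) = 0 := by
    intro m i hmi
    exact PowerSeries.X_pow_dvd_iff.1 (pow_dvd_pow_of_dvd hX i) m hmi
  have hyi : ∀ m i, PowerSeries.coeff m (y ^ i) = (-(ρ 0)⁻¹) ^ i * PowerSeries.coeff m (f ^ i) := by
    intro m i
    rw [hy, mul_pow, ← map_pow, PowerSeries.coeff_C_mul]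
  set T : PowerSeries ℝ := ∑ i ∈ Finset.range (n + 1), y ^ i with hT
  have hTc : ∀ m, m ≤ n → PowerSeries.coeff m T = Sm ρ m / (m.factorial : ℝ) := by
    intro m hm
    rw [hT, map_sum, Sm, Finset.sum_div]
    have : Finset.range (m + 1) ⊆ Finset.range (n + 1) := Finset.range_mono (by omega)
    rw [← Finset.sum_subset this]
    · refine Finset.sum_congr rfl fun i _ => ?_
      rw [hyi, hf, coeff_pow_bell, neg_pow]
      field_simp
    · intro i _ hi
      rw [hyi, hz m i (by simpa using hi), mul_zero]
  have hρ : PowerSeries.mk ρ = PowerSeries.C (ρ 0) * (1 - y) := by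
    have : PowerSeries.C (ρ 0) * (1 - y) = PowerSeries.C (ρ 0) + f := by
      rw [hy, mul_sub, ← mul_assoc, ← map_mul]
      rw [mul_neg, mul_inv_cancel₀ h0]
      simp
    rw [this]
    ext k
    rw [map_add, PowerSeries.coeff_mk, PowerSeries.coeff_C, hf, PowerSeries.coeff_mk]
    split_ifs with h
    · simp [h]
    · simp
  have key : PowerSeries.mk ρ * T = PowerSeries.C (ρ 0) * (1 - y ^ (n + 1)) := by
    rw [hρ, mul_assoc, hT, mul_neg_geom_sum]
  have := congrArg (PowerSeries.coeff n) key
  rw [PowerSeries.coeff_mul, PowerSeries.coeff_C_mul, map_sub, hyi, hz n (n + 1) (by omega)] at this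
  rw [Finset.sum_congr rfl (g := fun p => PowerSeries.coeff p.1 (PowerSeries.mk ρ) * PowerSeries.coeff p.2 T), this]
  · rw [PowerSeries.coeff_one]; split_ifs <;> simp
  · intro p hp
    have := Finset.HasAntidiagonal.mem_antidiagonal.1 hp
    rw [hTc p.2 (by omega), PowerSeries.coeff_mk]

/-- Formal derivative with respect to `ϱ_l`. -/
def pdVal (l : ℕ) : V → PR
  | .r k => if k = l then 1 else 0
  | .u => if l = 0 then -uu ^ 2 else 0
  | _ => 0

def pd (l : ℕ) : Derivation ℝ PR PR := MvPolynomial.mkDerivation ℝ (pdVal l)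

lemma pd_r (l k : ℕ) : pd l (rr k) = if k = l then 1 else 0 := MvPolynomial.mkDerivation_X ℝ _ _
lemma pd_u (l : ℕ) : pd l uu = if l = 0 then -uu ^ 2 else 0 := MvPolynomial.mkDerivation_X ℝ _ _
lemma pd_mul (l : ℕ) (a b : PR) : pd l (a * b) = a * pd l b + b * pd l a := by
  rw [Derivation.leibniz]; simp [smul_eq_mul]

lemma pd_props {c : PR} (hc : c ∈ S0 1) : c ∈ S0 1 ∧ (∀ l, pd l c ∈ S0 1) ∧ (∃ L, ∀ l, L ≤ l → pd l c = 0) ∧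
    (∀ ρ z l, ρ 0 ≠ 0 → HasDerivAt (fun t : ℝ => ev (Function.update ρ l t) z c) (ev ρ z (pd l c)) (ρ l)) ∧
    (∀ ρ z z', ev ρ z c = ev ρ z' c) := by
  refine S0_induction (P := fun c => c ∈ S0 1 ∧ (∀ l, pd l c ∈ S0 1) ∧ (∃ L, ∀ l, L ≤ l → pd l c = 0) ∧
    (∀ ρ z l, ρ 0 ≠ 0 → HasDerivAt (fun t : ℝ => ev (Function.update ρ l t) z c) (ev ρ z (pd l c)) (ρ l)) ∧
    (∀ ρ z z', ev ρ z c = ev ρ z' c)) ?_ ?_ ?_ ?_ ?_ ?_ hc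
  · intro a
    refine ⟨Subalgebra.algebraMap_mem _ _, fun l => by simp [Derivation.map_algebraMap], ⟨0, fun l _ => by simp [Derivation.map_algebraMap]⟩, ?_, ?_⟩
    · intro ρ z l hρ
      simp only [AlgHom.commutes, Derivation.map_algebraMap, map_zero]
      exact hasDerivAt_const _ _
    · intro ρ z z'; simp only [AlgHom.commutes]
  · intro k
    refine ⟨r_mem _ _, ?_, ⟨k + 1, ?_⟩, ?_, ?_⟩
    · intro l; rw [pd_r]; split_ifs
      · exact one_mem _
      · exact zero_mem _
    · intro l hl; rw [pd_r, if_neg (by omega)]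
    · intro ρ z l hρ
      rw [pd_r]
      simp only [ev_r]
      by_cases h : k = l
      · subst h
        simp only [Function.update_self, if_true, map_one]
        exact Complex.ofRealCLM.hasDerivAt
      · simp only [Function.update_of_ne h, if_neg h, map_zero]
        exact hasDerivAt_const _ _
    · intro ρ z z'; simp
  · refine ⟨u_mem _, ?_, ⟨1, ?_⟩, ?_, ?_⟩
    · intro l; rw [pd_u]; split_ifs
      · exact neg_mem (pow_mem (u_mem _) _)
      · exact zero_mem _
    · intro l hl; rw [pd_u, if_neg (by omega)]
    · intro ρ z l hρ
      rw [pd_u]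
      simp only [ev_u]
      have hc : (ρ 0 : ℂ) ≠ 0 := by exact_mod_cast hρ
      by_cases h : l = 0
      · subst h
        simp only [Function.update_self, if_true]
        have h1 : HasDerivAt (fun t : ℝ => (t : ℂ)) 1 (ρ 0) := Complex.ofRealCLM.hasDerivAt
        refine (h1.inv hc).congr_deriv ?_
        simp
        field_simp
      · simp only [Function.update_of_ne (Ne.symm h), if_neg h, map_zero]
        exact hasDerivAt_const _ _
    · intro ρ z z'; simp
  · intro i h1 h2; omega
  · rintro f g ⟨a0, a1, ⟨L, a2⟩, a3, a4⟩ ⟨b0, b1, ⟨L', b2⟩, b3, b4⟩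
    refine ⟨add_mem a0 b0, fun l => ?_, ⟨max L L', fun l hl => ?_⟩, fun ρ z l hρ => ?_, fun ρ z z' => ?_⟩
    · rw [map_add]; exact add_mem (a1 l) (b1 l)
    · rw [map_add, a2 l (le_trans (le_max_left _ _) hl), b2 l (le_trans (le_max_right _ _) hl), add_zero]
    · simp only [map_add]; exact (a3 ρ z l hρ).add (b3 ρ z l hρ)
    · rw [map_add, map_add, a4 ρ z z', b4 ρ z z']
  · rintro f g ⟨a0, a1, ⟨L, a2⟩, a3, a4⟩ ⟨b0, b1, ⟨L', b2⟩, b3, b4⟩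
    refine ⟨mul_mem a0 b0, fun l => ?_, ⟨max L L', fun l hl => ?_⟩, fun ρ z l hρ => ?_, fun ρ z zz => ?_⟩
    · rw [pd_mul]; exact add_mem (mul_mem a0 (b1 l)) (mul_mem b0 (a1 l))
    · rw [pd_mul, a2 l (le_trans (le_max_left _ _) hl), b2 l (le_trans (le_max_right _ _) hl)]; simp
    · rw [pd_mul]
      simp only [map_mul, map_add]
      have := (a3 ρ z l hρ).mul (b3 ρ z l hρ)
      simp only [Function.update_eq_self] at this
      refine this.congr_deriv ?_
      ring
    · rw [map_mul, map_mul, a4 ρ z zz, b4 ρ z zz]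

/-- Functions of the moments given by polynomials in `ϱ_l` and `1/ϱ₀`. -/
def IsPoly (F : (ℕ → ℝ) → ℝ) : Prop :=
  ∃ p ∈ S0 1, ∀ ρ z, ρ 0 ≠ 0 → (F ρ : ℂ) = ev ρ z p

lemma IsPoly.congr {F G : (ℕ → ℝ) → ℝ} (h : IsPoly F) (e : ∀ ρ, ρ 0 ≠ 0 → G ρ = F ρ) : IsPoly G := by
  obtain ⟨p, h1, h2⟩ := h
  exact ⟨p, h1, fun ρ z hρ => by rw [e ρ hρ, h2 ρ z hρ]⟩

lemma IsPoly.const (a : ℝ) : IsPoly (fun _ => a) :=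
  ⟨algebraMap ℝ PR a, Subalgebra.algebraMap_mem _ _, fun ρ z _ => by
    rw [AlgHom.commutes]; rfl⟩

lemma IsPoly.rho (l : ℕ) : IsPoly (fun ρ => ρ l) := ⟨rr l, r_mem _ _, fun ρ z _ => by simp⟩

lemma IsPoly.inv : IsPoly (fun ρ => (ρ 0)⁻¹) := ⟨uu, u_mem _, fun ρ z _ => by simp⟩

lemma IsPoly.add {F G : (ℕ → ℝ) → ℝ} (h : IsPoly F) (h' : IsPoly G) : IsPoly (fun ρ => F ρ + G ρ) := by
  obtain ⟨p, h1, h2⟩ := h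
  obtain ⟨q, h3, h4⟩ := h'
  exact ⟨p + q, add_mem h1 h3, fun ρ z hρ => by rw [map_add, ← h2 ρ z hρ, ← h4 ρ z hρ]; simp⟩

lemma IsPoly.mul {F G : (ℕ → ℝ) → ℝ} (h : IsPoly F) (h' : IsPoly G) : IsPoly (fun ρ => F ρ * G ρ) := by
  obtain ⟨p, h1, h2⟩ := h
  obtain ⟨q, h3, h4⟩ := h'
  exact ⟨p * q, mul_mem h1 h3, fun ρ z hρ => by rw [map_mul, ← h2 ρ z hρ, ← h4 ρ z hρ]; simp⟩

lemma IsPoly.pow {F : (ℕ → ℝ) → ℝ} (h : IsPoly F) (n : ℕ) : IsPoly (fun ρ => F ρ ^ n) := by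
  obtain ⟨p, h1, h2⟩ := h
  exact ⟨p ^ n, pow_mem h1 n, fun ρ z hρ => by rw [map_pow, ← h2 ρ z hρ]; simp⟩

lemma IsPoly.sum {ι : Type*} (s : Finset ι) {F : ι → (ℕ → ℝ) → ℝ} (h : ∀ i ∈ s, IsPoly (F i)) :
    IsPoly (fun ρ => ∑ i ∈ s, F i ρ) := by
  classical
  induction s using Finset.induction_on with
  | empty => simpa using IsPoly.const 0
  | insert i s hi ih =>
    simp only [Finset.sum_insert hi]
    exact (h i (by simp)).add (ih fun j hj => h j (by simp [hj]))

lemma IsPoly.prod {ι : Type*} (s : Finset ι) {F : ι → (ℕ → ℝ) → ℝ} (h : ∀ i ∈ s, IsPoly (F i)) :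
    IsPoly (fun ρ => ∏ i ∈ s, F i ρ) := by
  classical
  induction s using Finset.induction_on with
  | empty => simpa using IsPoly.const 1
  | insert i s hi ih =>
    simp only [Finset.prod_insert hi]
    exact (h i (by simp)).mul (ih fun j hj => h j (by simp [hj]))

lemma IsPoly.ite {F : (ℕ → ℝ) → ℝ} (c : Prop) [Decidable c] (h : c → IsPoly F) :
    IsPoly (fun ρ => if c then F ρ else 0) := by
  by_cases hc : c
  · simpa [hc] using h hc
  · simpa [hc] using IsPoly.const 0

lemma real_deriv {c : ℝ → ℝ} {d : ℂ} {x : ℝ} (h : HasDerivAt (fun t => (c t : ℂ)) d x) :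
    ((deriv c x : ℝ) : ℂ) = d := by
  have h1 : HasDerivAt c d.re x := by
    have := Complex.reCLM.hasFDerivAt.comp_hasDerivAt x h
    simpa [Function.comp_def] using this
  rw [h1.deriv]
  exact (h1.ofReal_comp).unique h

lemma IsPoly.pdR {F : (ℕ → ℝ) → ℝ} (h : IsPoly F) :
    (∀ l, IsPoly (NCQFT.pdR F l)) ∧ ∃ L, ∀ l, L ≤ l → ∀ ρ, ρ 0 ≠ 0 → NCQFT.pdR F l ρ = 0 := by
  obtain ⟨p, h1, h2⟩ := h
  obtain ⟨-, a1, ⟨L, a2⟩, a3, a4⟩ := pd_props h1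
  have key : ∀ l ρ z, ρ 0 ≠ 0 → ((NCQFT.pdR F l ρ : ℝ) : ℂ) = ev ρ z (pd l p) := by
    intro l ρ z hρ
    refine real_deriv ?_
    refine (a3 ρ z l hρ).congr_of_eventuallyEq ?_
    filter_upwards [rho_eventually hρ l] with t ht
    exact h2 _ z ht
  refine ⟨fun l => ⟨pd l p, a1 l, fun ρ z hρ => key l ρ z hρ⟩, L, fun l hl ρ hρ => ?_⟩
  have := key l ρ (fun _ => 0) hρ
  rw [a2 l hl, map_zero] at this
  exact_mod_cast this

lemma isPoly_Sm (m : ℕ) : IsPoly (fun ρ => Sm ρ m) := by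
  unfold Sm bellP
  refine IsPoly.sum _ fun i _ => ((IsPoly.const _).mul (IsPoly.inv.pow _)).mul ?_
  refine IsPoly.sum _ fun j _ => IsPoly.ite _ fun _ => (IsPoly.const _).mul ?_
  refine IsPoly.prod _ fun k _ => IsPoly.pow ?_ _
  exact (((IsPoly.const _).mul (IsPoly.rho _)).mul (IsPoly.const ((((k : ℕ) + 1).factorial : ℝ))⁻¹)).congr
    fun ρ _ => by rw [div_eq_mul_inv]

/-- Finite support. -/
def FS (c : ℕ → (ℕ → ℝ) → ℝ) : Prop := ∃ N, ∀ k, N ≤ k → ∀ ρ, ρ 0 ≠ 0 → c k ρ = 0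

lemma FS_pd {c : ℕ → (ℕ → ℝ) → ℝ} (h1 : ∀ k, IsPoly (c k)) (h2 : FS c) :
    ∃ L, ∀ k l, L ≤ l → ∀ ρ, ρ 0 ≠ 0 → pdR (c k) l ρ = 0 := by
  obtain ⟨N, hN⟩ := h2
  choose L hL using fun k => (h1 k).pdR.2
  refine ⟨(Finset.range N).sup L, fun k l hl ρ hρ => ?_⟩
  by_cases hk : k < N
  · exact hL k l (le_trans (Finset.le_sup (f := L) (by simpa using hk)) hl) ρ hρ
  · unfold pdR
    have : (fun t => c k (Function.update ρ l t)) =ᶠ[nhds (ρ l)] fun _ => 0 := by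
      filter_upwards [rho_eventually hρ l] with t ht
      exact hN k (by omega) _ ht
    rw [this.deriv_eq]; simp

lemma Gtab_eq (lam : ℝ) (G h : ℕ) (h1 : 1 ≤ h) (h2 : h ≤ G) : Gtab lam G h = Gcoef lam h := by
  induction G with
  | zero => omega
  | succ G ih =>
    by_cases e : h = G + 1
    · subst e; rfl
    · have hG : h ≤ G := by omega
      rw [← ih hG]
      rcases G with _ | G
      · omega
      · funext k ρ
        conv_lhs => rw [Gtab]
        beta_reduce
        rw [if_pos hG]

/-- The bracket coefficients with the final table. -/
def eG (lam : ℝ) (g m : ℕ) (ρ : ℕ → ℝ) : ℝ := eBr lam g (Gcoef lam) m ρ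

lemma eBr_congr (lam : ℝ) (g : ℕ) (hg : 2 ≤ g) (p p' : ℕ → ℕ → (ℕ → ℝ) → ℝ)
    (h : ∀ k, 1 ≤ k → k ≤ g - 1 → p k = p' k) (m : ℕ) (ρ : ℕ → ℝ) : eBr lam g p m ρ = eBr lam g p' m ρ := by
  unfold eBr
  rw [h (g - 1) (by omega) (by omega)]
  congr 1
  refine Finset.sum_congr rfl fun k hk => ?_
  have hk' := Finset.mem_Icc.1 hk
  rw [h k hk'.1 hk'.2, h (g - k) (by omega) (by omega)]

lemma Gcoef_step (lam : ℝ) (g : ℕ) (hg : 2 ≤ g) (k : ℕ) (ρ : ℕ → ℝ) : Gcoef lam g k ρ =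
    -(1 / (2 * ρ 0)) * ∑' j : ℕ, eG lam g (k + j) ρ * Sm ρ j / (j.factorial : ℝ) := by
  obtain ⟨G, rfl⟩ : ∃ G, g = G + 2 := ⟨g - 2, by omega⟩
  rw [Gcoef, Gtab]
  beta_reduce
  rw [if_neg (by omega), if_pos rfl]
  congr 2
  funext j
  rw [eG, eBr_congr lam (G + 2) (by omega) (Gtab lam (G + 1)) (Gcoef lam)
    (fun k h1 h2 => Gtab_eq lam (G + 1) k h1 (by omega))]

lemma eG_props (lam : ℝ) (g : ℕ) (hg : 2 ≤ g)
    (h1 : ∀ h, 1 ≤ h → h < g → ∀ k, IsPoly (Gcoef lam h k))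
    (h2 : ∀ h, 1 ≤ h → h < g → FS (Gcoef lam h)) :
    (∀ m, IsPoly (eG lam g m)) ∧ FS (eG lam g) := by
  obtain ⟨L, hL⟩ := FS_pd (h1 (g - 1) (by omega) (by omega)) (h2 (g - 1) (by omega) (by omega))
  have hpd := fun k => (h1 (g - 1) (by omega) (by omega) k).pdR.1
  constructor
  · intro m
    unfold eG eBr
    refine IsPoly.add ?_ ((IsPoly.const _).mul (IsPoly.add (IsPoly.add ?_ ?_) ?_))
    · refine IsPoly.sum _ fun h hh => IsPoly.sum _ fun i _ => IsPoly.sum _ fun j _ => IsPoly.ite _ fun _ => ?_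
      have hk' := Finset.mem_Icc.1 hh
      exact (h1 h hk'.1 (by omega) i).mul (h1 (g - h) (by omega) (by omega) j)
    · refine IsPoly.ite _ fun _ => ?_
      have : IsPoly (fun ρ => (-1) * (ρ 0)⁻¹ * ∑ l ∈ Finset.range L, ((3 + 2 * (l : ℝ)) * ρ (l + 1)
          * pdR (Gcoef lam (g - 1) (m - 2)) l ρ)) :=
        ((IsPoly.const _).mul IsPoly.inv).mul (IsPoly.sum _ fun l _ =>
          ((IsPoly.const _).mul (IsPoly.rho _)).mul (hpd _ _))
      refine this.congr fun ρ hρ => ?_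
      rw [tsum_eq_sum (s := Finset.range L)]
      · ring
      · intro l hl
        rw [hL _ l (by simpa using hl) ρ hρ, mul_zero]
    · exact IsPoly.sum _ fun k _ => IsPoly.sum _ fun l _ => IsPoly.ite _ fun _ =>
        (IsPoly.const _).mul (hpd _ _)
    · refine IsPoly.ite _ fun _ => ?_
      exact (((IsPoly.const (-((2 * (m - 3) + 3 : ℕ) : ℝ))).mul
        (h1 (g - 1) (by omega) (by omega) (m - 3))).mul IsPoly.inv).congr fun ρ _ => by
          rw [div_eq_mul_inv]; ring
  · have h2' : ∃ N, ∀ h, 1 ≤ h → h < g → ∀ k, N ≤ k → ∀ ρ, ρ 0 ≠ 0 → Gcoef lam h k ρ = 0 := by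
      have : ∀ h, ∃ N, 1 ≤ h → h < g → ∀ k, N ≤ k → ∀ ρ, ρ 0 ≠ 0 → Gcoef lam h k ρ = 0 := by
        intro h
        by_cases hh : 1 ≤ h ∧ h < g
        · obtain ⟨N, hN⟩ := h2 h hh.1 hh.2
          exact ⟨N, fun _ _ => hN⟩
        · exact ⟨0, fun a b => absurd ⟨a, b⟩ hh⟩
      choose N hN using this
      refine ⟨(Finset.range g).sup N, fun h a b k hk => hN h a b k (le_trans (Finset.le_sup (f := N) (by simpa using b)) hk)⟩
    obtain ⟨N, hN⟩ := h2'
    have hpd0 : ∀ k l, N ≤ k → ∀ ρ, ρ 0 ≠ 0 → pdR (Gcoef lam (g - 1) k) l ρ = 0 := by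
      intro k l hk ρ hρ
      unfold pdR
      have : (fun t => Gcoef lam (g - 1) k (Function.update ρ l t)) =ᶠ[nhds (ρ l)] fun _ => 0 := by
        filter_upwards [rho_eventually hρ l] with t ht
        exact hN (g - 1) (by omega) (by omega) k hk _ ht
      rw [this.deriv_eq]; simp
    refine ⟨2 * N + L + 5, fun m hm ρ hρ => ?_⟩
    unfold eG eBr
    have e1 : ∑ h ∈ Finset.Icc 1 (g - 1), ∑ i ∈ Finset.range (m + 1), ∑ j ∈ Finset.range (m + 1),
      (if i + j + 2 = m then Gcoef lam h i ρ * Gcoef lam (g - h) j ρ else 0) = 0 := by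
      refine Finset.sum_eq_zero fun h hh => Finset.sum_eq_zero fun i _ => Finset.sum_eq_zero fun j _ => ?_
      have hk' := Finset.mem_Icc.1 hh
      split_ifs with e
      · by_cases hi : N ≤ i
        · rw [hN h hk'.1 (by omega) i hi ρ hρ, zero_mul]
        · rw [hN (g - h) (by omega) (by omega) j (by omega) ρ hρ, mul_zero]
      · rfl
    have e2 : ∑' l : ℕ, (3 + 2 * (l : ℝ)) * ρ (l + 1) * pdR (Gcoef lam (g - 1) (m - 2)) l ρ = 0 := by
      rw [← tsum_zero (α := ℝ) (β := ℕ)]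
      congr 1
      funext l
      rw [hpd0 _ l (by omega) ρ hρ, mul_zero]
    have e3 : ∑ k ∈ Finset.range (m + 1), ∑ l ∈ Finset.range (m + 1),
        (if k + l + 3 = m then (3 + 2 * (l : ℝ)) * pdR (Gcoef lam (g - 1) k) l ρ else 0) = 0 := by
      refine Finset.sum_eq_zero fun k _ => Finset.sum_eq_zero fun l _ => ?_
      split_ifs with e
      · by_cases hi : N ≤ k
        · rw [hpd0 k l hi ρ hρ, mul_zero]
        · rw [hL k l (by omega) ρ hρ, mul_zero]
      · rfl
    rw [e1, e2, e3, hN (g - 1) (by omega) (by omega) (m - 3) (by omega) ρ hρ]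
    simp

lemma Gcoef_props (lam : ℝ) (g : ℕ) (hg : 1 ≤ g) :
    (∀ k, IsPoly (Gcoef lam g k)) ∧ FS (Gcoef lam g) := by
  induction g using Nat.strong_induction_on with
  | _ g ih =>
    rcases Nat.lt_or_ge 1 g with hg2 | hg2
    · obtain ⟨p1, M, p2⟩ := eG_props lam g hg2 (fun h a b => (ih h b a).1) (fun h a b => (ih h b a).2)
      have hs : ∀ k ρ, ρ 0 ≠ 0 → Gcoef lam g k ρ = -(1 / (2 * ρ 0)) *
          ∑ j ∈ Finset.range M, eG lam g (k + j) ρ * Sm ρ j / (j.factorial : ℝ) := by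
        intro k ρ hρ
        rw [Gcoef_step lam g hg2, tsum_eq_sum (s := Finset.range M)]
        intro j hj
        rw [p2 (k + j) (by have : M ≤ j := by simpa using hj
                           omega) ρ hρ]
        simp
      constructor
      · intro k
        have : IsPoly (fun ρ => (-1 / 2) * (ρ 0)⁻¹ *
          ∑ j ∈ Finset.range M, eG lam g (k + j) ρ * Sm ρ j * ((j.factorial : ℝ))⁻¹) :=
          ((IsPoly.const _).mul IsPoly.inv).mul (IsPoly.sum _ fun j _ => ((p1 _).mul (isPoly_Sm j)).mul (IsPoly.const _))
        refine this.congr fun ρ hρ => ?_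
        rw [hs k ρ hρ]
        simp only [div_eq_mul_inv, mul_inv]
        ring
      · refine ⟨M, fun k hk ρ hρ => ?_⟩
        rw [hs k ρ hρ, Finset.sum_eq_zero, mul_zero]
        intro j _
        rw [p2 (k + j) (by omega) ρ hρ]; simp
    · obtain rfl : g = 1 := by omega
      constructor
      · intro k
        unfold Gcoef Gtab
        simp only [if_true]
        split_ifs
        · exact (((IsPoly.const (2 * lam ^ 4)).mul (IsPoly.rho 1)).mul (IsPoly.inv.pow 2)).congr fun ρ _ => by
            rw [div_eq_mul_inv, inv_pow]
        · exact ((IsPoly.const (-(2 * lam ^ 4))).mul IsPoly.inv).congr fun ρ _ => by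
            rw [div_eq_mul_inv]
        · exact IsPoly.const 0
      · refine ⟨2, fun k hk ρ _ => ?_⟩
        unfold Gcoef Gtab
        simp only [if_true]
        rw [if_neg (by omega), if_neg (by omega)]

/-- The recursion inverts the operator `K̂`. -/
lemma K_inv (lam : ℝ) (g : ℕ) (hg : 2 ≤ g) : ∃ M, (∀ m, M ≤ m → ∀ ρ, ρ 0 ≠ 0 → eG lam g m ρ = 0 ∧ Gcoef lam g m ρ = 0) ∧
    ∀ N, M ≤ N → ∀ m ρ, ρ 0 ≠ 0 → ∑ j ∈ Finset.range N, ρ j * Gcoef lam g (m + j) ρ = -(1 / 2) * eG lam g m ρ := by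
  obtain ⟨p1, M0, p2⟩ := eG_props lam g hg (fun h a b => (Gcoef_props lam h a).1) (fun h a b => (Gcoef_props lam h a).2)
  obtain ⟨-, M1, q2⟩ := Gcoef_props lam g (by omega)
  refine ⟨max M0 M1 + 1, fun m hm ρ hρ => ⟨p2 m (by omega) ρ hρ, q2 m (by omega) ρ hρ⟩, ?_⟩
  intro N hN m ρ hρ
  have hs : ∀ k n, N ≤ k + n → Gcoef lam g k ρ = -(1 / (2 * ρ 0)) *
      ∑ j ∈ Finset.range n, eG lam g (k + j) ρ * (Sm ρ j / (j.factorial : ℝ)) := by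
    intro k n hn
    rw [Gcoef_step lam g hg, tsum_eq_sum (s := Finset.range n)]
    · simp only [mul_div_assoc]
    · intro j hj
      have : n ≤ j := by simpa using hj
      rw [p2 (k + j) (by omega) ρ hρ]
      simp
  have h1 : ∀ j ∈ Finset.range N, ρ j * Gcoef lam g (m + j) ρ = -(1 / (2 * ρ 0)) *
      ∑ i ∈ Finset.range (N - j), ρ j * (Sm ρ i / (i.factorial : ℝ)) * eG lam g (m + (j + i)) ρ := by
    intro j hj
    have : j < N := by simpa using hj
    rw [hs (m + j) (N - j) (by omega), Finset.mul_sum, Finset.mul_sum, Finset.mul_sum]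
    refine Finset.sum_congr rfl fun i _ => ?_
    rw [add_assoc]; ring
  rw [Finset.sum_congr rfl h1, ← Finset.mul_sum,
    ← Finset.sum_range_diag_flip N (fun j i => ρ j * (Sm ρ i / (i.factorial : ℝ)) * eG lam g (m + (j + i)) ρ)]
  have h2 : ∀ n ∈ Finset.range N, ∑ k ∈ Finset.range (n + 1),
      ρ k * (Sm ρ (n - k) / ((n - k).factorial : ℝ)) * eG lam g (m + (k + (n - k))) ρ
      = if n = 0 then ρ 0 * eG lam g m ρ else 0 := by
    intro n _
    have := Sm_conv hρ n
    rw [Finset.Nat.sum_antidiagonal_eq_sum_range_succ (fun a b => ρ a * (Sm ρ b / (b.factorial : ℝ)))] at this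
    have e : ∀ k ∈ Finset.range (n + 1), ρ k * (Sm ρ (n - k) / ((n - k).factorial : ℝ)) * eG lam g (m + (k + (n - k))) ρ
        = ρ k * (Sm ρ (n - k) / ((n - k).factorial : ℝ)) * eG lam g (m + n) ρ := by
      intro k hk
      have : k < n + 1 := by simpa using hk
      rw [show k + (n - k) = n by omega]
    rw [Finset.sum_congr rfl e, ← Finset.sum_mul, this]
    split_ifs with h
    · simp [h]
    · simp
  rw [Finset.sum_congr rfl h2, Finset.sum_ite_eq', if_pos (by simp; omega)]
  field_simp

/-! ### Reindexing lemmas -/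

lemma reindex2 (F : ℕ → ℕ → ℂ) (y : ℂ) (d M : ℕ) (hF : ∀ i j, M ≤ i + j + d → F i j = 0) :
    ∑ m ∈ Finset.range M, (∑ i ∈ Finset.range (m + 1), ∑ j ∈ Finset.range (m + 1),
      if i + j + d = m then F i j else 0) * y ^ m
    = ∑ i ∈ Finset.range M, ∑ j ∈ Finset.range M, F i j * y ^ (i + j + d) := by
  have h1 : ∀ m ∈ Finset.range M, (∑ i ∈ Finset.range (m + 1), ∑ j ∈ Finset.range (m + 1),
      if i + j + d = m then F i j else 0) * y ^ m =
      ∑ i ∈ Finset.range M, ∑ j ∈ Finset.range M, if i + j + d = m then F i j * y ^ (i + j + d) else 0 := by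
    intro m hm
    have hm' : m + 1 ≤ M := by simpa using hm
    have h2 : ∀ i, ∑ j ∈ Finset.range (m + 1), (if i + j + d = m then F i j else 0)
        = ∑ j ∈ Finset.range M, (if i + j + d = m then F i j else 0) := by
      intro i
      refine Finset.sum_subset (by simpa using hm') fun j _ hj => ?_
      rw [if_neg]
      simp at hj
      omega
    rw [Finset.sum_congr rfl fun i _ => h2 i,
      Finset.sum_subset (s₂ := Finset.range M) (by simpa using hm'), Finset.sum_mul]
    · refine Finset.sum_congr rfl fun i _ => ?_
      rw [Finset.sum_mul]
      refine Finset.sum_congr rfl fun j _ => ?_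
      split_ifs with e
      · rw [e]
      · simp
    · intro i _ hi
      refine Finset.sum_eq_zero fun j _ => ?_
      rw [if_neg]
      simp at hi
      omega
  rw [Finset.sum_congr rfl h1, Finset.sum_comm]
  refine Finset.sum_congr rfl fun i _ => ?_
  rw [Finset.sum_comm]
  refine Finset.sum_congr rfl fun j _ => ?_
  rw [Finset.sum_ite_eq]
  split_ifs with h
  · rfl
  · rw [hF i j (by simpa using h), zero_mul]

lemma reindex1 (a : ℕ → ℂ) (y : ℂ) (d M : ℕ) (hF : ∀ k, M ≤ k + d → a k = 0) :
    ∑ m ∈ Finset.range M, (if d ≤ m then a (m - d) else 0) * y ^ m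
    = ∑ k ∈ Finset.range M, a k * y ^ (k + d) := by
  have h1 : ∀ m ∈ Finset.range M, (if d ≤ m then a (m - d) else 0) * y ^ m =
      ∑ k ∈ Finset.range M, if m = k + d then a k * y ^ (k + d) else 0 := by
    intro m hm
    have hm' : m < M := by simpa using hm
    split_ifs with h
    · rw [Finset.sum_eq_single (m - d)]
      · rw [if_pos (by omega), show m - d + d = m by omega]
      · intro k _ hk
        rw [if_neg (by omega)]
      · intro hk
        simp at hk
        omega
    · rw [zero_mul, Finset.sum_eq_zero]
      intro k _
      rw [if_neg (by omega)]
  rw [Finset.sum_congr rfl h1, Finset.sum_comm]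
  refine Finset.sum_congr rfl fun k _ => ?_
  rw [Finset.sum_ite_eq']
  split_ifs with h
  · rfl
  · rw [hF k (by simpa using h), zero_mul]

/-! ### The one-boundary functions -/

/-- `b` represents the one-boundary function of genus `g`. -/
def IsG (lam : ℝ) (g : ℕ) (b : PR) : Prop :=
  ∃ (c : ℕ → PR) (N : ℕ), (∀ k, c k ∈ S0 1) ∧
    (∀ k ρ z, ρ 0 ≠ 0 → (Gcoef lam g k ρ : ℂ) = ev ρ z (c k)) ∧
    (∀ k, N ≤ k → ∀ ρ, ρ 0 ≠ 0 → Gcoef lam g k ρ = 0) ∧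
    b = ∑ k ∈ Finset.range N, c k * xx 0 ^ (2 * k + 3)

lemma exists_base (lam : ℝ) : ∃ bs, Base bs ∧ ∀ g, g ≠ 0 → IsG lam g (bs g) := by
  have : ∀ g, ∃ b, (g = 0 → b = oo) ∧ (g ≠ 0 → IsG lam g b) := by
    intro g
    by_cases hg : g = 0
    · exact ⟨oo, fun _ => rfl, fun h => absurd hg h⟩
    · obtain ⟨h1, N, h2⟩ := Gcoef_props lam g (by omega)
      choose c hc hc' using h1
      exact ⟨_, fun h => absurd h hg, fun _ => ⟨c, N, hc, hc', h2, rfl⟩⟩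
  choose bs h1 h2 using this
  refine ⟨bs, ⟨h1 0 rfl, fun g hg => ?_⟩, h2⟩
  obtain ⟨c, N, hc, -, -, hb⟩ := h2 g hg
  rw [hb]
  exact Submodule.sum_mem _ fun k _ => mem_Odd0 (hc k) k

lemma IsG.ev_eq {lam : ℝ} {g : ℕ} {b : PR} (h : IsG lam g b) : ∃ N, ∀ M, N ≤ M → ∀ ρ z, ρ 0 ≠ 0 →
    ev ρ z b = ∑ k ∈ Finset.range M, (Gcoef lam g k ρ : ℂ) * (z 0)⁻¹ ^ (2 * k + 3) := by
  obtain ⟨c, N, hc, h1, h2, rfl⟩ := h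
  refine ⟨N, fun M hM ρ z hρ => ?_⟩
  rw [map_sum, ← Finset.sum_subset (s₁ := Finset.range N) (s₂ := Finset.range M) (by simpa using hM)]
  · refine Finset.sum_congr rfl fun k _ => ?_
    rw [map_mul, map_pow, ev_x, ← h1 k ρ z hρ]
  · intro k _ hk
    rw [h2 k (by simpa using hk) ρ hρ]; simp

lemma IsG.Gfun_eq {lam : ℝ} {g : ℕ} {b : PR} (h : IsG lam g b) (ρ : ℕ → ℝ) (z : ℕ → ℂ) (hρ : ρ 0 ≠ 0) :
    Gfun lam g ρ (z 0) = ev ρ z b := by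
  obtain ⟨c, N, hc, h1, h2, rfl⟩ := h
  rw [Gfun, tsum_eq_sum (s := Finset.range N), map_sum]
  · refine Finset.sum_congr rfl fun k _ => ?_
    rw [map_mul, map_pow, ev_x, ← h1 k ρ z hρ, div_eq_mul_inv, inv_pow]
  · intro k hk
    rw [h2 k (by simpa using hk) ρ hρ]; simp

lemma ev_kap (ρ : ℕ → ℝ) (z : ℕ → ℂ) (k : ℕ) : ev ρ z (kap k) =
    ∑ j ∈ Finset.range (k + 1), (ρ j : ℂ) * ((z 0)⁻¹ ^ 2) ^ (k - j + 1) := by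
  induction k with
  | zero => simp [kap]
  | succ k ih =>
    rw [kap, map_add, map_mul, ih, Finset.sum_range_succ _ (k + 1), Finset.mul_sum]
    congr 1
    · refine Finset.sum_congr rfl fun j hj => ?_
      have : j < k + 1 := by simpa using hj
      rw [show k + 1 - j + 1 = (k - j + 1) + 1 by omega, pow_succ]
      simp; ring
    · simp

lemma IsG.ev_KK {lam : ℝ} {g : ℕ} {b : PR} (h : IsG lam g b) : ∃ N, ∀ M, N ≤ M → ∀ ρ z, ρ 0 ≠ 0 →
    ev ρ z (KK b) = ∑ m ∈ Finset.range M, (∑ j ∈ Finset.range M, (ρ j : ℂ) * (Gcoef lam g (m + j) ρ : ℂ)) *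
      ((z 0)⁻¹ ^ 2) ^ (m + 1) := by
  obtain ⟨c, N, hc, h1, h2, rfl⟩ := h
  refine ⟨N, fun M hM ρ z hρ => ?_⟩
  have e1 : ev ρ z (KK (∑ k ∈ Finset.range N, c k * xx 0 ^ (2 * k + 3))) =
      ∑ k ∈ Finset.range M, ∑ j ∈ Finset.range (k + 1),
        (ρ j : ℂ) * (Gcoef lam g (k - j + j) ρ : ℂ) * ((z 0)⁻¹ ^ 2) ^ (k - j + 1) := by
    rw [map_sum, map_sum, ← Finset.sum_subset (s₁ := Finset.range N) (s₂ := Finset.range M) (by simpa using hM)]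
    · refine Finset.sum_congr rfl fun k _ => ?_
      rw [KK_mul (hc k), map_mul, ev_kap, ← h1 k ρ z hρ, Finset.mul_sum]
      refine Finset.sum_congr rfl fun j hj => ?_
      have : j < k + 1 := by simpa using hj
      rw [show k - j + j = k by omega]; ring
    · intro k _ hk
      refine Finset.sum_eq_zero fun j hj => ?_
      have : j < k + 1 := by simpa using hj
      rw [show k - j + j = k by omega, h2 k (by simpa using hk) ρ hρ]; simp
  rw [e1, Finset.sum_range_diag_flip M
    (fun j m => (ρ j : ℂ) * (Gcoef lam g (m + j) ρ : ℂ) * ((z 0)⁻¹ ^ 2) ^ (m + 1))]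
  have e2 : ∀ j ∈ Finset.range M, ∑ m ∈ Finset.range (M - j), (ρ j : ℂ) * (Gcoef lam g (m + j) ρ : ℂ) * ((z 0)⁻¹ ^ 2) ^ (m + 1)
    = ∑ m ∈ Finset.range M, (ρ j : ℂ) * (Gcoef lam g (m + j) ρ : ℂ) * ((z 0)⁻¹ ^ 2) ^ (m + 1) := by
    intro j hj
    refine Finset.sum_subset (by simp) fun m _ hm => ?_
    have : M - j ≤ m := by simpa using hm
    rw [h2 (m + j) (by omega) ρ hρ]; simp
  rw [Finset.sum_congr rfl e2, Finset.sum_comm]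
  refine Finset.sum_congr rfl fun m _ => ?_
  rw [Finset.sum_mul]

lemma S0_one_le : S0 1 ≤ R0 0 := by
  apply MvPolynomial.supported_mono
  rintro (l | _ | k | k | _) hv
  · trivial
  · trivial
  · have := hv.1
    have := hv.2
    omega
  · exact hv.elim
  · exact hv

lemma AA_coef {ρ : ℕ → ℝ} {z : ℕ → ℂ} {j : ℕ} (hρ : ρ 0 ≠ 0) (hj : z j ≠ 0) {c : PR} (hc : c ∈ S0 1)
    {F : (ℕ → ℝ) → ℝ} (hF : ∀ ρ z, ρ 0 ≠ 0 → (F ρ : ℂ) = ev ρ z c) (L : ℕ)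
    (hL : ∀ l, L ≤ l → pdR F l ρ = 0) :
    ev ρ z (AA j c) = ∑ l ∈ Finset.range L, cR ρ (z j) l * (pdR F l ρ : ℂ) := by
  have hz : GoodZ 0 z := by intro i hi; omega
  obtain ⟨dl, de, h1, -, L0, h3, h4⟩ := chain hρ hz (S0_one_le hc)
  have hd : ∀ l, (pdR F l ρ : ℂ) = dl l := by
    intro l
    refine real_deriv ?_
    refine (h1 l).congr_of_eventuallyEq ?_
    filter_upwards [rho_eventually hρ l] with t ht
    exact hF _ z ht
  rw [← h4 j hj (max L L0) (le_max_right _ _)]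
  simp only [Finset.range_zero, Finset.sum_empty, add_zero]
  rw [Finset.sum_subset (s₁ := Finset.range L) (s₂ := Finset.range (max L L0)) (by simp)]
  · exact Finset.sum_congr rfl fun l _ => by rw [hd]
  · intro l _ hl
    rw [hL l (by simpa using hl)]; simp

lemma IsG.pd_zero {lam : ℝ} {g : ℕ} {b : PR} (h : IsG lam g b) : ∃ N, ∀ k l ρ, ρ 0 ≠ 0 → (N ≤ k ∨ N ≤ l) →
    pdR (Gcoef lam g k) l ρ = 0 := by
  obtain ⟨c, N, hc, h1, h2, rfl⟩ := h
  obtain ⟨L, hL⟩ := FS_pd (fun k => ⟨c k, hc k, h1 k⟩) ⟨N, h2⟩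
  refine ⟨max N L, fun k l ρ hρ hkl => ?_⟩
  rcases hkl with hk | hl
  · unfold pdR
    have : (fun t => Gcoef lam g k (Function.update ρ l t)) =ᶠ[nhds (ρ l)] fun _ => 0 := by
      filter_upwards [rho_eventually hρ l] with t ht
      exact h2 k (le_trans (le_max_left _ _) hk) _ ht
    rw [this.deriv_eq]; simp
  · exact hL k l (le_trans (le_max_right _ _) hl) ρ hρ

lemma IsG.ev_AA {lam : ℝ} {g : ℕ} {b : PR} (h : IsG lam g b) : ∃ N, ∀ M, N ≤ M → ∀ ρ z, ρ 0 ≠ 0 → z 0 ≠ 0 →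
    ev ρ z (AA 0 b) = ∑ k ∈ Finset.range M,
      ((∑ l ∈ Finset.range M, cR ρ (z 0) l * (pdR (Gcoef lam g k) l ρ : ℂ)) * (z 0)⁻¹ ^ (2 * k + 3)
      - (2 * (k : ℂ) + 3) * (ρ 0 : ℂ)⁻¹ * (Gcoef lam g k ρ : ℂ) * (z 0)⁻¹ ^ (2 * k + 8)) := by
  obtain ⟨L, hL⟩ := h.pd_zero
  obtain ⟨c, N, hc, h1, h2, rfl⟩ := h
  refine ⟨max N L, fun M hM ρ z hρ hz => ?_⟩
  have hM1 : N ≤ M := le_trans (le_max_left _ _) hM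
  have hM2 : L ≤ M := le_trans (le_max_right _ _) hM
  have e : ∀ k, ev ρ z (AA 0 (c k * xx 0 ^ (2 * k + 3))) =
      ((∑ l ∈ Finset.range M, cR ρ (z 0) l * (pdR (Gcoef lam g k) l ρ : ℂ)) * (z 0)⁻¹ ^ (2 * k + 3)
      - (2 * (k : ℂ) + 3) * (ρ 0 : ℂ)⁻¹ * (Gcoef lam g k ρ : ℂ) * (z 0)⁻¹ ^ (2 * k + 8)) := by
    intro k
    rw [AA_mono]
    simp only [map_add, map_mul, map_pow, map_neg, ev_x, ev_u, map_natCast, map_ofNat (ev ρ z)]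
    rw [AA_coef hρ hz (hc k) (h1 k) M (fun l hl => hL k l ρ hρ (Or.inr (le_trans hM2 hl))), ← h1 k ρ z hρ]
    ring
  rw [map_sum, map_sum, ← Finset.sum_subset (s₁ := Finset.range N) (s₂ := Finset.range M) (by simpa using hM1)]
  · exact Finset.sum_congr rfl fun k _ => e k
  · intro k _ hk
    have hk' : N ≤ k := by simpa using hk
    rw [← e k]
    have hc0 : ∀ ρ' z', ρ' 0 ≠ 0 → GoodZ 1 z' → ev ρ' z' (c k * xx 0 ^ (2 * k + 3)) = 0 := by
      intro ρ' z' hρ' _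
      rw [map_mul, ← h1 k ρ' z' hρ', h2 k hk' ρ' hρ']; simp
    refine Nl_AA (n := 1) (by omega) (Odd0_le_R0 (by omega) (mem_Odd0 (hc k) k)) hc0 ρ z hρ ?_
    intro i hi
    obtain rfl : i = 0 := by omega
    refine ⟨hz, ?_⟩
    rw [← two_mul]; exact mul_ne_zero two_ne_zero hz

lemma eG_expand (lam : ℝ) (g : ℕ) (hg : 2 ≤ g) {bs : ℕ → PR} (hG : ∀ g, g ≠ 0 → IsG lam g (bs g)) :
    ∃ N, ∀ M, N ≤ M → ∀ ρ (y : ℂ), ρ 0 ≠ 0 →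
    ∑ m ∈ Finset.range M, (eG lam g m ρ : ℂ) * y ^ m =
      ∑ h ∈ Finset.Icc 1 (g - 1), ∑ i ∈ Finset.range M, ∑ j ∈ Finset.range M,
        ((Gcoef lam h i ρ : ℂ) * (Gcoef lam (g - h) j ρ : ℂ)) * y ^ (i + j + 2)
      + (2 * (lam : ℂ)) ^ 4 * (
        ∑ k ∈ Finset.range M, (-(1 / (ρ 0 : ℂ)) * ∑ l ∈ Finset.range M, (3 + 2 * (l : ℂ)) * (ρ (l + 1) : ℂ)
          * (pdR (Gcoef lam (g - 1) k) l ρ : ℂ)) * y ^ (k + 2)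
        + ∑ k ∈ Finset.range M, ∑ l ∈ Finset.range M, ((3 + 2 * (l : ℂ)) * (pdR (Gcoef lam (g - 1) k) l ρ : ℂ))
          * y ^ (k + l + 3)
        + ∑ k ∈ Finset.range M, (-((2 * (k : ℂ) + 3) * (Gcoef lam (g - 1) k ρ : ℂ)) / (ρ 0 : ℂ)) * y ^ (k + 3)) := by
  obtain ⟨L, hL⟩ := (hG (g - 1) (by omega)).pd_zero
  have h2' : ∃ N, ∀ h, 1 ≤ h → h < g → ∀ k, N ≤ k → ∀ ρ, ρ 0 ≠ 0 → Gcoef lam h k ρ = 0 := by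
    have : ∀ h, ∃ N, 1 ≤ h → h < g → ∀ k, N ≤ k → ∀ ρ, ρ 0 ≠ 0 → Gcoef lam h k ρ = 0 := by
      intro h
      by_cases hh : 1 ≤ h ∧ h < g
      · obtain ⟨-, N, hN⟩ := Gcoef_props lam h hh.1
        exact ⟨N, fun _ _ => hN⟩
      · exact ⟨0, fun a b => absurd ⟨a, b⟩ hh⟩
    choose N hN using this
    refine ⟨(Finset.range g).sup N, fun h a b k hk => hN h a b k (le_trans (Finset.le_sup (f := N) (by simpa using b)) hk)⟩
  obtain ⟨N, hN⟩ := h2'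
  refine ⟨2 * N + 2 * L + 5, fun M hM ρ y hρ => ?_⟩
  have t : ∀ k, ∑' l : ℕ, (3 + 2 * (l : ℝ)) * ρ (l + 1) * pdR (Gcoef lam (g - 1) k) l ρ =
     ∑ l ∈ Finset.range M, (3 + 2 * (l : ℝ)) * ρ (l + 1) * pdR (Gcoef lam (g - 1) k) l ρ := by
    intro k
    refine tsum_eq_sum fun l hl => ?_
    have : M ≤ l := by simpa using hl
    rw [hL k l ρ hρ (Or.inr (by omega)), mul_zero]
  have e : ∀ m, (eG lam g m ρ : ℂ) =
      (∑ h ∈ Finset.Icc 1 (g - 1), ∑ i ∈ Finset.range (m + 1), ∑ j ∈ Finset.range (m + 1),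
        if i + j + 2 = m then (Gcoef lam h i ρ : ℂ) * (Gcoef lam (g - h) j ρ : ℂ) else 0)
      + (2 * (lam : ℂ)) ^ 4 * (
      (if 2 ≤ m then (fun k => (-(1 / (ρ 0 : ℂ)) * ∑ l ∈ Finset.range M, (3 + 2 * (l : ℂ)) * (ρ (l + 1) : ℂ)
          * (pdR (Gcoef lam (g - 1) k) l ρ : ℂ))) (m - 2) else 0)
      + (∑ k ∈ Finset.range (m + 1), ∑ l ∈ Finset.range (m + 1),
        if k + l + 3 = m then (3 + 2 * (l : ℂ)) * (pdR (Gcoef lam (g - 1) k) l ρ : ℂ) else 0)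
      + (if 3 ≤ m then (fun k : ℕ => (-((2 * (k : ℂ) + 3) * (Gcoef lam (g - 1) k ρ : ℂ)) / (ρ 0 : ℂ))) (m - 3) else 0)) := by
    intro m
    unfold eG eBr
    rw [t]
    push_cast [apply_ite (fun x : ℝ => (x : ℂ))]
    rfl
  have comb : ∀ (A B C D : ℕ → ℂ) (k : ℂ), ∑ m ∈ Finset.range M, (A m + k * (B m + C m + D m)) * y ^ m =
      ∑ m ∈ Finset.range M, A m * y ^ m + k * (∑ m ∈ Finset.range M, B m * y ^ m
        + ∑ m ∈ Finset.range M, C m * y ^ m + ∑ m ∈ Finset.range M, D m * y ^ m) := by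
    intro A B C D k
    simp only [Finset.mul_sum, ← Finset.sum_add_distrib]
    exact Finset.sum_congr rfl fun m _ => by ring
  rw [Finset.sum_congr rfl fun m _ => by rw [e m], comb, reindex1 (fun k => (-(1 / (ρ 0 : ℂ)) * ∑ l ∈ Finset.range M, (3 + 2 * (l : ℂ)) * (ρ (l + 1) : ℂ)
          * (pdR (Gcoef lam (g - 1) k) l ρ : ℂ))) y 2 M,
    reindex1 (fun k : ℕ => (-((2 * (k : ℂ) + 3) * (Gcoef lam (g - 1) k ρ : ℂ)) / (ρ 0 : ℂ))) y 3 M,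
    reindex2 (fun k l => (3 + 2 * (l : ℂ)) * (pdR (Gcoef lam (g - 1) k) l ρ : ℂ))]
  · congr 1
    simp only [Finset.sum_mul (Finset.Icc 1 (g - 1))]
    rw [Finset.sum_comm]
    refine Finset.sum_congr rfl fun h hh => ?_
    have hh' := Finset.mem_Icc.1 hh
    rw [reindex2 (fun i j => (Gcoef lam h i ρ : ℂ) * (Gcoef lam (g - h) j ρ : ℂ))]
    intro i j hij
    by_cases hi : N ≤ i
    · rw [hN h hh'.1 (by omega) i hi ρ hρ]; simp
    · rw [hN (g - h) (by omega) (by omega) j (by omega) ρ hρ]; simp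
  · intro i j hij
    rw [hL i j ρ hρ (by omega)]; simp
  · intro k hk
    rw [hN (g - 1) (by omega) (by omega) k (by omega) ρ hρ]; simp
  · intro k hk
    simp only [hL k _ ρ hρ (Or.inl (show L ≤ k by omega))]; simp

/-- `ϰ = (2λ)⁴/2`. -/
def kapp (lam : ℝ) : ℝ := (2 * lam) ^ 4 / 2

lemma EE_empty {bs : ℕ → PR} (lam : ℝ) {g : ℕ} (hg : g ≠ 0) (ρ : ℕ → ℝ) (z : ℕ → ℂ) :
    ev ρ z (EE bs (kapp lam) g ∅) = ev ρ z (KK (bs g)) + (kapp lam : ℂ) * ev ρ z (AA 0 (bs (g - 1)))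
      + (1 / 2) * ∑ h ∈ Finset.Icc 1 (g - 1), ev ρ z (bs h) * ev ρ z (bs (g - h)) := by
  unfold EE
  rw [if_neg hg]
  simp only [map_add, map_smul, map_sum, W_empty, Finset.powerset_empty, Finset.sum_singleton,
    Finset.sum_empty, map_zero, add_zero, Finset.empty_sdiff, map_mul, Complex.real_smul]
  congr 1
  push_cast
  congr 1
  symm
  rw [← Finset.sum_subset (s₁ := Finset.Icc 1 (g - 1)) (s₂ := Finset.range (g + 1))]
  · refine Finset.sum_congr rfl fun h hh => ?_
    have hh' := Finset.mem_Icc.1 hh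
    rw [Wo, if_neg (by omega), Wo, if_neg (by omega), W_empty, W_empty]
  · intro h hh
    have hh' := Finset.mem_Icc.1 hh
    simp; omega
  · intro h h1 h2
    have h1' : h < g + 1 := by simpa using h1
    have : h = 0 ∨ h = g := by
      simp at h2
      omega
    rcases this with rfl | rfl
    · simp [Wo]
    · simp [Wo]

lemma one_boundary (lam : ℝ) {bs : ℕ → PR} (hb : Base bs) (hG : ∀ g, g ≠ 0 → IsG lam g (bs g)) {g n : ℕ}
    (hg : g ≠ 0) (hn : 0 < n) : Nl n (EE bs (kapp lam) g ∅) := by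
  intro ρ z hρ hz
  have hz0 := (hz 0 hn).1
  have hc : (ρ 0 : ℂ) ≠ 0 := by exact_mod_cast hρ
  rw [EE_empty lam hg]
  obtain ⟨N1, h1⟩ := (hG g hg).ev_KK
  rcases Nat.lt_or_ge g 2 with h | h
  · obtain rfl : g = 1 := by omega
    rw [show 1 - 1 = 0 from rfl, hb.zero, AA_o, ev_q, h1 (N1 + 3) (by omega) ρ z hρ]
    have hk : ∀ k, 2 ≤ k → Gcoef lam 1 k ρ = 0 := by
      intro k hk
      unfold Gcoef Gtab
      simp only [if_true]
      rw [if_neg (by omega), if_neg (by omega)]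
    have hk0 : Gcoef lam 1 0 ρ = 2 * lam ^ 4 * ρ 1 / (ρ 0) ^ 2 := by simp [Gcoef, Gtab]
    have hk1 : Gcoef lam 1 1 ρ = -(2 * lam ^ 4) / ρ 0 := by simp [Gcoef, Gtab]
    have e0 : ∀ m, 1 ≤ m → ∀ j, 1 ≤ j → (ρ j : ℂ) * (Gcoef lam 1 (m + j) ρ : ℂ) = 0 := by
      intro m hm j hj; rw [hk _ (by omega)]; simp
    rw [show N1 + 3 = (N1 + 1) + 1 + 1 by ring, Finset.sum_range_succ', Finset.sum_range_succ']
    have a1 : ∀ m, ∑ j ∈ Finset.range (N1 + 1 + 1 + 1), (ρ j : ℂ) * (Gcoef lam 1 (m + j) ρ : ℂ)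
      = (ρ 0 : ℂ) * (Gcoef lam 1 m ρ : ℂ) + (ρ 1 : ℂ) * (Gcoef lam 1 (m + 1) ρ : ℂ) := by
      intro m
      rw [Finset.sum_range_succ', Finset.sum_range_succ', Finset.sum_eq_zero]
      · simp; ring
      · intro j _; rw [hk _ (by omega)]; simp
    simp only [a1]
    rw [Finset.sum_eq_zero]
    · rw [hk 2 (by omega), hk0, hk1]
      simp [kapp]
      field_simp
      ring
    · intro m _
      rw [hk _ (by omega), hk _ (by omega)]; simp
  · obtain ⟨N2, hKi1, hKi⟩ := K_inv lam g h
    obtain ⟨N3, h3⟩ := eG_expand lam g h hG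
    obtain ⟨N4, h4⟩ := (hG (g - 1) (by omega)).ev_AA
    have h5 : ∃ N, ∀ h, 1 ≤ h → h < g → ∀ M, N ≤ M → ev ρ z (bs h) =
        ∑ k ∈ Finset.range M, (Gcoef lam h k ρ : ℂ) * (z 0)⁻¹ ^ (2 * k + 3) := by
      have : ∀ h, ∃ N, 1 ≤ h → h < g → ∀ M, N ≤ M → ev ρ z (bs h) =
        ∑ k ∈ Finset.range M, (Gcoef lam h k ρ : ℂ) * (z 0)⁻¹ ^ (2 * k + 3) := by
        intro h
        by_cases hh : 1 ≤ h ∧ h < g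
        · obtain ⟨N, hN⟩ := (hG h (by omega)).ev_eq
          exact ⟨N, fun _ _ M hM => hN M hM ρ z hρ⟩
        · exact ⟨0, fun a b => absurd ⟨a, b⟩ hh⟩
      choose N hN using this
      exact ⟨(Finset.range g).sup N, fun h a b M hM => hN h a b M
        (le_trans (Finset.le_sup (f := N) (by simpa using b)) hM)⟩
    obtain ⟨N5, h5⟩ := h5
    set M := N1 + N2 + N3 + N4 + N5 with hM
    set x := (z 0)⁻¹ with hx
    have eK : ev ρ z (KK (bs g)) = -(1 / 2) * (∑ m ∈ Finset.range M, (eG lam g m ρ : ℂ) * (x ^ 2) ^ m) * x ^ 2 := by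
      rw [h1 M (by omega) ρ z hρ, Finset.mul_sum, Finset.sum_mul]
      refine Finset.sum_congr rfl fun m _ => ?_
      have := hKi M (by omega) m ρ hρ
      have := congrArg (fun t : ℝ => (t : ℂ)) this
      push_cast at this
      rw [this]; ring
    have eP : ∑ h ∈ Finset.Icc 1 (g - 1), ev ρ z (bs h) * ev ρ z (bs (g - h)) =
        (∑ h ∈ Finset.Icc 1 (g - 1), ∑ i ∈ Finset.range M, ∑ j ∈ Finset.range M,
        ((Gcoef lam h i ρ : ℂ) * (Gcoef lam (g - h) j ρ : ℂ)) * (x ^ 2) ^ (i + j + 2)) * x ^ 2 := by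
      rw [Finset.sum_mul]
      refine Finset.sum_congr rfl fun h hh => ?_
      have hh' := Finset.mem_Icc.1 hh
      rw [h5 h hh'.1 (by omega) M (by omega), h5 (g - h) (by omega) (by omega) M (by omega), Finset.sum_mul_sum,
        Finset.sum_mul]
      refine Finset.sum_congr rfl fun i _ => ?_
      rw [Finset.sum_mul]
      refine Finset.sum_congr rfl fun j _ => ?_
      ring
    have eA : ev ρ z (AA 0 (bs (g - 1))) = (
        ∑ k ∈ Finset.range M, (-(1 / (ρ 0 : ℂ)) * ∑ l ∈ Finset.range M, (3 + 2 * (l : ℂ)) * (ρ (l + 1) : ℂ)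
          * (pdR (Gcoef lam (g - 1) k) l ρ : ℂ)) * (x ^ 2) ^ (k + 2)
        + ∑ k ∈ Finset.range M, ∑ l ∈ Finset.range M, ((3 + 2 * (l : ℂ)) * (pdR (Gcoef lam (g - 1) k) l ρ : ℂ))
          * (x ^ 2) ^ (k + l + 3)
        + ∑ k ∈ Finset.range M, (-((2 * (k : ℂ) + 3) * (Gcoef lam (g - 1) k ρ : ℂ)) / (ρ 0 : ℂ)) * (x ^ 2) ^ (k + 3)) * x ^ 2 := by
      rw [h4 M (by omega) ρ z hρ hz0, ← Finset.sum_add_distrib, ← Finset.sum_add_distrib, Finset.sum_mul]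
      refine Finset.sum_congr rfl fun k _ => ?_
      have main : (∑ l ∈ Finset.range M, cR ρ (z 0) l * (pdR (Gcoef lam (g - 1) k) l ρ : ℂ)) * x ^ (2 * k + 3)
        = ((-(1 / (ρ 0 : ℂ)) * ∑ l ∈ Finset.range M, (3 + 2 * (l : ℂ)) * (ρ (l + 1) : ℂ)
          * (pdR (Gcoef lam (g - 1) k) l ρ : ℂ)) * (x ^ 2) ^ (k + 2)
        + ∑ l ∈ Finset.range M, ((3 + 2 * (l : ℂ)) * (pdR (Gcoef lam (g - 1) k) l ρ : ℂ))
          * (x ^ 2) ^ (k + l + 3)) * x ^ 2 := by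
        rw [Finset.mul_sum, Finset.sum_mul, Finset.sum_mul, ← Finset.sum_add_distrib, Finset.sum_mul]
        refine Finset.sum_congr rfl fun l _ => ?_
        have : cR ρ (z 0) l = (3 + 2 * (l : ℂ)) * (-(1 / (ρ 0 : ℂ)) * (ρ (l + 1) : ℂ) * x ^ 3 + x ^ (5 + 2 * l)) := by
          rw [cR, hx, inv_pow, inv_pow, div_eq_mul_inv, div_eq_mul_inv, mul_inv]
          ring
        rw [this]; ring
      rw [main, div_eq_mul_inv]
      ring
    rw [eK, h3 M (by omega) ρ (x ^ 2) hρ, eP, eA]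
    simp only [kapp]
    push_cast
    ring

/-- Normalisation of the multi-boundary functions. -/
def cst (lam : ℝ) (m : ℕ) : ℂ := if m = 0 then 1 else (2 * (lam : ℂ)) ^ (3 * m - 1)

lemma W_R0 {bs : ℕ → PR} (hb : Base bs) {n g : ℕ} {J : Finset ℕ} (hn : 0 < n)
    (hJ : ∀ i ∈ J, 0 < i ∧ i < n) (h : g ≠ 0 ∨ J ≠ ∅) : W bs g J ∈ R0 n := by
  have := Wo_R0 (g := g) hb hn hJ
  rwa [Wo, if_neg (by tauto)] at this

lemma Ico_insert (m : ℕ) : Finset.Ico 1 (m + 2) = insert (m + 1) (Finset.Ico 1 (m + 1)) := by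
  ext i; simp; omega

lemma GoodZ.mono {n m : ℕ} {z : ℕ → ℂ} (h : n ≤ m) (hz : GoodZ m z) : GoodZ n z :=
  fun i hi => hz i (by omega)

lemma GBraw_ev {lam : ℝ} {bs : ℕ → PR} (hb : Base bs) (hG : ∀ g, g ≠ 0 → IsG lam g (bs g)) {g : ℕ}
    (hg : g ≠ 0) (m : ℕ) : ∀ (ρ : ℕ → ℝ) (z : ℕ → ℂ), ρ 0 ≠ 0 → GoodZ (m + 1) z →
    GBraw lam g (m + 1) ρ z = ev ρ z (W bs g (Finset.Ico 1 (m + 1))) := by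
  induction m with
  | zero =>
    intro ρ z hρ hz
    rw [zero_add, GBraw]
    beta_reduce
    rw [Finset.Ico_self, W_empty, (hG g hg).Gfun_eq ρ z hρ]
  | succ m ih =>
    intro ρ z hρ hz
    rw [GBraw, AdagVar, AdagFree_ev (n := m + 1) (c := 1) (f := W bs g (Finset.Ico 1 (m + 1))) hρ
      (hz.mono (by omega)) (W_R0 hb (by omega) (fun i hi => by simp at hi; omega) (Or.inl hg))
      (fun ρ z h1 h2 => by rw [ih ρ z h1 h2, one_mul]) (m + 1) rfl (hz (m + 1) (by omega)).1, one_mul,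
      Ico_insert, W_insert _ _ (by simp)]

lemma GBraw0_ev (lam : ℝ) {bs : ℕ → PR} (hb : Base bs)
    (m : ℕ) : ∀ (ρ : ℕ → ℝ) (z : ℕ → ℂ), ρ 0 ≠ 0 → GoodZ (m + 2) z →
    GBraw0 lam (m + 2) ρ z = 4 * (lam : ℂ) ^ 2 * ev ρ z (W bs 0 (Finset.Ico 1 (m + 2))) := by
  induction m with
  | zero =>
    intro ρ z hρ hz
    have : Finset.Ico 1 2 = {1} := by decide
    rw [zero_add, GBraw0]
    beta_reduce
    rw [this, W_single hb, ev_q, div_eq_mul_inv]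
  | succ m ih =>
    intro ρ z hρ hz
    rw [GBraw0, AdagVar, AdagFree_ev (n := m + 2) (f := W bs 0 (Finset.Ico 1 (m + 2))) hρ
      (hz.mono (by omega)) (W_R0 hb (by omega) (fun i hi => by simp at hi; omega)
        (Or.inr (by rw [Ico_insert]; simp)))
      (fun ρ z h1 h2 => by rw [ih ρ z h1 h2]) (m + 2) rfl (hz (m + 2) (by omega)).1,
      show m + 1 + 2 = (m + 1) + 2 from rfl, Ico_insert (m + 1), W_insert _ _ (by simp)]

lemma GBfun_ev {lam : ℝ} {bs : ℕ → PR} (hb : Base bs) (hG : ∀ g, g ≠ 0 → IsG lam g (bs g)) {g m : ℕ}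
    (h : g ≠ 0 ∨ m ≠ 0) (ρ : ℕ → ℝ) (z : ℕ → ℂ) (hρ : ρ 0 ≠ 0) (hz : GoodZ (m + 1) z) :
    GBfun lam g (m + 1) ρ z = cst lam m * ev ρ z (W bs g (Finset.Ico 1 (m + 1))) := by
  unfold GBfun cst
  by_cases hg : g = 0
  · subst hg
    obtain ⟨k, rfl⟩ : ∃ k, m = k + 1 := ⟨m - 1, by omega⟩
    rw [if_pos rfl, if_neg (by omega), GBraw0_ev lam hb k ρ z hρ hz,
      show 3 * (k + 1 + 1) - 6 = 3 * k by omega, show 3 * (k + 1) - 1 = 3 * k + 2 by omega]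
    ring
  · rw [if_neg hg]
    by_cases hm : m = 0
    · subst hm
      rw [zero_add, if_pos rfl, if_pos rfl, Finset.Ico_self, W_empty, (hG g hg).Gfun_eq ρ z hρ, one_mul]
    · rw [if_neg (by omega), if_neg hm, GBraw_ev hb hG hg m ρ z hρ hz, show 3 * (m + 1) - 4 = 3 * m - 1 by omega]

/-! ### Renaming the labels -/

def renV (φ : ℕ → ℕ) : V → PR
  | .r l => rr l
  | .u => uu
  | .x i => xx (φ i)
  | .q i => qq (φ i)
  | .o => oo

def ren (φ : ℕ → ℕ) : PR →ₐ[ℝ] PR := MvPolynomial.aeval (renV φ)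

lemma ren_r (φ : ℕ → ℕ) (l : ℕ) : ren φ (rr l) = rr l := by simp [ren, rr, renV]
lemma ren_u (φ : ℕ → ℕ) : ren φ uu = uu := by simp [ren, uu, renV]
lemma ren_x (φ : ℕ → ℕ) (i : ℕ) : ren φ (xx i) = xx (φ i) := by simp [ren, xx, renV]
lemma ren_q (φ : ℕ → ℕ) (i : ℕ) : ren φ (qq i) = qq (φ i) := by simp [ren, qq, renV]
lemma ren_o (φ : ℕ → ℕ) : ren φ oo = oo := by simp [ren, oo, renV]

lemma ren_AA {φ : ℕ → ℕ} (h0 : φ 0 = 0) (i : ℕ) (p : PR) : ren φ (AA i p) = AA (φ i) (ren φ p) := by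
  induction p using MvPolynomial.induction_on with
  | C a =>
    have : (MvPolynomial.C a : PR) = algebraMap ℝ PR a := rfl
    rw [this, Derivation.map_algebraMap, AlgHom.commutes, Derivation.map_algebraMap, map_zero]
  | add p q hp hq => simp only [map_add, hp, hq]
  | mul_X p v hp =>
    rw [AA_mul, map_add, map_mul, map_mul, map_mul, AA_mul, hp]
    congr 2
    rcases v with l | _ | k | k | _
    · show ren φ (AA i (rr l)) = AA (φ i) (ren φ (rr l))
      rw [ren_r, AA_r, AA_r]
      simp [ren_r, ren_u, ren_x, map_ofNat (ren φ) 3, map_ofNat (ren φ) 2]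
    · show ren φ (AA i uu) = AA (φ i) (ren φ uu)
      rw [ren_u, AA_u, AA_u]
      simp [ren_r, ren_u, ren_x, map_ofNat (ren φ) 3, map_ofNat (ren φ) 2]
    · show ren φ (AA i (xx k)) = AA (φ i) (ren φ (xx k))
      rw [ren_x, AA_x, AA_x]
      simp [ren_r, ren_u, ren_x, map_ofNat (ren φ) 3, map_ofNat (ren φ) 2]
    · show ren φ (AA i (qq k)) = AA (φ i) (ren φ (qq k))
      rw [ren_q, AA_q, AA_q]
      simp [ren_r, ren_u, ren_x, h0]
    · show ren φ (AA i oo) = AA (φ i) (ren φ oo)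
      rw [ren_o, AA_o, AA_o, ren_q]

lemma ev_ren {φ : ℕ → ℕ} (h0 : φ 0 = 0) (ρ : ℕ → ℝ) (z : ℕ → ℂ) (p : PR) :
    ev ρ (fun n => z (φ n)) p = ev ρ z (ren φ p) := by
  have : ev ρ (fun n => z (φ n)) = (ev ρ z).comp (ren φ) := by
    apply MvPolynomial.algHom_ext
    rintro (l | _ | k | k | _)
    · show ev ρ (fun n => z (φ n)) (rr l) = ev ρ z (ren φ (rr l))
      rw [ren_r]; simp
    · show ev ρ (fun n => z (φ n)) uu = ev ρ z (ren φ uu)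
      rw [ren_u]; simp
    · show ev ρ (fun n => z (φ n)) (xx k) = ev ρ z (ren φ (xx k))
      rw [ren_x]; simp
    · show ev ρ (fun n => z (φ n)) (qq k) = ev ρ z (ren φ (qq k))
      rw [ren_q]; simp [h0]
    · show ev ρ (fun n => z (φ n)) oo = ev ρ z (ren φ oo)
      rw [ren_o]; simp [ev, oo, evv]
  rw [this]; rfl

lemma ev_congr {n : ℕ} {p : PR} (hp : p ∈ R0 n) (ρ : ℕ → ℝ) {z z' : ℕ → ℂ} (h : ∀ i, i < n → z i = z' i) :
    ev ρ z p = ev ρ z' p := by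
  refine R0_induction (P := fun p => ev ρ z p = ev ρ z' p) ?_ ?_ ?_ ?_ ?_ ?_ ?_ hp
  · intro a; rw [AlgHom.commutes, AlgHom.commutes]
  · intro l; simp
  · simp
  · intro i hi; simp [h i hi]
  · intro i hi; simp [h i hi, h 0 (by omega)]
  · intro f g hf hg; rw [map_add, map_add, hf, hg]
  · intro f g hf hg; rw [map_mul, map_mul, hf, hg]

lemma ren_bs {bs : ℕ → PR} (hb : Base bs) {φ : ℕ → ℕ} (h0 : φ 0 = 0) (g : ℕ) : ren φ (bs g) = bs g := by
  by_cases hg : g = 0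
  · subst hg; rw [hb.zero, ren_o]
  · refine Odd0_induction (P := fun f => ren φ f = f) (map_zero _) ?_ ?_ (hb.pos g hg)
    · intro c hc k
      have : ren φ c = c := by
        refine S0_induction (P := fun c => ren φ c = c) ?_ ?_ ?_ ?_ ?_ ?_ hc
        · intro a; rw [AlgHom.commutes]
        · intro l; rw [ren_r]
        · rw [ren_u]
        · intro i h1 h2; omega
        · intro f g hf hg; rw [map_add, hf, hg]
        · intro f g hf hg; rw [map_mul, hf, hg]
      rw [map_mul, map_pow, ren_x, h0, this]
    · intro f g hf hg; rw [map_add, hf, hg]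

lemma ren_Wm {φ : ℕ → ℕ} (h0 : φ 0 = 0) (b : PR) (I : Multiset ℕ) :
    ren φ (Wm b I) = Wm (ren φ b) (I.map φ) := by
  induction I using Multiset.induction_on with
  | empty => simp [Wm]
  | cons i I ih =>
    simp only [Wm, Multiset.foldr_cons, Multiset.map_cons] at *
    rw [ren_AA h0, ih]

/-- Slot labels. -/
def slotL (I : Finset ℕ) (n : ℕ) : ℕ := if n = 0 then 0 else (I.sort (· ≤ ·)).getD (n - 1) 0

lemma slotL_map (I : Finset ℕ) : (Finset.Ico 1 (I.card + 1)).val.map (slotL I) = I.val := by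
  have h : Finset.Ico 1 (I.card + 1) = (Finset.range I.card).map (addRightEmbedding 1) := by
    ext i; simp
    constructor
    · rintro ⟨h1, h2⟩; exact ⟨i - 1, by omega, by omega⟩
    · rintro ⟨k, h1, rfl⟩; omega
  rw [h, Finset.map_val, Multiset.map_map, Finset.range_val, Multiset.range, Multiset.map_coe]
  conv_rhs => rw [← Finset.sort_eq I (· ≤ ·)]
  congr 1
  refine List.ext_getElem (by simp) ?_
  intro k h1 h2
  simp [slotL] at *
  rw [List.getElem?_eq_getElem (by simpa using h1)]; rfl

lemma slotL_mem {I : Finset ℕ} {n : ℕ} (h1 : n ≠ 0) (h2 : n < I.card + 1) : slotL I n ∈ I := by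
  have : slotL I n ∈ I.val := by
    rw [← slotL_map I]
    exact Multiset.mem_map_of_mem _ (by simp; omega)
  exact this

lemma slotAt_eq {I : Finset ℕ} (hI : 0 ∉ I) (z : ℕ → ℂ) (w : ℂ) {n : ℕ} (hn : n < I.card + 1) :
    slotAt z w I n = Function.update z 0 w (slotL I n) := by
  by_cases h : n = 0
  · simp [h, slotAt, slotL]
  · have h1 := slotL_mem h hn
    rw [Function.update_of_ne (by intro e; rw [e] at h1; exact hI h1), slotAt, slotL, if_neg h, if_neg h]

lemma GBfun_slot {lam : ℝ} {bs : ℕ → PR} (hb : Base bs) (hG : ∀ g, g ≠ 0 → IsG lam g (bs g)) {g : ℕ}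
    {I : Finset ℕ} (h : g ≠ 0 ∨ I ≠ ∅) (hI : 0 ∉ I) (ρ : ℕ → ℝ) (z : ℕ → ℂ) (w : ℂ) (hρ : ρ 0 ≠ 0) (hw : w ≠ 0)
    (hz : ∀ i ∈ I, z i ≠ 0 ∧ w + z i ≠ 0) :
    GBfun lam g (I.card + 1) ρ (slotAt z w I) = cst lam I.card * ev ρ (Function.update z 0 w) (W bs g I) := by
  have h' : g ≠ 0 ∨ I.card ≠ 0 := by
    rcases h with h | h
    · exact Or.inl h
    · right; simpa using h
  have h0 : slotL I 0 = 0 := by simp [slotL]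
  rw [GBfun_ev hb hG h' ρ _ hρ]
  · congr 1
    rw [ev_congr (W_R0 hb (n := I.card + 1) (by omega) (fun i hi => by simp at hi; omega) ?_) ρ
      (z' := fun n => Function.update z 0 w (slotL I n)) (fun i hi => slotAt_eq hI z w hi), ev_ren h0]
    · congr 1
      rw [W, ren_Wm h0, ren_bs hb h0, slotL_map, W]
    · rcases h' with h' | h'
      · exact Or.inl h'
      · right
        refine Finset.Nonempty.ne_empty ⟨1, Finset.mem_Ico.2 ⟨le_rfl, by omega⟩⟩
  · intro i hi
    have e0 : slotAt z w I 0 = w := by simp [slotAt]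
    by_cases hi0 : i = 0
    · rw [hi0, e0]
      refine ⟨hw, ?_⟩
      rw [← two_mul]; exact mul_ne_zero two_ne_zero hw
    · have h1 := slotL_mem hi0 hi
      rw [e0, slotAt_eq hI z w hi, Function.update_of_ne (by intro e; rw [e] at h1; exact hI h1)]
      exact hz _ h1

/-! ### The integral operator -/

lemma Adm_ne {a b : ℝ} {z : ℂ} (hz : Admissible a b z) {y : ℝ} (hy : y ∈ Set.Icc a b) :
    z + (y : ℂ) ≠ 0 ∧ z ^ 2 - (y : ℂ) ^ 2 ≠ 0 := by
  obtain ⟨h1, h2⟩ := hz.2 y hy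
  have h3 : z + (y : ℂ) ≠ 0 := fun h => h2 (eq_neg_of_add_eq_zero_left h)
  refine ⟨h3, ?_⟩
  rw [sq_sub_sq]
  exact mul_ne_zero h3 (sub_ne_zero.2 h1)

lemma y_ne {a b y : ℝ} (ha : 0 < a) (hy : y ∈ Set.Icc a b) : (y : ℂ) ≠ 0 := by
  have : 0 < y := lt_of_lt_of_le ha hy.1
  exact_mod_cast this.ne'

section
variable {a b : ℝ} {r : ℝ → ℝ}

lemma cont_r (hr : ContinuousOn r (Set.Icc a b)) : ContinuousOn (fun y => (r y : ℂ)) (Set.Icc a b) :=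
  Complex.continuous_ofReal.comp_continuousOn hr

lemma cont_F (ha : 0 < a) (hr : ContinuousOn r (Set.Icc a b)) {z : ℂ} (hz : Admissible a b z) (k : ℕ) :
    ContinuousOn (fun y : ℝ => (r y : ℂ) * (z⁻¹ ^ k - (y : ℂ)⁻¹ ^ k) / (z ^ 2 - (y : ℂ) ^ 2)) (Set.Icc a b) := by
  have hy : ContinuousOn (fun y : ℝ => (y : ℂ)) (Set.Icc a b) := Complex.continuous_ofReal.continuousOn
  refine ContinuousOn.div ((cont_r hr).mul (continuousOn_const.sub ((hy.inv₀ ?_).pow k)))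
    (continuousOn_const.sub (hy.pow 2)) ?_
  · exact fun y h => y_ne ha h
  · exact fun y h => (Adm_ne hz h).2

lemma cont_G (ha : 0 < a) (hr : ContinuousOn r (Set.Icc a b)) {z : ℂ} (hz : Admissible a b z) :
    ContinuousOn (fun y : ℝ => (r y : ℂ) / ((z + (y : ℂ)) * (y : ℂ))) (Set.Icc a b) := by
  have hy : ContinuousOn (fun y : ℝ => (y : ℂ)) (Set.Icc a b) := Complex.continuous_ofReal.continuousOn
  refine ContinuousOn.div (cont_r hr) ((continuousOn_const.add hy).mul hy) ?_
  exact fun y h => mul_ne_zero (Adm_ne hz h).1 (y_ne ha h)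

lemma cont_M (ha : 0 < a) (hr : ContinuousOn r (Set.Icc a b)) (k : ℕ) :
    ContinuousOn (fun y : ℝ => (r y : ℂ) / (y : ℂ) ^ k) (Set.Icc a b) := by
  have hy : ContinuousOn (fun y : ℝ => (y : ℂ)) (Set.Icc a b) := Complex.continuous_ofReal.continuousOn
  refine ContinuousOn.div (cont_r hr) (hy.pow k) ?_
  exact fun y h => pow_ne_zero _ (y_ne ha h)

lemma II {f : ℝ → ℂ} (hab : a ≤ b) (hf : ContinuousOn f (Set.Icc a b)) : IntervalIntegrable f volume a b :=
  ContinuousOn.intervalIntegrable (by rwa [Set.uIcc_of_le hab])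

lemma int_congr {f g : ℝ → ℂ} (hab : a ≤ b) (h : ∀ y ∈ Set.Icc a b, f y = g y) :
    ∫ y in a..b, f y = ∫ y in a..b, g y := by
  apply intervalIntegral.integral_congr
  intro y hy
  rw [Set.uIcc_of_le hab] at hy
  exact h y hy

lemma moment_cast (s : ℝ) (l : ℕ) : (moment a b s r l : ℂ) =
    (if l = 0 then (s : ℂ) else 0) - (1 / 2) * ∫ y in a..b, (r y : ℂ) / (y : ℂ) ^ (3 + 2 * l) := by
  have : (∫ y in a..b, (r y : ℂ) / (y : ℂ) ^ (3 + 2 * l)) =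
      ((∫ y in a..b, r y / y ^ (3 + 2 * l) : ℝ) : ℂ) := by
    rw [← intervalIntegral.integral_ofReal]
    congr 1; ext y; push_cast; rfl
  rw [this, moment]
  split_ifs <;> push_cast <;> rfl

lemma Khat_mono (ha : 0 < a) (hab : a < b) (hr : ContinuousOn r (Set.Icc a b)) (s nbar : ℝ) {z : ℕ → ℂ}
    (hz : Admissible a b (z 0)) (k : ℕ) :
    G0fun a b s nbar r (z 0) * (z 0)⁻¹ ^ (2 * k + 3) + (nbar : ℂ) * (z 0)⁻¹ ^ (2 * k + 3)
    + (1 / 2) * ∫ y in a..b, (r y : ℂ) * ((z 0)⁻¹ ^ (2 * k + 3) - (y : ℂ)⁻¹ ^ (2 * k + 3)) / ((z 0) ^ 2 - (y : ℂ) ^ 2)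
    = ev (moment a b s r) z (kap k) := by
  have hz1 := hz.1
  induction k with
  | zero =>
    have h1 : (∫ y in a..b, (r y : ℂ) * ((z 0)⁻¹ ^ (2 * 0 + 3) - (y : ℂ)⁻¹ ^ (2 * 0 + 3)) / ((z 0) ^ 2 - (y : ℂ) ^ 2))
        = (-(z 0)⁻¹ ^ 2) * (∫ y in a..b, (r y : ℂ) / (y : ℂ) ^ (3 + 2 * 0))
          - (z 0)⁻¹ ^ 3 * ∫ y in a..b, (r y : ℂ) / ((z 0 + (y : ℂ)) * (y : ℂ)) := by
      rw [← intervalIntegral.integral_const_mul, ← intervalIntegral.integral_const_mul,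
        ← intervalIntegral.integral_sub]
      · refine int_congr hab.le fun y hy => ?_
        obtain ⟨h2, h3⟩ := Adm_ne hz hy
        have h4 := y_ne ha hy
        have h5 : z 0 - (y : ℂ) ≠ 0 := fun h => h3 (by rw [sq_sub_sq, h, mul_zero])
        rw [sq_sub_sq]
        simp only [inv_pow, mul_zero, zero_add, add_zero]
        field_simp
        ring
      · exact (II hab.le (cont_M ha hr _)).const_mul _
      · exact (II hab.le (cont_G ha hr hz)).const_mul _
    rw [h1, G0fun, kap, map_mul, map_pow, ev_r, ev_x, moment_cast, if_pos rfl]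
    simp only [inv_pow, mul_zero, zero_add, add_zero]
    field_simp
    ring
  | succ k ih =>
    have h1 : (∫ y in a..b, (r y : ℂ) * ((z 0)⁻¹ ^ (2 * (k + 1) + 3) - (y : ℂ)⁻¹ ^ (2 * (k + 1) + 3)) / ((z 0) ^ 2 - (y : ℂ) ^ 2))
        = (z 0)⁻¹ ^ 2 * (∫ y in a..b, (r y : ℂ) * ((z 0)⁻¹ ^ (2 * k + 3) - (y : ℂ)⁻¹ ^ (2 * k + 3)) / ((z 0) ^ 2 - (y : ℂ) ^ 2))
          - (z 0)⁻¹ ^ 2 * ∫ y in a..b, (r y : ℂ) / (y : ℂ) ^ (3 + 2 * (k + 1)) := by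
      rw [← intervalIntegral.integral_const_mul, ← intervalIntegral.integral_const_mul,
        ← intervalIntegral.integral_sub]
      · refine int_congr hab.le fun y hy => ?_
        obtain ⟨h2, h3⟩ := Adm_ne hz hy
        have h4 := y_ne ha hy
        rw [show 3 + 2 * (k + 1) = (2 * k + 3) + 2 by ring, show 2 * (k + 1) + 3 = (2 * k + 3) + 2 by ring]
        simp only [inv_pow]
        field_simp
        ring
      · exact (II hab.le (cont_F ha hr hz _)).const_mul _
      · exact (II hab.le (cont_M ha hr _)).const_mul _
    rw [h1, kap, map_add, map_mul, map_mul, map_pow, ← ih, ev_r, ev_x, moment_cast, if_neg (by omega)]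
    ring

lemma ev_S0_update {n : ℕ} {c : PR} (hc : c ∈ S0 n) (ρ : ℕ → ℝ) (z : ℕ → ℂ) (w : ℂ) :
    ev ρ (Function.update z 0 w) c = ev ρ z c := by
  refine S0_induction (P := fun c => ev ρ (Function.update z 0 w) c = ev ρ z c) ?_ ?_ ?_ ?_ ?_ ?_ hc
  · intro a; rw [AlgHom.commutes, AlgHom.commutes]
  · intro l; simp
  · simp
  · intro i hi _; simp [Function.update_of_ne hi.ne']
  · intro f g hf hg; rw [map_add, map_add, hf, hg]
  · intro f g hf hg; rw [map_mul, map_mul, hf, hg]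

lemma Khat_poly (ha : 0 < a) (hab : a < b) (hr : ContinuousOn r (Set.Icc a b)) (s nbar : ℝ) {z : ℕ → ℂ}
    (hz : Admissible a b (z 0)) {n : ℕ} {p : PR} (hp : p ∈ Odd0 n) :
    IntervalIntegrable (fun y : ℝ => (r y : ℂ) * (ev (moment a b s r) z p -
      ev (moment a b s r) (Function.update z 0 (y : ℂ)) p) / ((z 0) ^ 2 - (y : ℂ) ^ 2)) volume a b ∧
    Khat a b s nbar r (fun w => ev (moment a b s r) (Function.update z 0 w) p) (z 0)
      = ev (moment a b s r) z (KK p) := by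
  unfold Khat
  beta_reduce
  rw [Function.update_eq_self]
  refine Odd0_induction (P := fun p => IntervalIntegrable (fun y : ℝ => (r y : ℂ) * (ev (moment a b s r) z p -
      ev (moment a b s r) (Function.update z 0 (y : ℂ)) p) / ((z 0) ^ 2 - (y : ℂ) ^ 2)) volume a b ∧
    G0fun a b s nbar r (z 0) * ev (moment a b s r) z p + (nbar : ℂ) * ev (moment a b s r) z p
    + (1 / 2) * ∫ y in a..b, (r y : ℂ) * (ev (moment a b s r) z p -
      ev (moment a b s r) (Function.update z 0 (y : ℂ)) p) / ((z 0) ^ 2 - (y : ℂ) ^ 2)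
      = ev (moment a b s r) z (KK p)) ?_ ?_ ?_ hp
  · simp
  · intro c hc k
    have e : (fun y : ℝ => (r y : ℂ) * (ev (moment a b s r) z (c * xx 0 ^ (2 * k + 3)) -
      ev (moment a b s r) (Function.update z 0 (y : ℂ)) (c * xx 0 ^ (2 * k + 3))) / ((z 0) ^ 2 - (y : ℂ) ^ 2))
      = fun y : ℝ => ev (moment a b s r) z c *
        ((r y : ℂ) * ((z 0)⁻¹ ^ (2 * k + 3) - (y : ℂ)⁻¹ ^ (2 * k + 3)) / ((z 0) ^ 2 - (y : ℂ) ^ 2)) := by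
      ext y
      simp only [map_mul, map_pow, ev_x, ev_S0_update hc, Function.update_self]
      ring
    rw [e]
    refine ⟨(II hab.le (cont_F ha hr hz _)).const_mul _, ?_⟩
    rw [intervalIntegral.integral_const_mul, KK_mul hc, map_mul, map_mul, map_pow, ev_x,
      ← Khat_mono ha hab hr s nbar hz k]
    ring
  · rintro f g ⟨hf, hf'⟩ ⟨hg, hg'⟩
    have e : (fun y : ℝ => (r y : ℂ) * (ev (moment a b s r) z (f + g) -
      ev (moment a b s r) (Function.update z 0 (y : ℂ)) (f + g)) / ((z 0) ^ 2 - (y : ℂ) ^ 2))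
      = fun y : ℝ => (r y : ℂ) * (ev (moment a b s r) z f -
      ev (moment a b s r) (Function.update z 0 (y : ℂ)) f) / ((z 0) ^ 2 - (y : ℂ) ^ 2)
      + (r y : ℂ) * (ev (moment a b s r) z g -
      ev (moment a b s r) (Function.update z 0 (y : ℂ)) g) / ((z 0) ^ 2 - (y : ℂ) ^ 2) := by
      ext y
      simp only [map_add]
      ring
    rw [e]
    refine ⟨hf.add hg, ?_⟩
    rw [intervalIntegral.integral_add hf hg, map_add, map_add, map_add, ← hf', ← hg']
    ring

lemma Khat_ev (ha : 0 < a) (hab : a < b) (hr : ContinuousOn r (Set.Icc a b)) (s nbar : ℝ) {z : ℕ → ℂ}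
    (hz : Admissible a b (z 0)) {n : ℕ} {p : PR} (hp : p ∈ Odd0 n) (c : ℂ) (f : ℂ → ℂ) (S : Finset ℂ)
    (hS : z 0 ∉ S) (hf : ∀ w, w ≠ 0 → w ∉ S → f w = c * ev (moment a b s r) (Function.update z 0 w) p) :
    Khat a b s nbar r f (z 0) = c * ev (moment a b s r) z (KK p) := by
  rw [← (Khat_poly ha hab hr s nbar hz hp).2]
  unfold Khat
  beta_reduce
  rw [hf _ hz.1 hS, Function.update_eq_self]
  have : (∫ y in a..b, (r y : ℂ) * (c * ev (moment a b s r) z p - f (y : ℂ)) / (z 0 ^ 2 - (y : ℂ) ^ 2))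
    = c * ∫ y in a..b, (r y : ℂ) * (ev (moment a b s r) z p
      - ev (moment a b s r) (Function.update z 0 (y : ℂ)) p) / (z 0 ^ 2 - (y : ℂ) ^ 2) := by
    rw [← intervalIntegral.integral_const_mul]
    apply intervalIntegral.integral_congr_ae
    have hfin : (((fun y : ℝ => (y : ℂ)) ⁻¹' (S : Set ℂ))).Finite :=
      S.finite_toSet.preimage (Complex.ofReal_injective.injOn)
    have h0 : ∀ᵐ y : ℝ, y ∉ ((fun y : ℝ => (y : ℂ)) ⁻¹' (S : Set ℂ)) :=
      MeasureTheory.compl_mem_ae_iff.2 (hfin.measure_zero _)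
    filter_upwards [h0] with y hy hy2
    rw [Set.uIoc_of_le hab.le] at hy2
    rw [hf _ (y_ne ha ⟨hy2.1.le, hy2.2⟩) (by simpa using hy)]
    ring
  rw [this]
  ring
end

lemma deriv_mono {ρ : ℕ → ℝ} {z : ℕ → ℂ} {β : ℕ} (h0 : z 0 ≠ 0) (hβ : z β ≠ 0) (h1 : z 0 + z β ≠ 0)
    (h2 : z 0 ≠ z β) (k : ℕ) :
    HasDerivAt (fun t : ℂ => ((z 0)⁻¹ ^ (2 * k + 3) - t⁻¹ ^ (2 * k + 3)) / ((z 0) ^ 2 - t ^ 2))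
      (z β * (ev ρ z (tau β k) - ev ρ z (qq β) * (z 0)⁻¹ ^ (2 * k + 3))) (z β) := by
  have hd : z 0 ^ 2 - z β ^ 2 ≠ 0 := by
    rw [sq_sub_sq]; exact mul_ne_zero h1 (sub_ne_zero.2 h2)
  have hp : ∀ k : ℕ, HasDerivAt (fun t : ℂ => t⁻¹ ^ (k + 1)) (-((k + 1 : ℕ) : ℂ) * (z β)⁻¹ ^ (k + 2)) (z β) := by
    intro k
    have := (hasDerivAt_inv hβ).pow (k + 1)
    refine this.congr_deriv ?_
    simp only [Nat.add_sub_cancel, inv_pow]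
    field_simp
    ring
  induction k with
  | zero =>
    have h := ((hp 2).const_sub ((z 0)⁻¹ ^ 3)).div ((hasDerivAt_pow 2 (z β)).const_sub (z 0 ^ 2)) hd
    refine HasDerivAt.congr_deriv h ?_
    simp only [tau, map_add, map_mul, map_pow, ev_x, ev_q, map_ofNat (ev ρ z) 3]
    have h5 : z 0 - z β ≠ 0 := sub_ne_zero.2 h2
    rw [sq_sub_sq]
    simp only [inv_pow, mul_zero, zero_add]
    push_cast
    field_simp
    ring
  | succ k ih =>
    have h := (ih.mul_const ((z 0)⁻¹ ^ 2)).sub ((hp (2 * k + 4)).mul_const ((z 0)⁻¹ ^ 2))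
    have h' := h.congr_deriv (g' := z β * (ev ρ z (tau β (k + 1)) - ev ρ z (qq β) * (z 0)⁻¹ ^ (2 * (k + 1) + 3))) (by
      simp only [tau, map_add, map_mul, map_pow, ev_x, ev_q, map_ofNat (ev ρ z) 2, map_ofNat (ev ρ z) 5, map_natCast]
      push_cast
      simp only [inv_pow]
      field_simp
      ring)
    refine h'.congr_of_eventuallyEq ?_
    have e1 : ∀ᶠ t in nhds (z β), t ≠ 0 := eventually_ne_nhds hβ
    have e2 : ∀ᶠ t in nhds (z β), z 0 ^ 2 - t ^ 2 ≠ 0 :=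
      ContinuousAt.eventually_ne (by fun_prop) hd
    filter_upwards [e1, e2] with t h3 h4
    simp only [Pi.sub_apply, inv_pow]
    rw [show 2 * (k + 1) + 3 = (2 * k + 3) + 2 by ring, show 2 * k + 4 + 1 = (2 * k + 3) + 2 by ring]
    field_simp
    ring

lemma deriv_poly {ρ : ℕ → ℝ} {z : ℕ → ℂ} {β : ℕ} (h0 : z 0 ≠ 0) (hβ : z β ≠ 0) (h1 : z 0 + z β ≠ 0)
    (h2 : z 0 ≠ z β) {n : ℕ} {p : PR} (hp : p ∈ Odd0 n) :
    HasDerivAt (fun t : ℂ => (ev ρ z p - ev ρ (Function.update z 0 t) p) / ((z 0) ^ 2 - t ^ 2))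
      (z β * ev ρ z (UU β p)) (z β) := by
  refine Odd0_induction (P := fun p => HasDerivAt
    (fun t : ℂ => (ev ρ z p - ev ρ (Function.update z 0 t) p) / ((z 0) ^ 2 - t ^ 2))
      (z β * ev ρ z (UU β p)) (z β)) ?_ ?_ ?_ hp
  · simp [UU, hasDerivAt_const]
  · intro c hc k
    have h := (deriv_mono (ρ := ρ) h0 hβ h1 h2 k).const_mul (ev ρ z c)
    have h' := h.congr_deriv (g' := z β * ev ρ z (UU β (c * xx 0 ^ (2 * k + 3)))) (by
      rw [UU, TT_mul _ hc]; simp only [map_sub, map_mul, map_pow, ev_x]; ring)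
    refine h'.congr_of_eventuallyEq (Filter.Eventually.of_forall fun t => ?_)
    simp only [map_mul, map_pow, ev_x, ev_S0_update hc, Function.update_self]
    ring
  · intro f g hf hg
    have h' := (hf.add hg).congr_deriv (g' := z β * ev ρ z (UU β (f + g))) (by
      simp only [UU, map_add, map_sub, map_mul]; ring)
    refine h'.congr_of_eventuallyEq (Filter.Eventually.of_forall fun t => ?_)
    simp only [map_add, Pi.add_apply]
    ring

/-! ### Assembly -/

lemma cst_mul (lam : ℝ) {k l : ℕ} (hk : 1 ≤ k) (hl : 1 ≤ l) :
    (lam : ℂ) * (cst lam k * cst lam l) = cst lam (k + l) * (1 / 2) := by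
  unfold cst
  rw [if_neg (by omega), if_neg (by omega), if_neg (by omega),
    show 3 * (k + l) - 1 = (3 * k - 1) + (3 * l - 1) + 1 by omega, pow_add, pow_add]
  ring

lemma cst_succ (lam : ℝ) {m : ℕ} (hm : 1 ≤ m) :
    (if m + 1 = 2 then (2 * (lam : ℂ)) ^ 2 else (2 * (lam : ℂ)) ^ 3) * cst lam (m - 1) = cst lam m := by
  unfold cst
  rw [if_neg (show m ≠ 0 by omega)]
  by_cases h : m = 1
  · subst h; simp
  · rw [if_neg (by omega), if_neg (by omega), ← pow_add]
    congr 1; omega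

section
variable {lam : ℝ} {bs : ℕ → PR} {ρ : ℕ → ℝ} {z : ℕ → ℂ} {g m : ℕ}

lemma diag_term (hb : Base bs) (hG : ∀ g, g ≠ 0 → IsG lam g (bs g)) (hm : 1 ≤ m) (hρ : ρ 0 ≠ 0)
    (hz : GoodZ (m + 1) z) :
    (lam : ℂ) * ((2 * (lam : ℂ)) ^ 3 * AdagVar (Finset.range (m + 1)) (m + 1) (GBfun lam (g - 1) (m + 1)) ρ
        (Function.update z (m + 1) (z 0)))
      = cst lam m * ((kapp lam : ℂ) * ev ρ z (AA 0 (W bs (g - 1) (Finset.Ico 1 (m + 1))))) := by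
  have hu : ∀ i, i < m + 1 → Function.update z (m + 1) (z 0) i = z i := fun i hi =>
    Function.update_of_ne (by omega) _ _
  have hW : W bs (g - 1) (Finset.Ico 1 (m + 1)) ∈ R0 (m + 1) :=
    W_R0 hb (by omega) (fun i hi => by simp at hi; omega)
      (Or.inr (Finset.Nonempty.ne_empty ⟨1, Finset.mem_Ico.2 ⟨le_rfl, by omega⟩⟩))
  have hgz : GoodZ (m + 1) (Function.update z (m + 1) (z 0)) := by
    intro i hi
    rw [hu i hi, hu 0 (by omega)]
    exact hz i hi
  rw [AdagVar, AdagFree_ev (n := m + 1) (c := cst lam m) (f := W bs (g - 1) (Finset.Ico 1 (m + 1))) hρ hgz hW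
    (fun ρ z h1 h2 => GBfun_ev hb hG (Or.inr (by omega)) ρ z h1 h2) 0
    (by rw [hu 0 (by omega), Function.update_self])
    (by rw [Function.update_self]; exact (hz 0 (by omega)).1),
    ev_congr (AA_R0 (by omega) hW) ρ hu, kapp]
  push_cast
  ring

lemma prod_term (hb : Base bs) (hG : ∀ g, g ≠ 0 → IsG lam g (bs g)) (hm : 1 ≤ m) (hρ : ρ 0 ≠ 0)
    (hz : GoodZ (m + 1) z) :
    (lam : ℂ) * (∑ h ∈ Finset.range (g + 1), ∑ I ∈ (Finset.Ico 1 (m + 1)).powerset,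
          (if 1 ≤ I.card ∧ I.card ≤ m + 1 - 2 then
            GBfun lam h (I.card + 1) ρ (slotAt z (z 0) I) *
              GBfun lam (g - h) (((Finset.Ico 1 (m + 1)) \ I).card + 1) ρ
                (slotAt z (z 0) ((Finset.Ico 1 (m + 1)) \ I))
           else 0))
      + ∑ h ∈ Finset.Icc 1 g, Gfun lam h ρ (z 0) * GBfun lam (g - h) (m + 1) ρ z
    = cst lam m * ((1 / 2) * ∑ h ∈ Finset.range (g + 1), ∑ I ∈ (Finset.Ico 1 (m + 1)).powerset,
        ev ρ z (Wo bs h I) * ev ρ z (Wo bs (g - h) (Finset.Ico 1 (m + 1) \ I))) := by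
  set J := Finset.Ico 1 (m + 1) with hJ
  have hJne : J ≠ ∅ := Finset.Nonempty.ne_empty ⟨1, Finset.mem_Ico.2 ⟨le_rfl, by omega⟩⟩
  have hJc : J.card = m := by simp [hJ]
  have hsl : ∀ (h : ℕ) (I : Finset ℕ), I ⊆ J → I ≠ ∅ →
      GBfun lam h (I.card + 1) ρ (slotAt z (z 0) I) = cst lam I.card * ev ρ z (Wo bs h I) := by
    intro h I hI hne
    rw [GBfun_slot hb hG (Or.inr hne) ?_ ρ z (z 0) hρ (hz 0 (by omega)).1, Function.update_eq_self, Wo,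
      if_neg (by tauto)]
    · intro i hi
      have := hI hi
      rw [hJ, Finset.mem_Ico] at this
      exact hz i (by omega)
    · intro h0
      have := hI h0
      rw [hJ, Finset.mem_Ico] at this
      omega
  have h1 : ∀ h, ∀ I ∈ J.powerset, (lam : ℂ) * (if 1 ≤ I.card ∧ I.card ≤ m + 1 - 2 then
            GBfun lam h (I.card + 1) ρ (slotAt z (z 0) I) *
              GBfun lam (g - h) ((J \ I).card + 1) ρ (slotAt z (z 0) (J \ I)) else 0)
      = cst lam m * (1 / 2) * (ev ρ z (Wo bs h I) * ev ρ z (Wo bs (g - h) (J \ I))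
        - (if I = ∅ then ev ρ z (Wo bs h ∅) * ev ρ z (Wo bs (g - h) J) else 0)
        - (if I = J then ev ρ z (Wo bs h J) * ev ρ z (Wo bs (g - h) ∅) else 0)) := by
    intro h I hI
    rw [Finset.mem_powerset] at hI
    by_cases e1 : I = ∅
    · subst e1
      rw [if_neg (by simp), if_pos rfl, if_neg (fun e => hJne e.symm)]
      simp
    · by_cases e2 : I = J
      · subst e2
        rw [if_neg (by omega), if_neg e1, if_pos rfl]
        simp
      · have hc1 : 1 ≤ I.card := Finset.card_pos.2 (Finset.nonempty_iff_ne_empty.2 e1)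
        have hss : I ⊂ J := lt_of_le_of_ne hI e2
        have hc2 := Finset.card_lt_card hss
        have hd : J \ I ≠ ∅ := by
          rw [Ne, Finset.sdiff_eq_empty_iff_subset]
          exact fun h => e2 (Finset.Subset.antisymm hI h)
        have hc3 : I.card + (J \ I).card = m := by
          rw [Finset.card_sdiff_of_subset hI]; omega
        rw [if_pos (by omega), if_neg e1, if_neg e2, hsl h I hI e1, hsl (g - h) _ Finset.sdiff_subset hd,
          sub_zero, sub_zero, ← hc3, ← cst_mul lam hc1 (Finset.card_pos.2 (Finset.nonempty_iff_ne_empty.2 hd))]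
        ring
  have h2 : (lam : ℂ) * (∑ h ∈ Finset.range (g + 1), ∑ I ∈ J.powerset,
          (if 1 ≤ I.card ∧ I.card ≤ m + 1 - 2 then
            GBfun lam h (I.card + 1) ρ (slotAt z (z 0) I) *
              GBfun lam (g - h) ((J \ I).card + 1) ρ (slotAt z (z 0) (J \ I)) else 0))
      = cst lam m * (1 / 2) * (∑ h ∈ Finset.range (g + 1), ∑ I ∈ J.powerset,
        ev ρ z (Wo bs h I) * ev ρ z (Wo bs (g - h) (J \ I))
        - ∑ h ∈ Finset.range (g + 1), ev ρ z (Wo bs h ∅) * ev ρ z (Wo bs (g - h) J)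
        - ∑ h ∈ Finset.range (g + 1), ev ρ z (Wo bs h J) * ev ρ z (Wo bs (g - h) ∅)) := by
    rw [← Finset.sum_sub_distrib, ← Finset.sum_sub_distrib, Finset.mul_sum, Finset.mul_sum]
    refine Finset.sum_congr rfl fun h _ => ?_
    rw [Finset.mul_sum, Finset.sum_congr rfl (h1 h), ← Finset.mul_sum, Finset.sum_sub_distrib,
      Finset.sum_sub_distrib, Finset.sum_ite_eq' _ ∅, Finset.sum_ite_eq' _ J, if_pos (by simp), if_pos (by simp)]
  have h3 : ∑ h ∈ Finset.range (g + 1), ev ρ z (Wo bs h J) * ev ρ z (Wo bs (g - h) ∅)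
      = ∑ h ∈ Finset.range (g + 1), ev ρ z (Wo bs h ∅) * ev ρ z (Wo bs (g - h) J) := by
    rw [← Finset.sum_range_reflect]
    refine Finset.sum_congr rfl fun h hh => ?_
    rw [Finset.mem_range] at hh
    rw [show g + 1 - 1 - h = g - h by omega, show g - (g - h) = h by omega, mul_comm]
  have h4 : ∑ h ∈ Finset.Icc 1 g, Gfun lam h ρ (z 0) * GBfun lam (g - h) (m + 1) ρ z
      = cst lam m * ∑ h ∈ Finset.range (g + 1), ev ρ z (Wo bs h ∅) * ev ρ z (Wo bs (g - h) J) := by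
    rw [Finset.range_eq_Ico, Finset.sum_eq_sum_Ico_succ_bot (by omega), Wo, if_pos ⟨rfl, rfl⟩, map_zero,
      zero_mul, zero_add, Finset.mul_sum]
    have e : Finset.Icc 1 g = Finset.Ico (0 + 1) (g + 1) := by ext i; simp [Nat.lt_succ_iff]
    rw [e]
    refine Finset.sum_congr rfl fun h hh => ?_
    rw [Finset.mem_Ico] at hh
    rw [(hG h (by omega)).Gfun_eq ρ z hρ, GBfun_ev hb hG (Or.inr (by omega)) ρ z hρ hz, Wo, Wo,
      if_neg (by omega), if_neg (by tauto), W_empty]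
    ring
  rw [h2, h3, h4]
  ring

lemma deriv_term (hb : Base bs) (hG : ∀ g, g ≠ 0 → IsG lam g (bs g)) (hρ : ρ 0 ≠ 0) (hm : 1 ≤ m) (hgm : g ≠ 0 ∨ 2 ≤ m)
    (hz : ∀ i, i < m + 1 → z i ≠ 0)
    (hzz : ∀ i j, i < m + 1 → j < m + 1 → i ≠ j → z i ≠ z j ∧ z i + z j ≠ 0) {β : ℕ}
    (hβ : β ∈ Finset.Ico 1 (m + 1)) (d : ℂ)
    (hd : HasDerivAt (fun t : ℂ => (ev ρ z (W bs g ((Finset.Ico 1 (m + 1)).erase β))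
      - ev ρ (Function.update z 0 t) (W bs g ((Finset.Ico 1 (m + 1)).erase β))) / ((z 0) ^ 2 - t ^ 2))
      (z β * d) (z β)) :
    (1 / z β) * deriv (fun t : ℂ => (GBfun lam g (m + 1 - 1) ρ (slotAt z (z 0) ((Finset.Ico 1 (m + 1)) \ {β}))
          - GBfun lam g (m + 1 - 1) ρ (slotAt z t ((Finset.Ico 1 (m + 1)) \ {β}))) / ((z 0) ^ 2 - t ^ 2)) (z β)
      = cst lam (m - 1) * d := by
  have hβ' := Finset.mem_Ico.1 hβ
  have hzβ : z β ≠ 0 := hz β hβ'.2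
  have hc : ((Finset.Ico 1 (m + 1)).erase β).card = m - 1 := by
    rw [Finset.card_erase_of_mem hβ]; simp
  have hmem : ∀ i ∈ (Finset.Ico 1 (m + 1)).erase β, i ≠ β ∧ 1 ≤ i ∧ i < m + 1 := by
    intro i hi; simpa using hi
  have hs : ∀ w, w ≠ 0 → (∀ i ∈ (Finset.Ico 1 (m + 1)).erase β, w + z i ≠ 0) →
      GBfun lam g (m + 1 - 1) ρ (slotAt z w ((Finset.Ico 1 (m + 1)).erase β)) =
      cst lam (m - 1) * ev ρ (Function.update z 0 w) (W bs g ((Finset.Ico 1 (m + 1)).erase β)) := by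
    intro w hw h
    have := GBfun_slot (g := g) (I := (Finset.Ico 1 (m + 1)).erase β) hb hG ?_ (by simp) ρ z w hρ hw
      (fun i hi => ⟨hz i (hmem i hi).2.2, h i hi⟩)
    · rwa [hc, show m - 1 + 1 = m + 1 - 1 by omega] at this
    · rcases hgm with h | h
      · exact Or.inl h
      · right
        rw [← Finset.card_pos.trans Finset.nonempty_iff_ne_empty]; omega
  have e1 : ∀ᶠ t in nhds (z β), t ≠ 0 := eventually_ne_nhds hzβ
  have e2 : ∀ᶠ t in nhds (z β), ∀ i ∈ (Finset.Ico 1 (m + 1)).erase β, t + z i ≠ 0 := by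
    rw [Filter.eventually_all_finset]
    intro i hi
    refine ContinuousAt.eventually_ne (by fun_prop) ?_
    obtain ⟨h1, h2, h3⟩ := hmem i hi
    exact (hzz β i hβ'.2 h3 h1.symm).2
  have hD := (hd.const_mul (cst lam (m - 1))).congr_of_eventuallyEq (f₁ := fun t : ℂ =>
      (GBfun lam g (m + 1 - 1) ρ (slotAt z (z 0) ((Finset.Ico 1 (m + 1)).erase β))
          - GBfun lam g (m + 1 - 1) ρ (slotAt z t ((Finset.Ico 1 (m + 1)).erase β))) / ((z 0) ^ 2 - t ^ 2)) (by
    filter_upwards [e1, e2] with t h1 h2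
    rw [hs t h1 h2, hs (z 0) (hz 0 (by omega)) (fun i hi => by
      obtain ⟨h1, h2, h3⟩ := hmem i hi
      exact (hzz 0 i (by omega) h3 (by omega)).2), Function.update_eq_self]
    ring)
  rw [Finset.sdiff_singleton_eq_erase, hD.deriv]
  field_simp
end

lemma master {a b s nbar : ℝ} {r : ℝ → ℝ}
    (ha : 0 < a) (hab : a < b) (hr : ContinuousOn r (Set.Icc a b)) (hρ0 : moment a b s r 0 ≠ 0)
    {lam : ℝ} {bs : ℕ → PR} {g m : ℕ} (hb : Base bs) (hG : ∀ g, g ≠ 0 → IsG lam g (bs g))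
    (hm : 1 ≤ m) (hgm : g ≠ 0 ∨ 2 ≤ m)
    {z : ℕ → ℂ} (hz0 : Admissible a b (z 0))
    (hz : ∀ i, i < m + 1 → z i ≠ 0)
    (hzz : ∀ i j, i < m + 1 → j < m + 1 → i ≠ j → z i ≠ z j ∧ z i + z j ≠ 0) (d : ℕ → ℂ)
    (hd : ∀ β ∈ Finset.Ico 1 (m + 1),
      HasDerivAt (fun t : ℂ => (ev (moment a b s r) z (W bs g ((Finset.Ico 1 (m + 1)).erase β))
      - ev (moment a b s r) (Function.update z 0 t) (W bs g ((Finset.Ico 1 (m + 1)).erase β))) / ((z 0) ^ 2 - t ^ 2))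
      (z β * d β) (z β))
    (hE : ev (moment a b s r) z (KK (W bs g (Finset.Ico 1 (m + 1))))
      + (if g = 0 then 0 else (kapp lam : ℂ) * ev (moment a b s r) z (AA 0 (W bs (g - 1) (Finset.Ico 1 (m + 1)))))
      + ((1 / 2) * ∑ h ∈ Finset.range (g + 1), ∑ I ∈ (Finset.Ico 1 (m + 1)).powerset,
        ev (moment a b s r) z (Wo bs h I) * ev (moment a b s r) z (Wo bs (g - h) (Finset.Ico 1 (m + 1) \ I)))
      + ∑ β ∈ Finset.Ico 1 (m + 1), d β = 0) :
    0 = Khat a b s nbar r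
          (fun w => GBfun lam g (m + 1) (moment a b s r) (Function.update z 0 w)) (z 0)
      + (if g = 0 then 0 else
          (lam : ℂ) * ((2 * (lam : ℂ)) ^ 3 *
            AdagVar (Finset.range (m + 1)) (m + 1) (GBfun lam (g - 1) (m + 1)) (moment a b s r)
              (Function.update z (m + 1) (z 0))))
      + (lam : ℂ) * ∑ h ∈ Finset.range (g + 1), ∑ I ∈ (Finset.Ico 1 (m + 1)).powerset,
          (if 1 ≤ I.card ∧ I.card ≤ m + 1 - 2 then
            GBfun lam h (I.card + 1) (moment a b s r) (slotAt z (z 0) I) *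
              GBfun lam (g - h) (((Finset.Ico 1 (m + 1)) \ I).card + 1) (moment a b s r)
                (slotAt z (z 0) ((Finset.Ico 1 (m + 1)) \ I))
           else 0)
      + ∑ h ∈ Finset.Icc 1 g,
          Gfun lam h (moment a b s r) (z 0) * GBfun lam (g - h) (m + 1) (moment a b s r) z
      + (if m + 1 = 2 then (2 * (lam : ℂ)) ^ 2 else (2 * (lam : ℂ)) ^ 3) *
          ∑ β ∈ Finset.Ico 1 (m + 1), (1 / z β) *
            deriv (fun t : ℂ =>
              (GBfun lam g (m + 1 - 1) (moment a b s r)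
                  (slotAt z (z 0) ((Finset.Ico 1 (m + 1)) \ {β}))
                - GBfun lam g (m + 1 - 1) (moment a b s r)
                    (slotAt z t ((Finset.Ico 1 (m + 1)) \ {β})))
              / ((z 0) ^ 2 - t ^ 2)) (z β) := by
  have hJ : ∀ i ∈ Finset.Ico 1 (m + 1), 0 < i ∧ i < m + 1 := fun i hi => by simp at hi; omega
  have hgz : GoodZ (m + 1) z := by
    intro i hi
    refine ⟨hz i hi, ?_⟩
    by_cases h : i = 0
    · rw [h, ← two_mul]; exact mul_ne_zero two_ne_zero hz0.1
    · exact (hzz 0 i (by omega) hi (Ne.symm h)).2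
  have hW : W bs g (Finset.Ico 1 (m + 1)) ∈ Odd0 (m + 1) := W_Odd0 hb (by omega) hJ (by simpa using hgm)
  have t1 := Khat_ev ha hab hr s nbar hz0 hW (cst lam m)
    (fun w => GBfun lam g (m + 1) (moment a b s r) (Function.update z 0 w))
    ((Finset.Ico 1 (m + 1)).image (fun i => - z i)) (by
      simp only [Finset.mem_image, not_exists, not_and]
      intro i hi h
      obtain ⟨h1, h2⟩ := hJ i hi
      exact (hgz i h2).2 (by rw [← h]; ring)) (by
      intro w hw hS
      refine GBfun_ev hb hG (Or.inr (by omega)) _ _ hρ0 ?_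
      intro i hi
      by_cases h : i = 0
      · rw [h, Function.update_self, ← two_mul]; exact ⟨hw, mul_ne_zero two_ne_zero hw⟩
      · rw [Function.update_of_ne h, Function.update_self]
        refine ⟨hz i hi, fun e => hS ?_⟩
        rw [Finset.mem_image]
        exact ⟨i, Finset.mem_Ico.2 (by omega), (eq_neg_of_add_eq_zero_left e).symm⟩)
  rw [t1, add_assoc (_ + _) (_ * _) (∑ h ∈ Finset.Icc 1 g, _), prod_term hb hG hm hρ0 hgz,
    diag_term hb hG hm hρ0 hgz,
    Finset.sum_congr rfl (fun β hβ => deriv_term hb hG hρ0 hm hgm hz hzz hβ (d β) (hd β hβ)),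
    ← Finset.mul_sum, ← mul_assoc (if m + 1 = 2 then _ else _), cst_succ lam hm]
  have := congrArg (fun x => cst lam m * x) hE
  simp only [mul_zero] at this
  refine this.symm.trans ?_
  split_ifs <;> ring

lemma ev_EE (bs : ℕ → PR) (κ : ℝ) (g : ℕ) (J : Finset ℕ) (ρ : ℕ → ℝ) (z : ℕ → ℂ) :
    ev ρ z (EE bs κ g J) = ev ρ z (KK (W bs g J))
      + (if g = 0 then 0 else (κ : ℂ) * ev ρ z (AA 0 (W bs (g - 1) J)))
      + ((1 / 2) * ∑ h ∈ Finset.range (g + 1), ∑ I ∈ J.powerset,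
        ev ρ z (Wo bs h I) * ev ρ z (Wo bs (g - h) (J \ I)))
      + ∑ β ∈ J, ev ρ z (UU β (W bs g (J.erase β))) := by
  unfold EE
  simp only [map_add, map_smul, map_sum, map_mul, Complex.real_smul]
  congr 2
  · congr 1
    split_ifs <;> simp
  · push_cast; rfl

/-- The derivative term of the planar three-boundary equation. -/
def dd (z c t : ℂ) : ℂ :=
  ((c * (t + c) ^ 2 + 2 * t * c * (t + c)) / (t * c * (t + c) ^ 2) ^ 2 * (z ^ 2 - t ^ 2)
    + 2 * t * ((z * c * (z + c) ^ 2)⁻¹ - (t * c * (t + c) ^ 2)⁻¹)) / (z ^ 2 - t ^ 2) ^ 2 / t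

lemma dd_deriv {z c t : ℂ} (ht : t ≠ 0) (hc : c ≠ 0) (htc : t + c ≠ 0) (hzt : z ^ 2 - t ^ 2 ≠ 0) :
    HasDerivAt (fun t : ℂ => ((z * c * (z + c) ^ 2)⁻¹ - (t * c * (t + c) ^ 2)⁻¹) / (z ^ 2 - t ^ 2))
      (t * dd z c t) t := by
  have h1 : HasDerivAt (fun t : ℂ => t * c * (t + c) ^ 2) (c * (t + c) ^ 2 + t * c * (2 * (t + c))) t := by
    have ha : HasDerivAt (fun t : ℂ => t * c) c t := by simpa using (hasDerivAt_id' t).mul_const c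
    have hb : HasDerivAt (fun t : ℂ => (t + c) ^ 2) (2 * (t + c)) t := by
      refine HasDerivAt.congr_deriv (((hasDerivAt_id' t).add_const c).pow 2) ?_
      simp
    exact ha.mul hb
  have hne : t * c * (t + c) ^ 2 ≠ 0 := mul_ne_zero (mul_ne_zero ht hc) (pow_ne_zero _ htc)
  have h2 := (((h1.inv hne).const_sub ((z * c * (z + c) ^ 2)⁻¹)).div
    ((hasDerivAt_pow 2 t).const_sub (z ^ 2)) hzt)
  refine HasDerivAt.congr_deriv h2 ?_
  unfold dd
  simp only [Pi.inv_apply]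
  push_cast
  rw [mul_div_cancel₀ _ ht]
  congr 1
  ring

lemma planar3 {z c t : ℂ} (hz : z ≠ 0) (ht : t ≠ 0) (hc : c ≠ 0) (htc : t + c ≠ 0) (hzt : z + t ≠ 0)
    (hzc : z + c ≠ 0) (hzt' : z - t ≠ 0) (hzc' : z - c ≠ 0) :
    -(z⁻¹ ^ 2 * t⁻¹ ^ 3 * c⁻¹ ^ 3) + (z * t * (z + t) ^ 2)⁻¹ * (z * c * (z + c) ^ 2)⁻¹ + dd z c t + dd z t c = 0 := by
  unfold dd
  rw [sq_sub_sq z t, sq_sub_sq z c, add_comm c t]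
  simp only [inv_pow]
  field_simp
  ring

lemma final {a b s nbar : ℝ} {r : ℝ → ℝ}
    (ha : 0 < a) (hab : a < b) (hr : ContinuousOn r (Set.Icc a b)) (hρ0 : moment a b s r 0 ≠ 0)
    (lam : ℝ) {g m : ℕ} (hm : 1 ≤ m) (hgm : g ≠ 0 ∨ 2 ≤ m)
    {z : ℕ → ℂ} (hz0 : Admissible a b (z 0))
    (hz : ∀ i, i < m + 1 → z i ≠ 0)
    (hzz : ∀ i j, i < m + 1 → j < m + 1 → i ≠ j → z i ≠ z j ∧ z i + z j ≠ 0) :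
    0 = Khat a b s nbar r
          (fun w => GBfun lam g (m + 1) (moment a b s r) (Function.update z 0 w)) (z 0)
      + (if g = 0 then 0 else
          (lam : ℂ) * ((2 * (lam : ℂ)) ^ 3 *
            AdagVar (Finset.range (m + 1)) (m + 1) (GBfun lam (g - 1) (m + 1)) (moment a b s r)
              (Function.update z (m + 1) (z 0))))
      + (lam : ℂ) * ∑ h ∈ Finset.range (g + 1), ∑ I ∈ (Finset.Ico 1 (m + 1)).powerset,
          (if 1 ≤ I.card ∧ I.card ≤ m + 1 - 2 then
            GBfun lam h (I.card + 1) (moment a b s r) (slotAt z (z 0) I) *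
              GBfun lam (g - h) (((Finset.Ico 1 (m + 1)) \ I).card + 1) (moment a b s r)
                (slotAt z (z 0) ((Finset.Ico 1 (m + 1)) \ I))
           else 0)
      + ∑ h ∈ Finset.Icc 1 g,
          Gfun lam h (moment a b s r) (z 0) * GBfun lam (g - h) (m + 1) (moment a b s r) z
      + (if m + 1 = 2 then (2 * (lam : ℂ)) ^ 2 else (2 * (lam : ℂ)) ^ 3) *
          ∑ β ∈ Finset.Ico 1 (m + 1), (1 / z β) *
            deriv (fun t : ℂ =>
              (GBfun lam g (m + 1 - 1) (moment a b s r)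
                  (slotAt z (z 0) ((Finset.Ico 1 (m + 1)) \ {β}))
                - GBfun lam g (m + 1 - 1) (moment a b s r)
                    (slotAt z t ((Finset.Ico 1 (m + 1)) \ {β})))
              / ((z 0) ^ 2 - t ^ 2)) (z β) := by
  obtain ⟨bs, hb, hG⟩ := exists_base lam
  have hJ : ∀ i ∈ Finset.Ico 1 (m + 1), 0 < i ∧ i < m + 1 := fun i hi => by simp at hi; omega
  have hgz : GoodZ (m + 1) z := by
    intro i hi
    refine ⟨hz i hi, ?_⟩
    by_cases h : i = 0
    · rw [h, ← two_mul]; exact mul_ne_zero two_ne_zero hz0.1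
    · exact (hzz 0 i (by omega) hi (Ne.symm h)).2
  have hsq : ∀ i, 0 < i → i < m + 1 → z 0 ^ 2 - z i ^ 2 ≠ 0 := by
    intro i h1 h2
    rw [sq_sub_sq]
    exact mul_ne_zero (hgz i h2).2 (sub_ne_zero.2 (hzz 0 i (by omega) h2 (by omega)).1)
  by_cases h3 : g ≠ 0 ∨ 3 ≤ m
  · refine master ha hab hr hρ0 hb hG hm hgm hz0 hz hzz
      (fun β => ev (moment a b s r) z (UU β (W bs g ((Finset.Ico 1 (m + 1)).erase β)))) ?_ ?_
    · intro β hβ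
      obtain ⟨h1, h2⟩ := hJ β hβ
      refine deriv_poly (n := m + 1) hz0.1 (hz β h2) (hgz β h2).2 (hzz 0 β (by omega) h2 (by omega)).1
        (W_Odd0 hb (by omega) (fun i hi => hJ i (Finset.mem_of_mem_erase hi)) ?_)
      rcases h3 with h3 | h3
      · exact Or.inl h3
      · right; rw [Finset.card_erase_of_mem hβ, Nat.card_Ico]; omega
    · rw [← ev_EE]
      by_cases hg : g = 0
      · subst hg
        exact EE_zero hb _ (by omega) hJ (by simp; omega) _ _ hρ0 hgz
      · exact EE_pos hb _ hg (by omega) (one_boundary lam hb hG hg (by omega)) hJ _ _ hρ0 hgz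
  · obtain ⟨rfl, rfl⟩ : g = 0 ∧ m = 2 := by omega
    have hI : Finset.Ico 1 (2 + 1) = {1, 2} := by decide
    have e1 : ({1, 2} : Finset ℕ).erase 1 = {2} := by decide
    have e2 : ({1, 2} : Finset ℕ).erase 2 = {1} := by decide
    refine master ha hab hr hρ0 hb hG hm hgm hz0 hz hzz
      (fun β => if β = 1 then dd (z 0) (z 2) (z 1) else dd (z 0) (z 1) (z 2)) ?_ ?_
    · rw [hI]
      intro β hβ
      simp only [Finset.mem_insert, Finset.mem_singleton] at hβ
      rcases hβ with rfl | rfl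
      · rw [e1, W_single hb, if_pos rfl]
        simp only [ev_q, Function.update_self, Function.update_of_ne (show (2 : ℕ) ≠ 0 by omega)]
        exact dd_deriv (hz 1 (by omega)) (hz 2 (by omega)) (hzz 1 2 (by omega) (by omega) (by omega)).2
          (hsq 1 (by omega) (by omega))
      · rw [e2, W_single hb, if_neg (by omega)]
        simp only [ev_q, Function.update_self, Function.update_of_ne (show (1 : ℕ) ≠ 0 by omega)]
        exact dd_deriv (hz 2 (by omega)) (hz 1 (by omega)) (hzz 2 1 (by omega) (by omega) (by omega)).2
          (hsq 2 (by omega) (by omega))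
    · have hp : ({1, 2} : Finset ℕ).powerset = {∅, {1}, {2}, {1, 2}} := by decide
      have s1 : ({1, 2} : Finset ℕ) \ {1} = {2} := by decide
      have s2 : ({1, 2} : Finset ℕ) \ {2} = {1} := by decide
      have w0 : Wo bs 0 ∅ = 0 := by simp [Wo]
      have w1 : ∀ i : ℕ, Wo bs 0 {i} = qq i := fun i => by rw [Wo, if_neg (by simp), W_single hb]
      have hK : ev (moment a b s r) z (KK (W bs 0 {1, 2})) = -((z 0)⁻¹ ^ 2 * (z 1)⁻¹ ^ 3 * (z 2)⁻¹ ^ 3) := by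
        have hc : -(uu * xx 1 ^ 3 * xx 2 ^ 3) ∈ S0 3 :=
          neg_mem (mul_mem (mul_mem (u_mem 3) (pow_mem (x_mem (by omega)) 3)) (pow_mem (x_mem (by omega)) 3))
        have hk := KK_mul hc 0
        rw [W_pair hb (by omega), show -(uu * xx 1 ^ 3 * xx 0 ^ 3 * xx 2 ^ 3)
          = -(uu * xx 1 ^ 3 * xx 2 ^ 3) * xx 0 ^ (2 * 0 + 3) by ring, hk, kap]
        have hc0 : ((moment a b s r 0 : ℝ) : ℂ) ≠ 0 := by exact_mod_cast hρ0
        simp only [map_mul, map_neg, map_pow, ev_u, ev_x, ev_r]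
        field_simp
      rw [hI, hK, if_pos rfl, hp, zero_add, Finset.sum_range_one,
        Finset.sum_insert (by decide), Finset.sum_insert (by decide), Finset.sum_insert (by decide),
        Finset.sum_singleton, w0, s1, s2, w1, w1, Finset.sdiff_self, w0, Finset.sum_pair (by omega), if_pos rfl,
        if_neg (by omega), ev_q, ev_q, map_zero]
      refine Eq.trans ?_ (planar3 (hz 0 (by omega)) (hz 1 (by omega)) (hz 2 (by omega))
        (hzz 1 2 (by omega) (by omega) (by omega)).2 (hgz 1 (by omega)).2 (hgz 2 (by omega)).2
        (sub_ne_zero.2 (hzz 0 1 (by omega) (by omega) (by omega)).1)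
        (sub_ne_zero.2 (hzz 0 2 (by omega) (by omega) (by omega)).1))
      ring

end NCQFT

open NCQFT in
/-- The linear Dyson–Schwinger equation for the multi-boundary functions
(`J = {2,…,B}`, realized as coordinates `1,…,B−1`; `ϱ` = moments of the measure). -/
theorem stmt13 (a b s nbar : ℝ) (r : ℝ → ℝ)
    (ha : 0 < a) (hab : a < b)
    (hr : ContinuousOn r (Set.Icc a b)) (hrpos : ∀ y ∈ Set.Icc a b, 0 ≤ r y)
    (hs : 0 < s) (hρ0 : moment a b s r 0 ≠ 0)
    (lam : ℝ) (hlam : lam ≠ 0) (g B : ℕ) (hB : 2 ≤ B) (hgB : 2 < 2 * g + B)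
    (z : ℕ → ℂ) (hz0 : Admissible a b (z 0))
    (hz : ∀ i, i < B → z i ≠ 0)
    (hzz : ∀ i j, i < B → j < B → i ≠ j → z i ≠ z j ∧ z i + z j ≠ 0) :
    0 = Khat a b s nbar r
          (fun w => GBfun lam g B (moment a b s r) (Function.update z 0 w)) (z 0)
      + (if g = 0 then 0 else
          (lam : ℂ) * ((2 * (lam : ℂ)) ^ 3 *
            AdagVar (Finset.range B) B (GBfun lam (g - 1) B) (moment a b s r)
              (Function.update z B (z 0))))
      + (lam : ℂ) * ∑ h ∈ Finset.range (g + 1), ∑ I ∈ (Finset.Ico 1 B).powerset,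
          (if 1 ≤ I.card ∧ I.card ≤ B - 2 then
            GBfun lam h (I.card + 1) (moment a b s r) (slotAt z (z 0) I) *
              GBfun lam (g - h) (((Finset.Ico 1 B) \ I).card + 1) (moment a b s r)
                (slotAt z (z 0) ((Finset.Ico 1 B) \ I))
           else 0)
      + ∑ h ∈ Finset.Icc 1 g,
          Gfun lam h (moment a b s r) (z 0) * GBfun lam (g - h) B (moment a b s r) z
      + (if B = 2 then (2 * (lam : ℂ)) ^ 2 else (2 * (lam : ℂ)) ^ 3) *
          ∑ β ∈ Finset.Ico 1 B, (1 / z β) *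
            deriv (fun t : ℂ =>
              (GBfun lam g (B - 1) (moment a b s r)
                  (slotAt z (z 0) ((Finset.Ico 1 B) \ {β}))
                - GBfun lam g (B - 1) (moment a b s r)
                    (slotAt z t ((Finset.Ico 1 B) \ {β})))
              / ((z 0) ^ 2 - t ^ 2)) (z β) := by
  obtain ⟨m, rfl⟩ : ∃ m, B = m + 1 := ⟨B - 1, by omega⟩
  exact final ha hab hr hρ0 lam (by omega) (by omega) hz0 hz hzz
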